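/- Let n ≥ 2 and let g be a Riemannian metric on the sphere S^n conformal to the round metric g₀. Then λ₂(S^n,g) · Vol_g(S^n)^{2/n} < K_n · n · (2σ_n)^{2/n}, where λ₂(S^n,g) is the second nonzero eigenvalue of the Laplace–Beltrami operator of g. -/

import Mathlib

open MeasureTheory Metric Real Filter Set
open scoped RealInnerProductSpace ENNReal NNReal Topology Classical

noncomputable section

/-- Ambient Euclidean space `ℝ^{n+1}`. -/
abbrev Eu (n : ℕ) : Type := EuclideanSpace ℝ (Fin (n + 1))

/-- The unit sphere `S^n ⊆ ℝ^{n+1}` as a subset of the ambient space. -/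
def sphSet (n : ℕ) : Set (Eu n) := Metric.sphere (0 : Eu n) 1

/-- The canonical (round) volume measure of `S^n`, viewed as a measure on the
ambient space `ℝ^{n+1}` supported on the unit sphere. -/
def sphMeasure (n : ℕ) : Measure (Eu n) :=
  Measure.map Subtype.val ((volume : Measure (Eu n)).toSphere)

/-- `σ_n`, the volume of the round unit `n`-sphere. -/
def sigmaVol (n : ℕ) : ℝ := (sphMeasure n Set.univ).toReal

/-- The constant `K_n`. -/
def Kconst (n : ℕ) : ℝ :=
  ((n + 1 : ℝ) / n) *
    ((Real.Gamma n * Real.Gamma ((n + 1) / 2)) /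
      (Real.Gamma (n + 1 / 2) * Real.Gamma (n / 2))) ^ ((2 : ℝ) / n)

/-- The linear coordinate function `X_s(x) = s · x`. -/
def Xfun {n : ℕ} (s x : Eu n) : ℝ := ⟪s, x⟫

/-- The tangential gradient on the sphere of (the restriction of) an ambient function:
`∇_{S^n} f (x) = ∇f(x) - ⟨∇f(x), x⟩ x`. -/
def gradS {n : ℕ} (f : Eu n → ℝ) (x : Eu n) : Eu n :=
  gradient f x - ⟪gradient f x, x⟫ • x

/-- A conformal factor `w` represents the metric `g = w² g₀` on `S^n`; it is admissible if it
is smooth and positive on the sphere. -/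
def IsConformalFactor (n : ℕ) (w : Eu n → ℝ) : Prop :=
  ContDiff ℝ (⊤ : ℕ∞) w ∧ ∀ x ∈ sphSet n, 0 < w x

/-- The Riemannian measure `dv_g` of the conformal metric `g = w² g₀`, i.e. `w^n dv_{g₀}`. -/
def confMeasure (n : ℕ) (w : Eu n → ℝ) : Measure (Eu n) :=
  (sphMeasure n).withDensity fun x => ENNReal.ofReal (w x ^ n)

/-- The volume of `(S^n, g)`, `g = w² g₀`. -/
def confVol (n : ℕ) (w : Eu n → ℝ) : ℝ := (confMeasure n w Set.univ).toReal

/-- The Dirichlet energy `∫ |∇_g u|²_g dv_g` of the restriction to `S^n` of `V`,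
for `g = w² g₀`: it equals `∫ w^{n-2} |∇_{g₀} V|²_{g₀} dv_{g₀}`. -/
def dirichlet (n : ℕ) (w : Eu n → ℝ) (V : Eu n → ℝ) : ℝ :=
  ∫ x, w x ^ (n - 2) * ‖gradS V x‖ ^ 2 ∂(sphMeasure n)

/-- `∫ u² dv_g`. -/
def l2sq (n : ℕ) (w : Eu n → ℝ) (V : Eu n → ℝ) : ℝ :=
  ∫ x, (V x) ^ 2 ∂(confMeasure n w)

/-- Mean value zero w.r.t. `dv_g`. -/
def MeanZero (n : ℕ) (w : Eu n → ℝ) (V : Eu n → ℝ) : Prop :=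
  ∫ x, V x ∂(confMeasure n w) = 0

/-- The second nonzero eigenvalue `λ₂(S^n, g)` of the Laplace–Beltrami operator of
`g = w² g₀`, defined via the Courant–Fischer min-max characterization over two-dimensional
spaces of mean-zero test functions (restrictions of smooth ambient functions). -/
def lambda2 (n : ℕ) (w : Eu n → ℝ) : ℝ :=
  sInf { Λ : ℝ | ∃ V W : Eu n → ℝ, ContDiff ℝ (⊤ : ℕ∞) V ∧ ContDiff ℝ (⊤ : ℕ∞) W ∧
    MeanZero n w V ∧ MeanZero n w W ∧
    (∀ a b : ℝ, (∀ x ∈ sphSet n, a * V x + b * W x = 0) → a = 0 ∧ b = 0) ∧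
    Λ = sSup { q : ℝ | ∃ a b : ℝ, ¬(a = 0 ∧ b = 0) ∧
      q = dirichlet n w (fun x => a * V x + b * W x) /
          l2sq n w (fun x => a * V x + b * W x) } }

/-- The conformal transformation `d_ξ` of the closed unit ball. -/
def dMap {n : ℕ} (ξ : Eu n) (x : Eu n) : Eu n :=
  (1 + 2 * ⟪ξ, x⟫ + ‖x‖ ^ 2 * ‖ξ‖ ^ 2)⁻¹ •
    ((1 - ‖ξ‖ ^ 2) • x + (1 + 2 * ⟪ξ, x⟫ + ‖x‖ ^ 2) • ξ)

/-- The reflection `R_p(x) = x - 2(p·x)p`. -/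
def Refl {n : ℕ} (p x : Eu n) : Eu n := x - (2 * ⟪p, x⟫) • p

/-- The spherical cap `a_{r,p} = d_{rp}(a_{0,p})`. -/
def cap (n : ℕ) (r : ℝ) (p : Eu n) : Set (Eu n) :=
  dMap (r • p) '' {x ∈ sphSet n | 0 < ⟪p, x⟫}

/-- The conformal reflection `τ_{a_{r,p}} = d_{rp} ∘ R_p ∘ d_{-rp}`. -/
def tauMap {n : ℕ} (r : ℝ) (p : Eu n) : Eu n → Eu n :=
  dMap (r • p) ∘ Refl p ∘ dMap (-(r • p))

/-- The measure `μ_{a_{r,p}}`, equal to `dv_g + (τ_a)^* dv_g` on `a` and `0` on `a^*`. -/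
def capMeasure (n : ℕ) (w : Eu n → ℝ) (r : ℝ) (p : Eu n) : Measure (Eu n) :=
  (confMeasure n w + Measure.map (tauMap r p) (confMeasure n w)).restrict (cap n r p)

/-- `d_ξ` renormalizes the finite measure `μ`: `∫ X_s ∘ d_ξ dμ = 0` for all `s ∈ S^n`. -/
def Renormalizes {n : ℕ} (ξ : Eu n) (μ : Measure (Eu n)) : Prop :=
  ∀ s ∈ sphSet n, ∫ x, Xfun s (dMap ξ x) ∂μ = 0

/-- The quadratic form `Q(s) = ∫ X_s² dν` of a measure `ν`. -/
def Qform {n : ℕ} (ν : Measure (Eu n)) (s : Eu n) : ℝ := ∫ x, (⟪s, x⟫ : ℝ) ^ 2 ∂ν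

/-- The maximal eigenvalue of the quadratic form `Q`. -/
def maxEig (n : ℕ) (ν : Measure (Eu n)) : ℝ :=
  sSup { q : ℝ | ∃ s : Eu n, ‖s‖ = 1 ∧ q = Qform ν s }

/-- `ν` is simple with (unit) maximal direction `s₀`: the eigenspace of the maximal
eigenvalue of `Q` is the line spanned by `s₀`. -/
def IsMaxDir {n : ℕ} (ν : Measure (Eu n)) (s₀ : Eu n) : Prop :=
  ‖s₀‖ = 1 ∧ ∀ s : Eu n, Qform ν s = maxEig n ν * ‖s‖ ^ 2 ↔ ∃ c : ℝ, s = c • s₀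

/-- `ν` is multiple: the eigenspace of the maximal eigenvalue of `Q` has dimension ≥ 2. -/
def IsMultiple {n : ℕ} (ν : Measure (Eu n)) : Prop :=
  ∃ s t : Eu n, Qform ν s = maxEig n ν * ‖s‖ ^ 2 ∧ Qform ν t = maxEig n ν * ‖t‖ ^ 2 ∧
    LinearIndependent ℝ ![s, t]

/-- The test function `u_a^s` (for `a = a_{r,p}` with renormalization point `ξ`):
`X_s ∘ d_ξ` on `a` and `X_s ∘ d_ξ ∘ τ_a` on `a^*`. -/
def testFun (n : ℕ) (ξ : Eu n) (r : ℝ) (p : Eu n) (s : Eu n) (x : Eu n) : ℝ :=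
  if 0 < ⟪p, dMap (-(r • p)) x⟫ then Xfun s (dMap ξ x) else Xfun s (dMap ξ (tauMap r p x))

/-- The first coordinate vector `e₁ ∈ ℝ^{n+1}`. -/
def e1 (n : ℕ) : Eu n := EuclideanSpace.single 0 1

section

open Polynomial in
/-- If the integrals over a compact set of a polynomial with continuous coefficients vanish for
all large values of the variable, then so does the integral of the constant coefficient. -/
lemma setIntegral_coeff_zero_of_eventually {E : Type*} [TopologicalSpace E] [T2Space E]
    [MeasurableSpace E] [BorelSpace E] {μ : Measure E} [IsFiniteMeasureOnCompacts μ] {K : Set E}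
    (hK : IsCompact K) (q : C(E, ℝ)[X])
    (h : ∀ᶠ ε : ℝ in atTop, ∫ x in K, (q.eval (algebraMap ℝ C(E, ℝ) ε)) x ∂μ = 0) :
    ∫ x in K, (q.coeff 0) x ∂μ = 0 := by
  let r : ℝ[X] := ∑ i ∈ Finset.range (q.natDegree + 1), monomial i (∫ x in K, (q.coeff i) x ∂μ)
  have hr : ∀ ε : ℝ, r.eval ε = ∫ x in K, (q.eval (algebraMap ℝ C(E, ℝ) ε)) x ∂μ := by
    intro ε
    simp only [r, eval_finsetSum, eval_monomial]
    have : ∀ x, (q.eval (algebraMap ℝ C(E, ℝ) ε)) x =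
        ∑ i ∈ Finset.range (q.natDegree + 1), (q.coeff i) x * ε ^ i := by
      intro x
      rw [eval_eq_sum_range]
      simp [ContinuousMap.sum_apply]
    simp_rw [this]
    rw [integral_finsetSum]
    · refine Finset.sum_congr rfl fun i _ => ?_
      rw [integral_mul_const]
    · intro i _
      exact ((q.coeff i).continuous.mul continuous_const).continuousOn.integrableOn_compact hK
  have h0 : r = 0 := by
    refine Polynomial.eq_zero_of_infinite_isRoot r ?_
    obtain ⟨a, ha⟩ := eventually_atTop.1 h
    refine (Ici_infinite a).mono fun ε hε => ?_
    simp only [mem_ofPred_eq, IsRoot.def, hr]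
    exact ha ε hε
  have h1 := hr 0
  rw [h0] at h1
  simp only [eval_zero, map_zero] at h1
  rw [h1]
  simp [Polynomial.coeff_zero_eq_eval_zero]

variable {ι : Type*} [Fintype ι]

/-- A large dilation plus a compactly supported `C¹` map is a bijection of a ball onto the
dilated ball. -/
lemma image_smul_add_closedBall {g : EuclideanSpace ℝ ι → EuclideanSpace ℝ ι} {C : ℝ≥0}
    (hL : LipschitzWith C g) {R : ℝ} (hR : ∀ x, x ∉ closedBall 0 R → g x = 0) {ε : ℝ}
    (hε : (C : ℝ) < ε) :
    Function.Injective (fun x => ε • x + g x) ∧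
    (fun x => ε • x + g x) '' closedBall 0 R = (fun x => ε • x) '' closedBall 0 R := by
  have hε0 : 0 < ε := lt_of_le_of_lt C.2 hε
  have hinj : Function.Injective (fun x => ε • x + g x) := by
    intro x y hxy
    by_contra hne
    have h1 : ε • (x - y) = g y - g x := by
      simp only at hxy
      rw [smul_sub, sub_eq_sub_iff_add_eq_add, hxy, add_comm]
    have h2 := hL.dist_le_mul y x
    rw [dist_eq_norm, dist_eq_norm, ← h1, norm_smul, Real.norm_of_nonneg hε0.le,
      norm_sub_rev y x] at h2
    have h3 : 0 < ‖x - y‖ := norm_pos_iff.2 (sub_ne_zero.2 hne)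
    nlinarith
  refine ⟨hinj, ?_⟩
  have hsurj : Function.Surjective (fun x => ε • x + g x) := by
    intro y
    let K : ℝ≥0 := C / Real.toNNReal ε
    have hKc : (K : ℝ) = C / ε := by simp [K, Real.coe_toNNReal ε hε0.le]
    have hK : K < 1 := by
      rw [← NNReal.coe_lt_coe, hKc, NNReal.coe_one, div_lt_one hε0]
      exact hε
    have hc : ContractingWith K (fun x => ε⁻¹ • (y - g x)) := by
      refine ⟨hK, LipschitzWith.of_dist_le_mul fun a b => ?_⟩
      rw [dist_smul₀, dist_sub_left, Real.norm_of_nonneg (inv_nonneg.2 hε0.le)]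
      have := hL.dist_le_mul a b
      rw [hKc, div_eq_inv_mul, mul_assoc]
      gcongr
    refine ⟨hc.fixedPoint, ?_⟩
    have h : ε⁻¹ • (y - g hc.fixedPoint) = hc.fixedPoint := hc.fixedPoint_isFixedPt
    rw [inv_smul_eq_iff₀ hε0.ne', sub_eq_iff_eq_add] at h
    exact h.symm
  ext y
  constructor
  · rintro ⟨x, hx, rfl⟩
    refine ⟨ε⁻¹ • (ε • x + g x), ?_, by simp [smul_inv_smul₀ hε0.ne']⟩
    by_contra hz
    have h1 := hR _ hz
    have : (ε⁻¹ • (ε • x + g x)) = x := by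
      apply hinj
      simp only [h1, add_zero]
      rw [smul_inv_smul₀ hε0.ne']
    rw [this] at hz
    exact hz hx
  · rintro ⟨x, hx, rfl⟩
    obtain ⟨z, hz⟩ := hsurj (ε • x)
    refine ⟨z, ?_, hz⟩
    by_contra hzn
    simp only [hR z hzn, add_zero] at hz
    rw [smul_right_injective _ hε0.ne' hz] at hzn
    exact hzn hx

/-- Change of variables for a large dilation plus a compactly supported `C¹` map. -/
lemma integral_comp_smul_add_mul_det {g : EuclideanSpace ℝ ι → EuclideanSpace ℝ ι}
    (hg : ContDiff ℝ 1 g) (hs : HasCompactSupport g) {R : ℝ}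
    (hR : ∀ x, x ∉ closedBall 0 R → g x = 0) (ψ : EuclideanSpace ℝ ι → ℝ) :
    ∀ᶠ ε : ℝ in atTop, ∫ x in closedBall 0 R, ψ (ε • x + g x) *
        (ε • ContinuousLinearMap.id ℝ (EuclideanSpace ℝ ι) + fderiv ℝ g x).det =
      ∫ x in closedBall 0 R, ψ (ε • x) * ε ^ Fintype.card ι := by
  obtain ⟨C, hC⟩ := hg.lipschitzWith_of_hasCompactSupport hs one_ne_zero
  have hdet : ∃ δ > 0, ∀ A : EuclideanSpace ℝ ι →L[ℝ] EuclideanSpace ℝ ι, ‖A‖ < δ →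
      0 < (ContinuousLinearMap.id ℝ (EuclideanSpace ℝ ι) + A).det := by
    have hc : Continuous fun A : EuclideanSpace ℝ ι →L[ℝ] EuclideanSpace ℝ ι =>
        (ContinuousLinearMap.id ℝ (EuclideanSpace ℝ ι) + A).det :=
      ContinuousLinearMap.continuous_det.comp (continuous_const.add continuous_id)
    have h0 : (0 : ℝ) < (ContinuousLinearMap.id ℝ (EuclideanSpace ℝ ι) + 0).det := by
      simp [ContinuousLinearMap.det]
    obtain ⟨δ, hδ, h⟩ := Metric.eventually_nhds_iff.1 (hc.continuousAt.eventually_const_lt h0)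
    exact ⟨δ, hδ, fun A hA => h (by simpa using hA)⟩
  obtain ⟨δ, hδ, hdet⟩ := hdet
  filter_upwards [eventually_gt_atTop (C : ℝ), eventually_gt_atTop (C / δ : ℝ)] with ε hε hε'
  have hε0 : 0 < ε := lt_of_le_of_lt C.2 hε
  obtain ⟨hinj, him⟩ := image_smul_add_closedBall hC hR hε
  have hder : ∀ x, HasFDerivAt (fun x => ε • x + g x)
      (ε • ContinuousLinearMap.id ℝ (EuclideanSpace ℝ ι) + fderiv ℝ g x) x := fun x =>
    ((hasFDerivAt_id x).const_smul ε).add (hg.differentiable one_ne_zero x).hasFDerivAt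
  have hpos : ∀ x, 0 < (ε • ContinuousLinearMap.id ℝ (EuclideanSpace ℝ ι) + fderiv ℝ g x).det := by
    intro x
    have : ε • ContinuousLinearMap.id ℝ (EuclideanSpace ℝ ι) + fderiv ℝ g x =
        ε • (ContinuousLinearMap.id ℝ (EuclideanSpace ℝ ι) + ε⁻¹ • fderiv ℝ g x) := by
      rw [smul_add, smul_inv_smul₀ hε0.ne']
    rw [this]
    have hd : (ε • (ContinuousLinearMap.id ℝ (EuclideanSpace ℝ ι) + ε⁻¹ • fderiv ℝ g x)).det =
        ε ^ Module.finrank ℝ (EuclideanSpace ℝ ι) *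
        (ContinuousLinearMap.id ℝ (EuclideanSpace ℝ ι) + ε⁻¹ • fderiv ℝ g x).det := by
      simp only [ContinuousLinearMap.det, ContinuousLinearMap.toLinearMap_smul, LinearMap.det_smul]
    rw [hd]
    refine mul_pos (pow_pos hε0 _) (hdet _ ?_)
    rw [norm_smul, norm_inv, Real.norm_of_nonneg hε0.le, inv_mul_lt_iff₀ hε0]
    calc ‖fderiv ℝ g x‖ ≤ C := norm_fderiv_le_of_lipschitz ℝ hC
      _ < ε * δ := by rwa [div_lt_iff₀ hδ] at hε'
  have h1 := integral_image_eq_integral_abs_det_fderiv_smul volume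
    (isClosed_closedBall (x := (0 : EuclideanSpace ℝ ι)) (ε := R)).measurableSet
    (fun x _ => (hder x).hasFDerivWithinAt) hinj.injOn ψ
  have h2 := integral_image_eq_integral_abs_det_fderiv_smul (f := fun x => ε • x) volume
    (isClosed_closedBall (x := (0 : EuclideanSpace ℝ ι)) (ε := R)).measurableSet
    (fun x _ => ((hasFDerivAt_id x).const_smul ε).hasFDerivWithinAt)
    (smul_right_injective _ hε0.ne').injOn ψ
  rw [him] at h1
  rw [h1] at h2
  simp only [smul_eq_mul] at h2
  calc _ = ∫ x in closedBall 0 R, |(ε • ContinuousLinearMap.id ℝ (EuclideanSpace ℝ ι) +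
        fderiv ℝ g x).det| * ψ (ε • x + g x) := by
        refine integral_congr_ae (Eventually.of_forall fun x => ?_)
        simp only [abs_of_pos (hpos x), mul_comm]
    _ = _ := by
        rw [h2]
        refine integral_congr_ae (Eventually.of_forall fun x => ?_)
        have hd : (ε • ContinuousLinearMap.id ℝ (EuclideanSpace ℝ ι)).det =
            ε ^ Fintype.card ι := by
          simp [ContinuousLinearMap.det, ContinuousLinearMap.toLinearMap_smul, LinearMap.det_smul]
        simp only [hd, abs_of_pos (pow_pos hε0 _), mul_comm]

end

section

variable {ι : Type*} [Fintype ι]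

/-- The determinant of a continuous endomorphism of Euclidean space as a matrix determinant. -/
lemma ContinuousLinearMap.det_eq_det_euclidean
    (A : EuclideanSpace ℝ ι →L[ℝ] EuclideanSpace ℝ ι) :
    A.det = (Matrix.of fun i j => A (EuclideanSpace.single j 1) i).det := by
  rw [ContinuousLinearMap.det,
    ← LinearMap.det_toMatrix (EuclideanSpace.basisFun ι ℝ).toBasis]
  congr 1

open Polynomial in
/-- `∫ ψ(g) det Dg = 0` for `g` of class `C¹` with compact support and polynomial `ψ`. -/
lemma integral_mvPolynomial_comp_mul_det_eq_zero [Nonempty ι]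
    {g : EuclideanSpace ℝ ι → EuclideanSpace ℝ ι}
    (hg : ContDiff ℝ 1 g) (hs : HasCompactSupport g) {R : ℝ}
    (hR : ∀ x, x ∉ closedBall 0 R → g x = 0) (p : MvPolynomial ι ℝ) :
    ∫ x in closedBall 0 R, MvPolynomial.eval (fun i => g x i) p * (fderiv ℝ g x).det = 0 := by
  let X' : ι → C(EuclideanSpace ℝ ι, ℝ) := fun i => ⟨fun x => x i, by fun_prop⟩
  let G : ι → C(EuclideanSpace ℝ ι, ℝ) := fun i =>
    ⟨fun x => g x i, by have := hg.continuous; fun_prop⟩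
  let D : ι → ι → C(EuclideanSpace ℝ ι, ℝ) := fun i j =>
    ⟨fun x => fderiv ℝ g x (EuclideanSpace.single j 1) i, by
      have := hg.continuous_fderiv one_ne_zero; fun_prop⟩
  let M : Matrix ι ι C(EuclideanSpace ℝ ι, ℝ)[X] :=
    Matrix.of fun i j => X * C (if i = j then 1 else 0) + C (D i j)
  let q : C(EuclideanSpace ℝ ι, ℝ)[X] :=
    MvPolynomial.aeval (fun i => C (X' i) * X + C (G i)) p * M.det -
      MvPolynomial.aeval (fun i => C (X' i) * X) p * X ^ Fintype.card ι
  let ev : EuclideanSpace ℝ ι → ℝ → C(EuclideanSpace ℝ ι, ℝ)[X] →+* ℝ := fun x ε =>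
    ((ContinuousMap.evalAlgHom ℝ ℝ x : C(EuclideanSpace ℝ ι, ℝ) →ₐ[ℝ] ℝ) :
      C(EuclideanSpace ℝ ι, ℝ) →+* ℝ).comp (Polynomial.evalRingHom (algebraMap ℝ _ ε))
  have hev : ∀ x ε r, ev x ε r = (r.eval (algebraMap ℝ C(EuclideanSpace ℝ ι, ℝ) ε)) x :=
    fun x ε r => rfl
  have haev : ∀ x ε (f : ι → C(EuclideanSpace ℝ ι, ℝ)[X]),
      ev x ε (MvPolynomial.aeval f p) = MvPolynomial.eval (fun i => ev x ε (f i)) p := by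
    intro x ε f
    rw [MvPolynomial.aeval_def, MvPolynomial.hom_eval₂, MvPolynomial.eval, MvPolynomial.coe_eval₂Hom]
    congr 1
    ext t
    simp
  have hM : ∀ x ε, ev x ε M.det =
      (ε • ContinuousLinearMap.id ℝ (EuclideanSpace ℝ ι) + fderiv ℝ g x).det := by
    intro x ε
    rw [RingHom.map_det, ContinuousLinearMap.det_eq_det_euclidean]
    congr 1
    ext i j
    by_cases hij : i = j
    · simp [M, hev, D, hij]
    · simp [M, hev, D, hij]
  have hq : ∀ x ε, (q.eval (algebraMap ℝ C(EuclideanSpace ℝ ι, ℝ) ε)) x =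
      MvPolynomial.eval (fun i => (ε • x + g x) i) p *
        (ε • ContinuousLinearMap.id ℝ (EuclideanSpace ℝ ι) + fderiv ℝ g x).det -
      MvPolynomial.eval (fun i => (ε • x) i) p * ε ^ Fintype.card ι := by
    intro x ε
    rw [← hev]
    have h1 : ∀ i, ev x ε (C (X' i) * X + C (G i)) = (ε • x + g x) i := fun i => by
      simp [hev, X', G]; ring
    have h2 : ∀ i, ev x ε (C (X' i) * X) = (ε • x) i := fun i => by
      simp [hev, X']; ring
    have h3 : ev x ε X = ε := by simp [hev]
    simp only [q, map_sub, map_mul (ev x ε) (MvPolynomial.aeval _ p), haev, hM, map_pow, h1, h2, h3]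
  have hcomp : IsCompact (closedBall (0 : EuclideanSpace ℝ ι) R) := isCompact_closedBall _ _
  have hpc : Continuous fun y : EuclideanSpace ℝ ι => MvPolynomial.eval (fun i => y i) p :=
    (MvPolynomial.continuous_eval p).comp (by fun_prop)
  have hgc := hg.continuous
  have hgc' := hg.continuous_fderiv one_ne_zero
  have hdc : Continuous fun A : EuclideanSpace ℝ ι →L[ℝ] EuclideanSpace ℝ ι => A.det :=
    ContinuousLinearMap.continuous_det
  have key := setIntegral_coeff_zero_of_eventually (μ := volume) hcomp q (by
    filter_upwards [integral_comp_smul_add_mul_det hg hs hR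
      (fun y => MvPolynomial.eval (fun i => y i) p)] with ε hε
    simp_rw [hq]
    rw [integral_sub, hε, sub_self]
    · exact ((hpc.comp ((continuous_id.const_smul ε).add hgc)).mul
        (hdc.comp (continuous_const.add hgc'))).continuousOn.integrableOn_compact hcomp
    · exact ((hpc.comp (continuous_id.const_smul ε)).mul
        continuous_const).continuousOn.integrableOn_compact hcomp)
  have h0 : ∀ x, (q.coeff 0) x = MvPolynomial.eval (fun i => g x i) p * (fderiv ℝ g x).det := by
    intro x
    have := hq x 0
    rw [map_zero, ← Polynomial.coeff_zero_eq_eval_zero] at this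
    rw [this]
    rw [zero_smul ℝ (ContinuousLinearMap.id ℝ (EuclideanSpace ℝ ι)), zero_add, zero_smul, zero_add]
    simp [Fintype.card_ne_zero]
  simp_rw [h0] at key
  exact key

end

section

variable {ι : Type*} [Fintype ι]

/-- `∫ ψ(g) det Dg = 0` for `g` of class `C¹` with compact support and continuous `ψ`. -/
lemma integral_comp_mul_det_eq_zero [Nonempty ι]
    {g : EuclideanSpace ℝ ι → EuclideanSpace ℝ ι}
    (hg : ContDiff ℝ 1 g) (hs : HasCompactSupport g) {R : ℝ}
    (hR : ∀ x, x ∉ closedBall 0 R → g x = 0) {ψ : EuclideanSpace ℝ ι → ℝ} (hψ : Continuous ψ) :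
    ∫ x in closedBall 0 R, ψ (g x) * (fderiv ℝ g x).det = 0 := by
  have hgc := hg.continuous
  have hgc' := hg.continuous_fderiv one_ne_zero
  have hdc : Continuous fun x => (fderiv ℝ g x).det :=
    ContinuousLinearMap.continuous_det.comp hgc'
  have hcomp : IsCompact (closedBall (0 : EuclideanSpace ℝ ι) R) := isCompact_closedBall _ _
  let Φ : MvPolynomial ι ℝ →ₐ[ℝ] C(EuclideanSpace ℝ ι, ℝ) :=
    MvPolynomial.aeval fun i => ⟨fun x => x i, by fun_prop⟩
  have hΦ : ∀ p x, Φ p x = MvPolynomial.eval (fun i => x i) p := by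
    intro p x
    have : (ContinuousMap.evalAlgHom ℝ ℝ x).comp Φ = MvPolynomial.aeval (fun i => x i) := by
      ext i; simp [Φ]
    have h2 := congrArg (fun f => f p) this
    simpa [MvPolynomial.aeval_eq_eval] using h2
  have hsep : Φ.range.SeparatesPoints := by
    intro x y hxy
    obtain ⟨i, hi⟩ : ∃ i, x i ≠ y i := by
      by_contra! h
      exact hxy (by ext i; exact h i)
    exact ⟨_, ⟨_, ⟨MvPolynomial.X i, rfl⟩, rfl⟩, by simpa [hΦ] using hi⟩
  set J := ∫ x in closedBall 0 R, |(fderiv ℝ g x).det| with hJ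
  have hJ0 : 0 ≤ J := integral_nonneg fun x => abs_nonneg _
  have h_int : ∀ f : EuclideanSpace ℝ ι → ℝ, Continuous f → IntegrableOn f (closedBall 0 R) :=
    fun f hf => hf.continuousOn.integrableOn_compact hcomp
  refine abs_eq_zero.1 (le_antisymm (le_of_forall_pos_le_add fun ε hε => ?_) (abs_nonneg _))
  obtain ⟨_, ⟨p, rfl⟩, hp⟩ :=
    ContinuousMap.exists_mem_subalgebra_near_continuous_of_isCompact_of_separatesPoints hsep
      ⟨ψ, hψ⟩ (hcomp.image hgc) (show 0 < ε / (J + 1) by positivity)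
  have h0 := integral_mvPolynomial_comp_mul_det_eq_zero hg hs hR p
  have hpc : Continuous fun y : EuclideanSpace ℝ ι => MvPolynomial.eval (fun i => y i) p :=
    (MvPolynomial.continuous_eval p).comp (by fun_prop)
  have h1 : ∫ x in closedBall 0 R, ψ (g x) * (fderiv ℝ g x).det =
      ∫ x in closedBall 0 R, (ψ (g x) * (fderiv ℝ g x).det -
        MvPolynomial.eval (fun i => g x i) p * (fderiv ℝ g x).det) := by
    have h2 := integral_sub (h_int _ ((hψ.comp hgc).mul hdc)) (h_int _ ((hpc.comp hgc).mul hdc))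
    simp only [Pi.mul_apply, Function.comp_apply] at h2
    rw [h2, h0, sub_zero]
  rw [h1]
  calc _ ≤ ∫ x in closedBall 0 R, ε / (J + 1) * |(fderiv ℝ g x).det| := by
        rw [← Real.norm_eq_abs]
        refine norm_integral_le_of_norm_le (h_int _ (continuous_const.mul hdc.abs)) ?_
        refine (ae_restrict_mem measurableSet_closedBall).mono fun x hx => ?_
        rw [← sub_mul, norm_mul, Real.norm_eq_abs (ContinuousLinearMap.det _)]
        refine mul_le_mul_of_nonneg_right ?_ (abs_nonneg _)
        have := hp (g x) (mem_image_of_mem _ hx)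
        rw [norm_sub_rev]
        simp only [AlgHom.toRingHom_eq_coe, RingHom.coe_coe, hΦ, ContinuousMap.coe_mk] at this
        exact this.le
    _ = ε * (J / (J + 1)) := by rw [integral_const_mul]; ring
    _ ≤ 0 + ε := by
        rw [zero_add]
        refine mul_le_of_le_one_right hε.le ?_
        rw [div_le_one (by positivity)]; linarith


/-- The local inverse theorem at a nondegenerate zero: a small neighbourhood on which the map is
injective, the Jacobian determinant keeps its sign, and the image is a neighbourhood of `0`. -/
lemma exists_open_injOn_det_pos_image_mem_nhds
    {F : EuclideanSpace ℝ ι → EuclideanSpace ℝ ι} (hF : ContDiff ℝ 1 F)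
    {a : EuclideanSpace ℝ ι} (ha : (fderiv ℝ F a).det ≠ 0) {W : Set (EuclideanSpace ℝ ι)}
    (hW : W ∈ 𝓝 a) :
    ∃ U : Set (EuclideanSpace ℝ ι), IsOpen U ∧ a ∈ U ∧ U ⊆ W ∧ InjOn F U ∧
      (∀ x ∈ U, 0 < (fderiv ℝ F a).det * (fderiv ℝ F x).det) ∧ F '' U ∈ 𝓝 (F a) := by
  have h1 : HasStrictFDerivAt F
      ((fderiv ℝ F a).toContinuousLinearEquivOfDetNeZero ha : _ →L[ℝ] _) a := by
    rw [ContinuousLinearMap.coe_toContinuousLinearEquivOfDetNeZero]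
    exact hF.contDiffAt.hasStrictFDerivAt one_ne_zero
  have hdc : Continuous fun x => (fderiv ℝ F a).det * (fderiv ℝ F x).det :=
    continuous_const.mul
      (ContinuousLinearMap.continuous_det.comp (hF.continuous_fderiv one_ne_zero))
  set e := h1.toOpenPartialHomeomorph F with he
  have hO : IsOpen {x | 0 < (fderiv ℝ F a).det * (fderiv ℝ F x).det} :=
    isOpen_lt continuous_const hdc
  have hU : IsOpen (e.source ∩ interior W ∩
      {x | 0 < (fderiv ℝ F a).det * (fderiv ℝ F x).det}) :=
    (e.open_source.inter isOpen_interior).inter hO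
  have haU : a ∈ e.source ∩ interior W ∩
      {x | 0 < (fderiv ℝ F a).det * (fderiv ℝ F x).det} :=
    ⟨⟨h1.mem_toOpenPartialHomeomorph_source, mem_interior_iff_mem_nhds.2 hW⟩,
      mul_self_pos.2 ha⟩
  refine ⟨_, hU, haU, fun x hx => interior_subset hx.1.2, ?_, fun x hx => hx.2, ?_⟩
  · have := e.injOn
    rw [he, h1.toOpenPartialHomeomorph_coe] at this
    exact this.mono fun x hx => hx.1.1
  · have := e.isOpen_image_of_subset_source hU fun x hx => hx.1.1
    rw [he, h1.toOpenPartialHomeomorph_coe] at this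
    exact this.mem_nhds (mem_image_of_mem _ haU)

/-- A `C¹` map that is a nonzero constant near infinity and has only nondegenerate zeros has an
even number of zeros. -/
lemma even_ncard_zeros [Nonempty ι]
    {F : EuclideanSpace ℝ ι → EuclideanSpace ℝ ι} (hF : ContDiff ℝ 1 F) {R : ℝ}
    {v : EuclideanSpace ℝ ι} (hv : v ≠ 0) (hR : ∀ x, x ∉ ball 0 R → F x = v)
    (hdet : ∀ x, F x = 0 → (fderiv ℝ F x).det ≠ 0) :
    {x | F x = 0}.Finite ∧ Even {x | F x = 0}.ncard := by
  have hFc := hF.continuous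
  have hcomp : IsCompact (closedBall (0 : EuclideanSpace ℝ ι) R) := isCompact_closedBall _ _
  have hsub : {x | F x = 0} ⊆ ball 0 R := fun x hx => by
    by_contra h
    exact hv ((hR x h).symm.trans hx)
  have hclosed : IsClosed {x | F x = 0} := isClosed_eq hFc continuous_const
  have hZc : IsCompact {x | F x = 0} :=
    hcomp.of_isClosed_subset hclosed (hsub.trans ball_subset_closedBall)
  have hfin : {x | F x = 0}.Finite := by
    refine hZc.finite ?_
    rw [isDiscrete_iff_forall_mem_exists_isOpen]
    intro a ha
    obtain ⟨U, hU, haU, -, hinj, -, -⟩ :=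
      exists_open_injOn_det_pos_image_mem_nhds hF (hdet a ha) univ_mem
    refine ⟨U, hU, ?_⟩
    ext x
    refine ⟨fun hx => hinj hx.1 haU (hx.2.trans ha.symm), fun hx => ?_⟩
    rw [mem_singleton_iff.1 hx]
    exact ⟨haU, ha⟩
  refine ⟨hfin, ?_⟩
  obtain ⟨W, hWmem, hWdisj⟩ := hfin.t2_separation
  have hU : ∀ a, ∃ U : Set (EuclideanSpace ℝ ι), F a = 0 → IsOpen U ∧ a ∈ U ∧ 
      U ⊆ W a ∩ ball 0 R ∧ InjOn F U ∧
      (∀ x ∈ U, 0 < (fderiv ℝ F a).det * (fderiv ℝ F x).det) ∧ F '' U ∈ 𝓝 0 := by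
    intro a
    by_cases ha : F a = 0
    · obtain ⟨U, h⟩ := exists_open_injOn_det_pos_image_mem_nhds hF (hdet a ha)
        (((hWmem a).2.inter isOpen_ball).mem_nhds ⟨(hWmem a).1, hsub ha⟩)
      exact ⟨U, fun _ => ha ▸ h⟩
    · exact ⟨∅, fun h => absurd h ha⟩
  choose U hU using hU
  have hUm : ∀ a ∈ hfin.toFinset, MeasurableSet (U a) := fun a ha =>
    (hU a (hfin.mem_toFinset.1 ha)).1.measurableSet
  have hUopen : IsOpen (⋃ a ∈ hfin.toFinset, U a) :=
    isOpen_biUnion fun a ha => (hU a (hfin.mem_toFinset.1 ha)).1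
  have hLc : IsCompact (F '' (closedBall 0 R \ ⋃ a ∈ hfin.toFinset, U a)) :=
    (hcomp.diff hUopen).image hFc
  have hL0 : (F '' (closedBall 0 R \ ⋃ a ∈ hfin.toFinset, U a))ᶜ ∈ 𝓝 0 := by
    refine hLc.isClosed.isOpen_compl.mem_nhds ?_
    rintro ⟨x, hx, hx0⟩
    exact hx.2 (mem_biUnion (hfin.mem_toFinset.2 hx0) (hU x hx0).2.1)
  obtain ⟨r, hr, hball⟩ := Metric.mem_nhds_iff.1 (inter_mem hL0
    ((Filter.biInter_finset_mem hfin.toFinset).2 fun a ha =>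
      (hU a (hfin.mem_toFinset.1 ha)).2.2.2.2.2))
  let ψ : EuclideanSpace ℝ ι → ℝ := fun y => max 0 (r - ‖y‖)
  have hψc : Continuous ψ := by fun_prop
  have hψ0 : ∀ y, y ∉ ball 0 r → ψ y = 0 := fun y hy => by
    simp only [mem_ball_zero_iff, not_lt] at hy
    simp [ψ, hy]
  have hψs : HasCompactSupport ψ :=
    HasCompactSupport.intro (isCompact_closedBall 0 r) fun y hy =>
      hψ0 y fun h => hy (ball_subset_closedBall h)
  have hI : 0 < ∫ y, ψ y := by
    refine hψc.integral_pos_of_hasCompactSupport_nonneg_nonzero hψs (x := 0)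
      (fun y => le_max_left _ _) ?_
    simp [ψ, hr.ne', hr.le]
  let c : EuclideanSpace ℝ ι → ℕ := fun a => if 0 < (fderiv ℝ F a).det then 0 else 1
  have hpiece : ∀ a ∈ hfin.toFinset,
      ∫ x in U a, ψ (F x) * (fderiv ℝ F x).det = (1 - 2 * c a) * ∫ y, ψ y := by
    intro a ha
    obtain ⟨-, -, -, hinj, hsign, -⟩ := hU a (hfin.mem_toFinset.1 ha)
    have h1 := integral_image_eq_integral_abs_det_fderiv_smul volume (hUm a ha)
      (fun x _ => (hF.differentiable one_ne_zero x).hasFDerivAt.hasFDerivWithinAt) hinj ψ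
    have h2 : ∫ y in F '' U a, ψ y = ∫ y, ψ y := by
      refine setIntegral_eq_integral_of_forall_compl_eq_zero fun y hy => hψ0 y fun h => hy ?_
      exact mem_iInter₂.1 (hball h).2 a ha
    rw [← h2, h1, ← integral_const_mul]
    refine setIntegral_congr_fun (hUm a ha) fun x hx => ?_
    have h3 := hsign x hx
    simp only [smul_eq_mul, c]
    split_ifs with h4
    · rw [abs_of_pos (pos_of_mul_pos_right h3 h4.le)]; push_cast; ring
    · have h5 : (fderiv ℝ F x).det < 0 := by
        by_contra! h6
        exact absurd h3 (not_lt.2 (mul_nonpos_of_nonpos_of_nonneg (not_lt.1 h4) h6))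
      rw [abs_of_neg h5]; push_cast; ring
  have hsum : ∫ x in closedBall 0 R, ψ (F x) * (fderiv ℝ F x).det =
      ∑ a ∈ hfin.toFinset, ∫ x in U a, ψ (F x) * (fderiv ℝ F x).det := by
    have hcont : Continuous fun x => ψ (F x) * (fderiv ℝ F x).det :=
      (hψc.comp hFc).mul
        (ContinuousLinearMap.continuous_det.comp (hF.continuous_fderiv one_ne_zero))
    have hUsub : ∀ a ∈ hfin.toFinset, U a ⊆ closedBall 0 R := fun a ha =>
      ((hU a (hfin.mem_toFinset.1 ha)).2.2.1.trans inter_subset_right).trans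
        ball_subset_closedBall
    rw [← integral_biUnion_finset _ hUm]
    · refine setIntegral_eq_of_subset_of_forall_sdiff_eq_zero measurableSet_closedBall
        (iUnion₂_subset hUsub) fun x hx => ?_
      rw [hψ0, zero_mul]
      intro h
      exact (hball h).1 (mem_image_of_mem _ hx)
    · intro a ha b hb hab
      exact (hWdisj (by simpa using ha) (by simpa using hb) hab).mono
        ((hU a (hfin.mem_toFinset.1 ha)).2.2.1.trans inter_subset_left)
        ((hU b (hfin.mem_toFinset.1 hb)).2.2.1.trans inter_subset_left)
    · exact fun a ha => (hcont.continuousOn.integrableOn_compact hcomp).mono_set (hUsub a ha)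
  have hzero : ∫ x in closedBall 0 R, ψ (F x) * (fderiv ℝ F x).det = 0 := by
    have hgR : ∀ x, x ∉ closedBall 0 R → F x - v = 0 := fun x hx =>
      sub_eq_zero.2 (hR x fun h => hx (ball_subset_closedBall h))
    have := integral_comp_mul_det_eq_zero (g := fun x => F x - v) (hF.sub contDiff_const)
      (HasCompactSupport.intro hcomp hgR) hgR (ψ := fun y => ψ (y + v)) (by fun_prop)
    simpa only [sub_add_cancel, fderiv_sub_const] using this
  rw [hsum, Finset.sum_congr rfl hpiece, ← Finset.sum_mul, mul_eq_zero,
    or_iff_left hI.ne', Finset.sum_sub_distrib, ← Finset.mul_sum] at hzero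
  rw [ncard_eq_toFinset_card _ hfin]
  refine ⟨∑ a ∈ hfin.toFinset, c a, ?_⟩
  rify
  simp only [Finset.sum_const, nsmul_eq_mul, mul_one] at hzero
  linarith

end

section EquivariantVector

variable {V : Type*} [NormedAddCommGroup V] [InnerProductSpace ℝ V]

/-- The vector at `x` with radial part `y.2 • x` and tangential part the projection of `y.1`
(times `‖x‖²`). -/
def radTan (x : V) (y : V × ℝ) : V := y.2 • x + (‖x‖ ^ 2 • y.1 - ⟪y.1, x⟫ • x)

lemma radTan_sub (x : V) (y z : V × ℝ) : radTan x (y - z) = radTan x y - radTan x z := by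
  simp only [radTan, Prod.snd_sub, Prod.fst_sub, sub_smul, smul_sub, inner_sub_left]
  abel

lemma norm_radTan_le (x : V) (y : V × ℝ) : ‖radTan x y‖ ≤ (‖x‖ + 2 * ‖x‖ ^ 2) * ‖y‖ := by
  have h1 : ‖y.2 • x‖ ≤ ‖y‖ * ‖x‖ := by
    rw [norm_smul]; exact mul_le_mul_of_nonneg_right (norm_snd_le y) (norm_nonneg _)
  have h2 : ‖‖x‖ ^ 2 • y.1‖ ≤ ‖x‖ ^ 2 * ‖y‖ := by
    rw [norm_smul, norm_pow, norm_norm]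
    exact mul_le_mul_of_nonneg_left (norm_fst_le y) (by positivity)
  have h3 : ‖⟪y.1, x⟫ • x‖ ≤ ‖y‖ * ‖x‖ * ‖x‖ := by
    rw [norm_smul]
    refine mul_le_mul_of_nonneg_right ((norm_inner_le_norm _ _).trans ?_) (norm_nonneg _)
    exact mul_le_mul_of_nonneg_right (norm_fst_le y) (norm_nonneg _)
  calc _ ≤ ‖y‖ * ‖x‖ + (‖x‖ ^ 2 * ‖y‖ + ‖y‖ * ‖x‖ * ‖x‖) :=
        (norm_add_le _ _).trans (add_le_add h1 ((norm_sub_le _ _).trans (add_le_add h2 h3)))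
    _ = _ := by ring

lemma radTan_neg (x : V) (y : V × ℝ) :
    ‖x‖ ^ 2 • radTan (-x) y = ‖x‖ ^ 2 • radTan x y - (2 * ⟪x, radTan x y⟫) • x := by
  simp only [radTan, norm_neg, inner_neg_right, smul_neg, inner_add_right, inner_sub_right,
    inner_smul_right, real_inner_self_eq_norm_sq, neg_smul, neg_neg, real_inner_comm y.1 x]
  module

/-- The kernel of `radTan x`. -/
lemma radTan_eq_zero {x : V} (hx : x ≠ 0) {y : V × ℝ} (h : radTan x y = 0) :
    ∃ τ : ℝ, y = (τ • x, 0) := by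
  have hn : ‖x‖ ^ 2 ≠ 0 := by positivity
  have h1 : y.2 = 0 := by
    have h2 : ⟪x, radTan x y⟫ = y.2 * ‖x‖ ^ 2 := by
      simp only [radTan, inner_add_right, inner_sub_right, inner_smul_right,
        real_inner_self_eq_norm_sq, real_inner_comm y.1 x]
      ring
    rw [h, inner_zero_right] at h2
    exact (mul_eq_zero.1 h2.symm).resolve_right hn
  refine ⟨⟪y.1, x⟫ / ‖x‖ ^ 2, Prod.ext ?_ h1⟩
  rw [radTan, h1, zero_smul, zero_add, sub_eq_zero] at h
  rw [div_eq_inv_mul, mul_smul]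
  simp only
  rw [← h, smul_smul, inv_mul_cancel₀ hn, one_smul]

/-- A right inverse of `radTan x`, plus a multiple of the kernel vector. -/
def radTanInv (S : V → V) (z : V × ℝ) : V × ℝ :=
  ((‖z.1‖ ^ 2)⁻¹ • (S z.1 - ((‖z.1‖ ^ 2)⁻¹ * ⟪S z.1, z.1⟫) • z.1) + z.2 • z.1,
    (‖z.1‖ ^ 2)⁻¹ * ⟪S z.1, z.1⟫)

lemma radTan_radTanInv (S : V → V) {x : V} (hx : x ≠ 0) (s : ℝ) :
    radTan x (radTanInv S (x, s)) = S x := by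
  have hn : ‖x‖ ^ 2 ≠ 0 := by positivity
  simp only [radTan, radTanInv, inner_add_left, inner_sub_left, inner_smul_left, smul_add,
    real_inner_self_eq_norm_sq, smul_smul, mul_inv_cancel₀ hn, one_smul]
  simp only [conj_trivial]
  match_scalars <;> field_simp
  ring

lemma hasDerivAt_radTan_of_eq_zero {u x : V} {Δ : ℝ → V × ℝ} {Δ' : V × ℝ}
    (h : HasDerivAt Δ Δ' 0) (h0 : Δ 0 = 0) :
    HasDerivAt (fun t : ℝ => radTan (x + t • u) (Δ t)) (radTan x Δ') 0 := by
  have hX : HasDerivAt (fun t : ℝ => x + t • u) u 0 := by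
    simpa using ((hasDerivAt_id (0 : ℝ)).smul_const u).const_add x
  have h1 : HasDerivAt (fun t => (Δ t).1) Δ'.1 0 := h.fst
  have h2 : HasDerivAt (fun t => (Δ t).2) Δ'.2 0 := h.snd
  have hN := hX.norm_sq
  have hI := h1.inner ℝ hX
  have := (h2.smul hX).add ((hN.smul h1).sub (hI.smul hX))
  refine this.congr_deriv ?_
  simp [h0, radTan]

lemma contDiff_radTan (y : V × ℝ) {m : WithTop ℕ∞} : ContDiff ℝ m fun x => radTan x y := by
  have h1 := contDiff_norm_sq ℝ (E := V) (n := m)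
  exact (contDiff_const.smul contDiff_id).add ((h1.smul contDiff_const).sub
    ((contDiff_const.inner ℝ contDiff_id).smul contDiff_id))

variable [FiniteDimensional ℝ V] [MeasurableSpace V] [BorelSpace V]

/-- Generic perturbation within the family `radTan · y` makes all zeros nondegenerate. -/
lemma exists_radTan_perturbation {S : V → V} (hS : ContDiff ℝ 1 S) {δ : ℝ} (hδ : 0 < δ) :
    ∃ y : V × ℝ, ‖y‖ < δ ∧ ∀ x, x ≠ 0 → S x - radTan x y = 0 →
      (fderiv ℝ (fun x => S x - radTan x y) x).det ≠ 0 := by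
  have hdiff : ∀ z : V × ℝ, z.1 ≠ 0 → DifferentiableAt ℝ (radTanInv S) z := by
    intro z hz
    have hn : ‖z.1‖ ^ 2 ≠ 0 := by positivity
    have h1 : DifferentiableAt ℝ (fun z : V × ℝ => S z.1) z :=
      (hS.differentiable one_ne_zero z.1).comp z differentiableAt_fst
    have h2 : DifferentiableAt ℝ (fun z : V × ℝ => (‖z.1‖ ^ 2)⁻¹) z :=
      (differentiableAt_fst.norm_sq ℝ).inv hn
    have h3 : DifferentiableAt ℝ (fun z : V × ℝ => ⟪S z.1, z.1⟫) z :=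
      h1.inner ℝ differentiableAt_fst
    have h4 : DifferentiableAt ℝ (fun z : V × ℝ => z.1) z := differentiableAt_fst
    have h5 : DifferentiableAt ℝ (fun z : V × ℝ => z.2) z := differentiableAt_snd
    exact ((h2.smul (h1.sub ((h2.mul h3).smul h4))).add (h5.smul h4)).prodMk (h2.mul h3)
  let A : Set (V × ℝ) := {z | z.1 ≠ 0 ∧ (fderiv ℝ (radTanInv S) z).det = 0}
  have hA : (Measure.addHaar : Measure (V × ℝ)) (radTanInv S '' A) = 0 :=
    addHaar_image_eq_zero_of_det_fderivWithin_eq_zero _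
      (fun z hz => (hdiff z hz.1).hasFDerivAt.hasFDerivWithinAt) fun z hz => hz.2
  obtain ⟨y, hy, hyA⟩ : ∃ y ∈ ball (0 : V × ℝ) δ, y ∉ radTanInv S '' A := by
    by_contra! h
    exact (measure_ball_pos Measure.addHaar (0 : V × ℝ) hδ).ne'
      (measure_mono_null h hA)
  refine ⟨y, by simpa using hy, fun x hx hzero hdet => hyA ?_⟩
  have hG : DifferentiableAt ℝ (fun x => S x - radTan x y) x :=
    (hS.differentiable one_ne_zero x).sub ((contDiff_radTan y).differentiable one_ne_zero x)
  obtain ⟨u, hu0, hu⟩ : ∃ u, u ≠ 0 ∧ fderiv ℝ (fun x => S x - radTan x y) x u = 0 := by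
    have := LinearMap.bot_lt_ker_of_det_eq_zero hdet
    obtain ⟨u, hu, hu0⟩ := Submodule.exists_mem_ne_zero_of_ne_bot this.ne'
    exact ⟨u, hu0, hu⟩
  obtain ⟨s, hs⟩ : ∃ s, radTanInv S (x, s) = y := by
    obtain ⟨τ, hτ⟩ := radTan_eq_zero hx (y := y - radTanInv S (x, 0)) (by
      rw [radTan_sub, radTan_radTanInv S hx, ← neg_eq_zero, neg_sub, hzero])
    refine ⟨τ, ?_⟩
    rw [sub_eq_iff_eq_add] at hτ
    rw [hτ]
    simp [radTanInv, add_comm]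
  refine ⟨(x, s), ⟨hx, ?_⟩, hs⟩
  have hline : HasDerivAt (fun t : ℝ => x + t • u) u 0 := by
    simpa using ((hasDerivAt_id (0 : ℝ)).smul_const u).const_add x
  have hne : ∀ᶠ t : ℝ in 𝓝 0, x + t • u ≠ 0 := by
    refine hline.continuousAt.eventually_ne ?_
    simpa using hx
  set D := fderiv ℝ (radTanInv S) (x, s) with hD
  have hΘ : HasDerivAt (fun t : ℝ => radTanInv S (x + t • u, s) - y) (D (u, 0)) 0 := by
    have h1 : HasDerivAt (fun t : ℝ => (x + t • u, s)) (u, (0 : ℝ)) 0 :=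
      hline.prodMk (hasDerivAt_const _ _)
    have h2 : HasFDerivAt (radTanInv S) D (x + (0 : ℝ) • u, s) := by
      simpa using (hdiff (x, s) hx).hasFDerivAt
    exact (h2.comp_hasDerivAt (0 : ℝ) h1).sub_const y
  have h1 := hasDerivAt_radTan_of_eq_zero (u := u) (x := x) hΘ (by simp [hs])
  have h2 : HasDerivAt (fun t : ℝ => S (x + t • u) - radTan (x + t • u) y) 0 0 := by
    have h3 : HasFDerivAt (fun x => S x - radTan x y)
        (fderiv ℝ (fun x => S x - radTan x y) x) (x + (0 : ℝ) • u) := by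
      simpa using hG.hasFDerivAt
    have := h3.comp_hasDerivAt (0 : ℝ) hline
    rwa [hu] at this
  have h4 : radTan x (D (u, 0)) = 0 := by
    refine h1.unique (h2.congr_of_eventuallyEq ?_)
    filter_upwards [hne] with t ht
    rw [radTan_sub, radTan_radTanInv S ht]
  obtain ⟨τ, hτ⟩ := radTan_eq_zero hx h4
  have h5 : D (0, 1) = (x, 0) := by
    have h6 : HasDerivAt (fun t : ℝ => radTanInv S (x, s + t)) (x, 0) 0 := by
      have : (fun t : ℝ => radTanInv S (x, s + t)) =
          fun t : ℝ => radTanInv S (x, s) + t • (x, (0 : ℝ)) := by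
        ext1 t
        simp [radTanInv, add_smul, add_assoc]
      rw [this]
      simpa using ((hasDerivAt_id (0 : ℝ)).smul_const (x, (0 : ℝ))).const_add
        (radTanInv S (x, s))
    have h7 : HasDerivAt (fun t : ℝ => (x, s + t)) ((0 : V), (1 : ℝ)) 0 :=
      (hasDerivAt_const _ _).prodMk ((hasDerivAt_id (0 : ℝ)).const_add s)
    have h8 : HasFDerivAt (radTanInv S) D (x, s + 0) := by
      simpa using (hdiff (x, s) hx).hasFDerivAt
    have h9 : HasDerivAt (fun t : ℝ => radTanInv S (x, s + t)) (D (0, 1)) 0 :=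
      HasFDerivAt.comp_hasDerivAt (f := fun t : ℝ => (x, s + t)) (0 : ℝ) h8 h7
    exact h9.unique h6
  by_contra hne'
  have h9 : D (u, -τ) = 0 := by
    have : ((u, -τ) : V × ℝ) = (u, 0) - τ • (0, 1) := by simp
    rw [this, map_sub, map_smul, hτ, h5]
    simp
  have h10 := (D.toContinuousLinearEquivOfDetNeZero hne').injective
    (a₁ := (u, -τ)) (a₂ := 0) (by
      rw [map_zero]; exact h9)
  exact hu0 (congrArg Prod.fst h10)

end EquivariantVector

variable {ι : Type*} [Fintype ι]

/-- A finite set of vectors stable under negation, containing `0`, has odd cardinality. -/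
lemma not_even_ncard_of_neg_mem {V : Type*} [AddCommGroup V] [Module ℝ V] {Z : Set V}
    (hZ : Z.Finite) (h0 : 0 ∈ Z) (hneg : ∀ x ∈ Z, -x ∈ Z) : ¬ Even Z.ncard := by
  have h1 : ((hZ.toFinset.erase 0).card : ZMod 2) = 0 := by
    rw [Finset.card_eq_sum_ones, Nat.cast_sum]
    refine Finset.sum_involution (fun x _ => -x) (fun x hx => by decide) (fun x hx _ h => ?_)
      (fun x hx => ?_) fun x hx => neg_neg x
    · simp only [Finset.mem_erase, ne_eq] at hx
      have h2 : (2 : ℝ) • x = 0 := by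
        rw [two_smul]
        nth_rewrite 1 [← h]
        exact neg_add_cancel x
      exact hx.1 ((smul_eq_zero.1 h2).resolve_left two_ne_zero)
    · simp only [Finset.mem_erase, ne_eq, neg_eq_zero, Finite.mem_toFinset] at hx ⊢
      exact ⟨hx.1, hneg x hx.2⟩
  rw [ncard_eq_toFinset_card _ hZ]
  rw [ZMod.natCast_eq_zero_iff_even, Finset.card_erase_of_mem (by simpa using h0)] at h1
  have h2 : 0 < hZ.toFinset.card := Finset.card_pos.2 ⟨0, by simpa using h0⟩
  rw [Nat.not_even_iff_odd]
  have := h1.add_one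
  rwa [Nat.sub_add_cancel (Nat.one_le_iff_ne_zero.2 h2.ne')] at this

section Symmetrization

variable {V : Type*} [NormedAddCommGroup V] [InnerProductSpace ℝ V]

/-- Symmetrization of a vector field with respect to `v(x) ↦ R_x v(-x)`, times `‖x‖²`. -/
def reflSymm (P : V → V) (x : V) : V :=
  (1 / 2 : ℝ) • (‖x‖ ^ 2 • P x + (‖x‖ ^ 2 • P (-x) - (2 * ⟪x, P (-x)⟫) • x))

lemma reflSymm_neg (P : V → V) (x : V) :
    ‖x‖ ^ 2 • reflSymm P (-x) =
      ‖x‖ ^ 2 • reflSymm P x - (2 * ⟪x, reflSymm P x⟫) • x := by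
  simp only [reflSymm, norm_neg, inner_neg_left, neg_neg, inner_add_right, inner_sub_right,
    inner_smul_right, real_inner_self_eq_norm_sq, smul_neg]
  module

lemma norm_reflSymm_sub_le {P F : V → V} {η : ℝ} (hP : ∀ x, ‖P x - F x‖ ≤ η) {x : V}
    (hF : ‖x‖ ^ 2 • F x = ‖x‖ ^ 2 • F (-x) - (2 * ⟪x, F (-x)⟫) • x) :
    ‖reflSymm P x - ‖x‖ ^ 2 • F x‖ ≤ 2 * ‖x‖ ^ 2 * η := by
  have h1 : reflSymm P x - ‖x‖ ^ 2 • F x = (1 / 2 : ℝ) • (‖x‖ ^ 2 • (P x - F x) +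
      (‖x‖ ^ 2 • (P (-x) - F (-x)) - (2 * ⟪x, P (-x) - F (-x)⟫) • x)) := by
    have : ‖x‖ ^ 2 • F x = (1 / 2 : ℝ) • (‖x‖ ^ 2 • F x + ‖x‖ ^ 2 • F x) := by module
    rw [this]
    nth_rewrite 2 [hF]
    simp only [reflSymm, inner_sub_right]
    module
  have hη : 0 ≤ η := (norm_nonneg _).trans (hP x)
  have h2 : ‖‖x‖ ^ 2 • (P x - F x)‖ ≤ ‖x‖ ^ 2 * η := by
    rw [norm_smul, norm_pow, norm_norm]
    exact mul_le_mul_of_nonneg_left (hP x) (by positivity)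
  have h3 : ‖‖x‖ ^ 2 • (P (-x) - F (-x))‖ ≤ ‖x‖ ^ 2 * η := by
    rw [norm_smul, norm_pow, norm_norm]
    exact mul_le_mul_of_nonneg_left (hP (-x)) (by positivity)
  have h4 : ‖(2 * ⟪x, P (-x) - F (-x)⟫) • x‖ ≤ 2 * (‖x‖ * η) * ‖x‖ := by
    rw [norm_smul, norm_mul, Real.norm_ofNat]
    gcongr
    exact (norm_inner_le_norm _ _).trans
      (mul_le_mul_of_nonneg_left (hP (-x)) (norm_nonneg x))
  rw [h1, norm_smul]
  calc _ ≤ ‖(1 / 2 : ℝ)‖ * (‖x‖ ^ 2 * η + (‖x‖ ^ 2 * η + 2 * (‖x‖ * η) * ‖x‖)) := by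
        gcongr
        exact (norm_add_le _ _).trans (add_le_add h2 ((norm_sub_le _ _).trans (add_le_add h3 h4)))
    _ = _ := by norm_num; ring

lemma contDiff_reflSymm {P : V → V} {m : WithTop ℕ∞} (hP : ContDiff ℝ m P) :
    ContDiff ℝ m (reflSymm P) := by
  have h1 := contDiff_norm_sq ℝ (E := V) (n := m)
  have h2 : ContDiff ℝ m fun x => P (-x) := hP.comp contDiff_neg
  exact contDiff_const.smul ((h1.smul hP).add ((h1.smul h2).sub
    ((contDiff_const.mul (contDiff_id.inner ℝ h2)).smul contDiff_id)))

end Symmetrization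

/-- There is no continuous map on Euclidean space that is the identity on the unit ball, a
nonzero constant far away, equivariant with respect to reflections in between, and without
other zeros outside the equivariant region. -/
lemma false_of_reflection_equivariant [Nonempty ι]
    {F : EuclideanSpace ℝ ι → EuclideanSpace ℝ ι} (hF : Continuous F)
    {v : EuclideanSpace ℝ ι} (hv : v ≠ 0) {ρ : ℝ} (hρ : 0 < ρ)
    (hid : ∀ x, ‖x‖ ^ 2 ≤ 1 → F x = x) (hfar : ∀ x, 4 ≤ ‖x‖ ^ 2 → F x = v)
    (hrefl : ∀ x, ‖x‖ ^ 2 ≤ 3 → ‖x‖ ^ 2 • F x = ‖x‖ ^ 2 • F (-x) - (2 * ⟪x, F (-x)⟫) • x)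
    (hbd : ∀ x, 2 ≤ ‖x‖ ^ 2 → ρ ≤ ‖F x‖) : False := by
  obtain ⟨η, hη, hη1, hη2⟩ : ∃ η : ℝ, 0 < η ∧ 3 * η < ρ ∧ 3 * η < 1 / 2 :=
    ⟨min ρ (1 / 2) / 4, by positivity, by linarith [min_le_left ρ (1 / 2)],
      by linarith [min_le_right ρ (1 / 2)]⟩
  obtain ⟨P, hPs, hP, -⟩ := hF.exists_contDiff_approx 1 continuous_const
    (fun _ => hη : ∀ x : EuclideanSpace ℝ ι, 0 < (fun _ => η) x)
  replace hP : ∀ x, ‖P x - F x‖ ≤ η := fun x => by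
    rw [← dist_eq_norm]; exact (hP x).le
  obtain ⟨y, hy, hydet⟩ := exists_radTan_perturbation (contDiff_reflSymm hPs)
    (show 0 < η / 4 by positivity)
  set G : EuclideanSpace ℝ ι → EuclideanSpace ℝ ι := fun x => reflSymm P x - radTan x y with hG
  have hGs : ContDiff ℝ 1 G := (contDiff_reflSymm hPs).sub (contDiff_radTan y)
  have hGF : ∀ x, 1 / 4 ≤ ‖x‖ ^ 2 → ‖x‖ ^ 2 ≤ 3 → ‖G x - ‖x‖ ^ 2 • F x‖ ≤ 3 * ‖x‖ ^ 2 * η := by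
    intro x h1 h2
    have h3 := norm_reflSymm_sub_le hP (hrefl x h2)
    have h4 := norm_radTan_le x y
    have h5 : ‖x‖ ≤ 2 * ‖x‖ ^ 2 := by nlinarith [norm_nonneg x]
    have h6 : (‖x‖ + 2 * ‖x‖ ^ 2) * ‖y‖ ≤ (2 * ‖x‖ ^ 2 + 2 * ‖x‖ ^ 2) * (η / 4) := by gcongr
    have h7 : G x - ‖x‖ ^ 2 • F x = (reflSymm P x - ‖x‖ ^ 2 • F x) - radTan x y := by
      simp only [hG]; abel
    rw [h7]
    refine (norm_sub_le _ _).trans ?_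
    linarith
  have hGneg : ∀ x, ‖x‖ ^ 2 • G (-x) = ‖x‖ ^ 2 • G x - (2 * ⟪x, G x⟫) • x := by
    intro x
    simp only [hG, smul_sub, reflSymm_neg, radTan_neg, inner_sub_right]
    module
  let a : EuclideanSpace ℝ ι → ℝ := fun x => smoothTransition (2 - 2 * ‖x‖ ^ 2)
  let b : EuclideanSpace ℝ ι → ℝ := fun x => smoothTransition (3 - ‖x‖ ^ 2)
  let c : EuclideanSpace ℝ ι → ℝ := fun x => smoothTransition (5 - ‖x‖ ^ 2)
  have hns := contDiff_norm_sq ℝ (E := EuclideanSpace ℝ ι) (n := 1)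
  have has : ContDiff ℝ 1 a :=
    smoothTransition.contDiff.comp (contDiff_const.sub (contDiff_const.mul hns))
  have hbs : ContDiff ℝ 1 b := smoothTransition.contDiff.comp (contDiff_const.sub hns)
  have hcs : ContDiff ℝ 1 c := smoothTransition.contDiff.comp (contDiff_const.sub hns)
  let K : EuclideanSpace ℝ ι → EuclideanSpace ℝ ι := fun x =>
    a x • x + (1 - a x) • (b x • G x + (c x - b x) • P x + (1 - c x) • v)
  have hKs : ContDiff ℝ 1 K :=
    (has.smul contDiff_id).add ((contDiff_const.sub has).smul
      (((hbs.smul hGs).add ((hcs.sub hbs).smul hPs)).add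
        ((contDiff_const.sub hcs).smul contDiff_const)))
  have ha1 : ∀ x, ‖x‖ ^ 2 ≤ 1 / 2 → a x = 1 := fun x hx =>
    smoothTransition.one_of_one_le (by linarith)
  have ha0 : ∀ x, 1 ≤ ‖x‖ ^ 2 → a x = 0 := fun x hx =>
    smoothTransition.zero_of_nonpos (by linarith)
  have hb1 : ∀ x, ‖x‖ ^ 2 ≤ 2 → b x = 1 := fun x hx =>
    smoothTransition.one_of_one_le (by linarith)
  have hb0 : ∀ x, 3 ≤ ‖x‖ ^ 2 → b x = 0 := fun x hx =>
    smoothTransition.zero_of_nonpos (by linarith)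
  have hc1 : ∀ x, ‖x‖ ^ 2 ≤ 4 → c x = 1 := fun x hx =>
    smoothTransition.one_of_one_le (by linarith)
  have hc0 : ∀ x, 5 ≤ ‖x‖ ^ 2 → c x = 0 := fun x hx =>
    smoothTransition.zero_of_nonpos (by linarith)
  have hKid : ∀ x, ‖x‖ ^ 2 ≤ 1 / 2 → K x = x := fun x hx => by simp [K, ha1 x hx]
  have hKG : ∀ x, 1 ≤ ‖x‖ ^ 2 → ‖x‖ ^ 2 ≤ 2 → K x = G x := fun x h1 h2 => by
    simp [K, ha0 x h1, hb1 x h2, hc1 x (by linarith)]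
  have hne1 : ∀ x, 1 / 2 < ‖x‖ ^ 2 → ‖x‖ ^ 2 ≤ 1 → K x ≠ 0 := by
    intro x h1 h2 h0
    have h3 := hGF x (by linarith) (by linarith)
    rw [hid x h2] at h3
    have h4 : K x = (a x + (1 - a x) * ‖x‖ ^ 2) • x + (1 - a x) • (G x - ‖x‖ ^ 2 • x) := by
      simp only [K, hb1 x (by linarith), hc1 x (by linarith)]
      module
    have h5 : 0 ≤ a x := smoothTransition.nonneg _
    have h6 : a x ≤ 1 := smoothTransition.le_one _
    have h7 : ‖(a x + (1 - a x) * ‖x‖ ^ 2) • x‖ = ‖(1 - a x) • (G x - ‖x‖ ^ 2 • x)‖ := by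
      rw [h0] at h4
      rw [eq_neg_of_add_eq_zero_left h4.symm, norm_neg]
    rw [norm_smul, norm_smul, Real.norm_of_nonneg (by nlinarith),
      Real.norm_of_nonneg (by linarith)] at h7
    have h8 : 1 / 2 < ‖x‖ := by nlinarith [norm_nonneg x]
    have h9 : (1 - a x) * ‖G x - ‖x‖ ^ 2 • x‖ ≤ (1 - a x) * (3 * ‖x‖ ^ 2 * η) :=
      mul_le_mul_of_nonneg_left h3 (by linarith)
    have h10 : 0 < a x + (1 - a x) * ‖x‖ ^ 2 := by nlinarith
    have h11 : (a x + (1 - a x) * ‖x‖ ^ 2) * (3 * η) < (a x + (1 - a x) * ‖x‖ ^ 2) * ‖x‖ :=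
      mul_lt_mul_of_pos_left (by linarith) h10
    nlinarith [mul_nonneg h5 hη.le]
  have hne2 : ∀ x, 2 ≤ ‖x‖ ^ 2 → K x ≠ 0 := by
    intro x h1 h0
    have h5 : 0 ≤ b x := smoothTransition.nonneg _
    have h6 : b x ≤ 1 := smoothTransition.le_one _
    have h7 : 0 ≤ c x := smoothTransition.nonneg _
    have h8 : c x ≤ 1 := smoothTransition.le_one _
    have h9 : b x ≤ c x := by
      rcases le_total 3 (‖x‖ ^ 2) with h | h
      · rw [hb0 x h]; exact h7
      · rw [hc1 x (by linarith)]; exact h6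
    have h10 : (1 - c x) • v = (1 - c x) • F x := by
      rcases le_total 4 (‖x‖ ^ 2) with h | h
      · rw [hfar x h]
      · rw [hc1 x h]; simp
    have h11 : K x = (b x * ‖x‖ ^ 2 + (1 - b x)) • F x + (b x • (G x - ‖x‖ ^ 2 • F x) +
        (c x - b x) • (P x - F x)) := by
      simp only [K, ha0 x (by linarith), h10]
      module
    have h12 : ‖b x • (G x - ‖x‖ ^ 2 • F x)‖ ≤ b x * (3 * ‖x‖ ^ 2 * η) := by
      rw [norm_smul, Real.norm_of_nonneg h5]
      rcases le_total 3 (‖x‖ ^ 2) with h | h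
      · rw [hb0 x h]; simp
      · exact mul_le_mul_of_nonneg_left (hGF x (by linarith) h) h5
    have h13 : ‖(c x - b x) • (P x - F x)‖ ≤ (1 - b x) * η := by
      rw [norm_smul, Real.norm_of_nonneg (by linarith)]
      exact mul_le_mul (by linarith) (hP x) (norm_nonneg _) (by linarith)
    have h14 : ‖(b x * ‖x‖ ^ 2 + (1 - b x)) • F x‖ =
        ‖b x • (G x - ‖x‖ ^ 2 • F x) + (c x - b x) • (P x - F x)‖ := by
      rw [h0] at h11
      rw [eq_neg_of_add_eq_zero_left h11.symm, norm_neg]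
    have h15 : 0 < b x * ‖x‖ ^ 2 + (1 - b x) := by nlinarith
    rw [norm_smul, Real.norm_of_nonneg h15.le] at h14
    have h16 := norm_add_le (b x • (G x - ‖x‖ ^ 2 • F x)) ((c x - b x) • (P x - F x))
    have h17 : (b x * ‖x‖ ^ 2 + (1 - b x)) * (3 * η) < (b x * ‖x‖ ^ 2 + (1 - b x)) * ‖F x‖ :=
      mul_lt_mul_of_pos_left (by linarith [hbd x h1]) h15
    nlinarith [mul_nonneg (sub_nonneg.2 h6) hη.le]
  have hzero : ∀ x, K x = 0 → x = 0 ∨ (1 < ‖x‖ ^ 2 ∧ ‖x‖ ^ 2 < 2) := by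
    intro x hx
    rcases le_or_gt (‖x‖ ^ 2) (1 / 2) with h | h
    · exact Or.inl ((hKid x h).symm.trans hx)
    · refine Or.inr ⟨?_, ?_⟩
      · by_contra! h2
        exact hne1 x h h2 hx
      · by_contra! h2
        exact hne2 x h2 hx
  have hK0 : K 0 = 0 := hKid 0 (by simp)
  have hdet : ∀ x, K x = 0 → (fderiv ℝ K x).det ≠ 0 := by
    intro x hx
    rcases hzero x hx with rfl | ⟨h1, h2⟩
    · have h3 : K =ᶠ[𝓝 0] id := by
        have : ∀ᶠ x : EuclideanSpace ℝ ι in 𝓝 0, ‖x‖ ^ 2 < 1 / 2 :=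
          (continuous_norm.pow 2).continuousAt.eventually_lt continuousAt_const (by simp)
        filter_upwards [this] with x hx using hKid x hx.le
      rw [h3.fderiv_eq, fderiv_id, ContinuousLinearMap.det, ContinuousLinearMap.coe_id,
        LinearMap.det_id]
      exact one_ne_zero
    · have h3 : K =ᶠ[𝓝 x] G := by
        have h4 : ∀ᶠ x : EuclideanSpace ℝ ι in 𝓝 x, ‖x‖ ^ 2 < 2 :=
          (continuous_norm.pow 2).continuousAt.eventually_lt continuousAt_const h2
        have h5 : ∀ᶠ x : EuclideanSpace ℝ ι in 𝓝 x, 1 < ‖x‖ ^ 2 :=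
          continuousAt_const.eventually_lt (continuous_norm.pow 2).continuousAt h1
        filter_upwards [h4, h5] with x h4 h5 using hKG x h5.le h4.le
      rw [h3.fderiv_eq]
      refine hydet x ?_ ?_
      · rintro rfl
        norm_num at h1
      · rw [← hx, hKG x h1.le h2.le]
  obtain ⟨hfin, heven⟩ := even_ncard_zeros (R := 3) hKs hv (fun x hx => by
    have h1 : 3 ≤ ‖x‖ := by simpa using hx
    have h2 : 9 ≤ ‖x‖ ^ 2 := by nlinarith
    simp [K, ha0 x (by linarith), hb0 x (by linarith), hc0 x (by linarith)]) hdet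
  refine not_even_ncard_of_neg_mem hfin hK0 (fun x hx => ?_) heven
  rcases hzero x hx with rfl | ⟨h1, h2⟩
  · simpa using hx
  · have hx' : G x = 0 := (hKG x h1.le h2.le).symm.trans hx
    have h3 := hGneg x
    rw [hx', smul_zero, inner_zero_right, mul_zero, zero_smul, sub_zero] at h3
    have h4 := (smul_eq_zero.1 h3).resolve_left (by linarith)
    show K (-x) = 0
    rw [hKG (-x) (by simpa using h1.le) (by simpa using h2.le), h4]

section

variable {ι : Type*} [Fintype ι]

/-- A homotopy of vector-valued maps on the sphere that ends at a constant and starts at a map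
`h` with `h (-p) = R_p (h p)` has a zero. -/
lemma exists_zero_of_reflection_symmetric [Nonempty ι]
    {H : ℝ → EuclideanSpace ℝ ι → EuclideanSpace ℝ ι}
    (hc : ContinuousOn (fun q : ℝ × EuclideanSpace ℝ ι => H q.1 q.2)
      (Icc 0 1 ×ˢ sphere 0 1)) {v : EuclideanSpace ℝ ι}
    (h1 : ∀ p ∈ sphere (0 : EuclideanSpace ℝ ι) 1, H 1 p = v)
    (h0 : ∀ p ∈ sphere (0 : EuclideanSpace ℝ ι) 1, H 0 (-p) = H 0 p - (2 * ⟪p, H 0 p⟫) • p) :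
    ∃ k ∈ Icc (0 : ℝ) 1, ∃ p ∈ sphere (0 : EuclideanSpace ℝ ι) 1, H k p = 0 := by
  by_contra! hne
  have hcomp : IsCompact (Icc (0 : ℝ) 1 ×ˢ sphere (0 : EuclideanSpace ℝ ι) 1) :=
    isCompact_Icc.prod (isCompact_sphere _ _)
  obtain ⟨e, he⟩ : (sphere (0 : EuclideanSpace ℝ ι) 1).Nonempty :=
    NormedSpace.sphere_nonempty.2 zero_le_one
  have hv : v ≠ 0 := by
    rw [← h1 e he]
    exact hne 1 ⟨zero_le_one, le_rfl⟩ e he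
  obtain ⟨⟨k₀, p₀⟩, ⟨hk₀, hp₀⟩, hmin⟩ := hcomp.exists_isMinOn
    ⟨(0, e), ⟨⟨le_rfl, zero_le_one⟩, he⟩⟩ hc.norm
  let cl : ℝ → ℝ := fun t => max 0 (min 1 t)
  have hclc : Continuous cl := by fun_prop
  have hclm : ∀ t, cl t ∈ Icc (0 : ℝ) 1 := fun t =>
    ⟨le_max_left _ _, max_le zero_le_one (min_le_left _ _)⟩
  have hcl0 : ∀ t, t ≤ 0 → cl t = 0 := fun t ht => by
    simp [cl, ht]
  have hcl1 : ∀ t, 1 ≤ t → cl t = 1 := fun t ht => by simp [cl, ht]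
  have hsph : ∀ x : EuclideanSpace ℝ ι, x ≠ 0 → ‖x‖⁻¹ • x ∈ sphere (0 : EuclideanSpace ℝ ι) 1 :=
    fun x hx => by
      rw [mem_sphere_zero_iff_norm, norm_smul, norm_inv, norm_norm,
        inv_mul_cancel₀ (norm_ne_zero_iff.2 hx)]
  let F : EuclideanSpace ℝ ι → EuclideanSpace ℝ ι := fun x =>
    (1 - cl (‖x‖ ^ 2 - 1)) • x + cl (‖x‖ ^ 2 - 1) • H (cl (‖x‖ ^ 2 - 3)) (‖x‖⁻¹ • x)
  have hid : ∀ x, ‖x‖ ^ 2 ≤ 1 → F x = x := fun x hx => by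
    simp [F, hcl0 (‖x‖ ^ 2 - 1) (by linarith)]
  have hF2 : ∀ x, 2 ≤ ‖x‖ ^ 2 → F x = H (cl (‖x‖ ^ 2 - 3)) (‖x‖⁻¹ • x) := fun x hx => by
    simp [F, hcl1 (‖x‖ ^ 2 - 1) (by linarith)]
  have hnz : ∀ x : EuclideanSpace ℝ ι, 1 ≤ ‖x‖ ^ 2 → x ≠ 0 := by
    rintro x hx rfl
    norm_num at hx
  refine false_of_reflection_equivariant (F := F) (v := v) ?_ hv
    (norm_pos_iff.2 (hne k₀ hk₀ p₀ hp₀)) hid (fun x hx => ?_) (fun x hx => ?_) fun x hx => ?_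
  · rw [continuous_iff_continuousAt]
    intro x
    by_cases hx : x = 0
    · have h3 : F =ᶠ[𝓝 x] id := by
        have : ∀ᶠ x : EuclideanSpace ℝ ι in 𝓝 x, ‖x‖ ^ 2 < 1 :=
          (continuous_norm.pow 2).continuousAt.eventually_lt continuousAt_const (by simp [hx])
        filter_upwards [this] with x hx using hid x hx.le
      exact continuousAt_id.congr h3.symm
    · have h4 : ContinuousOn (fun x : EuclideanSpace ℝ ι =>
          H (cl (‖x‖ ^ 2 - 3)) (‖x‖⁻¹ • x)) {0}ᶜ := by
        refine hc.comp (f := fun x : EuclideanSpace ℝ ι => (cl (‖x‖ ^ 2 - 3), ‖x‖⁻¹ • x)) ?_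
          fun x hx => ⟨hclm _, hsph x hx⟩
        refine ContinuousOn.prodMk (by fun_prop) ?_
        exact (continuous_norm.continuousOn.inv₀ fun x hx => norm_ne_zero_iff.2 hx).smul
          continuousOn_id
      have h5 := h4.continuousAt (isOpen_compl_singleton.mem_nhds hx)
      have h6 : Continuous fun x : EuclideanSpace ℝ ι => cl (‖x‖ ^ 2 - 1) := by fun_prop
      exact ((continuousAt_const.sub h6.continuousAt).smul continuousAt_id).add
        (h6.continuousAt.smul h5)
  · rw [hF2 x (by linarith), hcl1 _ (by linarith), h1 _ (hsph x (hnz x (by linarith)))]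
  · by_cases hx0 : x = 0
    · simp [hx0]
    · have hn : ‖x‖ ≠ 0 := norm_ne_zero_iff.2 hx0
      have h2 := h0 _ (hsph x hx0)
      set h := H 0 (‖x‖⁻¹ • x) with hh
      have h3 : F x = (1 - cl (‖x‖ ^ 2 - 1)) • x + cl (‖x‖ ^ 2 - 1) • h := by
        simp only [F, hcl0 (‖x‖ ^ 2 - 3) (by linarith), hh]
      have h4 : F (-x) = -((1 - cl (‖x‖ ^ 2 - 1)) • x) +
          cl (‖x‖ ^ 2 - 1) • (h - (2 * ⟪‖x‖⁻¹ • x, h⟫) • ‖x‖⁻¹ • x) := by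
        simp only [F, norm_neg, hcl0 (‖x‖ ^ 2 - 3) (by linarith), smul_neg, h2]
      rw [h3, h4]
      simp only [inner_add_right, inner_neg_right, inner_sub_right, inner_smul_right,
        inner_smul_left, real_inner_self_eq_norm_sq, conj_trivial]
      match_scalars <;> field_simp <;> ring
  · rw [hF2 x hx]
    exact hmin (a := (_, _)) ⟨hclm _, hsph x (hnz x (by linarith))⟩

end

section Boost

set_option linter.unusedSectionVars false

variable {V : Type*} [NormedAddCommGroup V] [InnerProductSpace ℝ V]

/-- The time component `√(1 + ‖y‖²)` of the point of the hyperboloid over `y`. -/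
def hypT (y : V) : ℝ := √(1 + ‖y‖ ^ 2)

/-- Time component of the Lorentz boost by `y` applied to `(a, v)`. -/
def boostT (y : V) (a : ℝ) (v : V) : ℝ := hypT y * a + ⟪y, v⟫

/-- Space component of the Lorentz boost by `y` applied to `(a, v)`. -/
def boostS (y : V) (a : ℝ) (v : V) : V := v + (a + ⟪y, v⟫ / (1 + hypT y)) • y

lemma hypT_sq (y : V) : hypT y ^ 2 = 1 + ‖y‖ ^ 2 := Real.sq_sqrt (by positivity)

lemma one_le_hypT (y : V) : 1 ≤ hypT y := by
  rw [hypT, Real.one_le_sqrt]; nlinarith [norm_nonneg y]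

lemma hypT_pos (y : V) : 0 < hypT y := zero_lt_one.trans_le (one_le_hypT y)

lemma norm_lt_hypT (y : V) : ‖y‖ < hypT y := by
  refine lt_of_pow_lt_pow_left₀ 2 (hypT_pos y).le ?_
  rw [hypT_sq]; linarith

lemma continuous_hypT : Continuous (hypT : V → ℝ) := by
  unfold hypT; fun_prop

lemma norm_boostS_sq (y : V) (a : ℝ) (v : V) :
    ‖boostS y a v‖ ^ 2 = boostT y a v ^ 2 - a ^ 2 + ‖v‖ ^ 2 := by
  have h := hypT_sq y
  have h1 : 1 + hypT y ≠ 0 := by linarith [hypT_pos y]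
  have h2 : ‖y‖ ^ 2 = (hypT y - 1) * (hypT y + 1) := by linarith
  rw [boostS, norm_add_sq_real, norm_smul, mul_pow, Real.norm_eq_abs, sq_abs, inner_smul_right,
    real_inner_comm y v, boostT, h2]
  field_simp
  ring

lemma le_boostT_one (y : V) {v : V} (hv : ‖v‖ = 1) : hypT y - ‖y‖ ≤ boostT y 1 v := by
  have := abs_le.1 (abs_real_inner_le_norm y v)
  rw [hv, mul_one] at this
  rw [boostT]; linarith [this.1]

lemma boostT_one_le (y : V) {v : V} (hv : ‖v‖ = 1) : boostT y 1 v ≤ hypT y + ‖y‖ := by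
  have := abs_le.1 (abs_real_inner_le_norm y v)
  rw [hv, mul_one] at this
  rw [boostT]; linarith [this.2]

lemma boostT_one_pos (y : V) {v : V} (hv : ‖v‖ = 1) : 0 < boostT y 1 v :=
  (sub_pos.2 (norm_lt_hypT y)).trans_le (le_boostT_one y hv)

/-- Conformal automorphism of the unit sphere induced by the Lorentz boost. -/
def confBoost (y v : V) : V := (boostT y 1 v)⁻¹ • boostS y 1 v

lemma norm_confBoost (y : V) {v : V} (hv : ‖v‖ = 1) : ‖confBoost y v‖ = 1 := by
  have h1 := boostT_one_pos y hv
  have h2 := norm_boostS_sq y 1 v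
  rw [hv, sub_add_cancel] at h2
  rw [pow_left_inj₀ (norm_nonneg _) h1.le two_ne_zero] at h2
  rw [confBoost, norm_smul, h2, norm_inv, Real.norm_of_nonneg h1.le, inv_mul_cancel₀ h1.ne']

lemma abs_log_boostT_le (y : V) {v : V} (hv : ‖v‖ = 1) :
    |log (boostT y 1 v)| ≤ log (hypT y + ‖y‖) := by
  have h1 := boostT_one_pos y hv
  have h3 : 0 < hypT y + ‖y‖ := by linarith [hypT_pos y, norm_nonneg y]
  have h4 : (hypT y + ‖y‖)⁻¹ = hypT y - ‖y‖ := by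
    rw [inv_eq_iff_eq_inv, eq_comm, inv_eq_of_mul_eq_one_left]
    linarith [hypT_sq y, sq (‖y‖), sq (hypT y)]
  refine abs_le.2 ⟨?_, Real.log_le_log h1 (boostT_one_le y hv)⟩
  rw [← Real.log_inv, h4]
  exact Real.log_le_log (sub_pos.2 (norm_lt_hypT y)) (le_boostT_one y hv)

lemma continuous_boostT_one : Continuous fun q : V × V => boostT q.1 1 q.2 := by
  have := continuous_hypT (V := V)
  unfold boostT
  fun_prop

lemma continuousAt_confBoost {q : V × V} (hq : ‖q.2‖ = 1) :
    ContinuousAt (fun q : V × V => confBoost q.1 q.2) q := by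
  have h1 := continuous_hypT (V := V)
  have h2 := (continuous_boostT_one (V := V)).continuousAt (x := q)
  have h3 : Continuous fun q : V × V => boostS q.1 1 q.2 := by
    unfold boostS
    refine continuous_snd.add (Continuous.smul (continuous_const.add ?_) continuous_fst)
    refine Continuous.div (by fun_prop) (by fun_prop) fun q => ?_
    have := hypT_pos q.1
    positivity
  exact (h2.inv₀ (boostT_one_pos q.1 hq).ne').smul h3.continuousAt

variable {X : Type*} [MeasurableSpace X] {μ : Measure X}

/-- The functional whose critical points renormalize the measure. -/
def herschFun (μ : Measure X) (f : X → V) (y : V) : ℝ := ∫ x, log (boostT y 1 (f x)) ∂μ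

lemma herschFun_zero (f : X → V) : herschFun μ f 0 = 0 := by
  simp [herschFun, boostT, hypT]

lemma aestronglyMeasurable_log_boostT {f : X → V} (hf : AEStronglyMeasurable f μ) (y : V) :
    AEStronglyMeasurable (fun x => log (boostT y 1 (f x))) μ := by
  have : AEStronglyMeasurable (fun x => boostT y 1 (f x)) μ := by
    unfold boostT
    exact aestronglyMeasurable_const.add (aestronglyMeasurable_const.inner hf)
  exact this.aemeasurable.log.aestronglyMeasurable

variable [IsFiniteMeasure μ]

lemma integrable_log_boostT {f : X → V} (hf : AEStronglyMeasurable f μ)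
    (h1 : ∀ᵐ x ∂μ, ‖f x‖ = 1) (y : V) :
    Integrable (fun x => log (boostT y 1 (f x))) μ := by
  refine Integrable.of_bound (aestronglyMeasurable_log_boostT hf y) (log (hypT y + ‖y‖)) ?_
  filter_upwards [h1] with x hx using abs_log_boostT_le y hx

lemma tendsto_herschFun {f : ℕ → X → V} {f₀ : X → V} (hf : ∀ j, AEStronglyMeasurable (f j) μ)
    (h1 : ∀ j, ∀ᵐ x ∂μ, ‖f j x‖ = 1) (h0 : ∀ᵐ x ∂μ, ‖f₀ x‖ = 1)
    (hlim : ∀ᵐ x ∂μ, Tendsto (fun j => f j x) atTop (𝓝 (f₀ x)))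
    {y : ℕ → V} {y₀ : V} (hy : Tendsto y atTop (𝓝 y₀)) :
    Tendsto (fun j => herschFun μ (f j) (y j)) atTop (𝓝 (herschFun μ f₀ y₀)) := by
  have hb : Tendsto (fun j => log (hypT (y j) + ‖y j‖)) atTop
      (𝓝 (log (hypT y₀ + ‖y₀‖))) := by
    refine Tendsto.log (((continuous_hypT.tendsto _).comp hy).add hy.norm) ?_
    have := hypT_pos y₀
    positivity
  obtain ⟨C, hC⟩ := hb.bddAbove_range
  refine tendsto_integral_of_dominated_convergence (fun _ => C)
    (fun j => aestronglyMeasurable_log_boostT (hf j) _) (integrable_const C) (fun j => ?_) ?_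
  · filter_upwards [h1 j] with x hx
    exact (abs_log_boostT_le _ hx).trans (hC ⟨j, rfl⟩)
  · filter_upwards [hlim, h0] with x hx hx0
    refine Tendsto.log ?_ (boostT_one_pos y₀ hx0).ne'
    unfold boostT
    exact (((continuous_hypT.tendsto y₀).comp hy).mul_const 1).add (hy.inner hx)

end Boost

section Hersch

set_option linter.unusedSectionVars false

variable {V : Type*} [NormedAddCommGroup V] [InnerProductSpace ℝ V] [FiniteDimensional ℝ V]
  {X : Type*} [MeasurableSpace X] {μ : Measure X} [IsFiniteMeasure μ]

/-- Coercivity of the Hersch functional, uniformly along convergent sequences of maps. -/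
lemma bddAbove_norm_of_herschFun_nonpos (hμ : μ ≠ 0) {f : ℕ → X → V} {f₀ : X → V}
    (hf : ∀ j, AEStronglyMeasurable (f j) μ)
    (h1 : ∀ j, ∀ᵐ x ∂μ, ‖f j x‖ = 1) (h0 : ∀ᵐ x ∂μ, ‖f₀ x‖ = 1)
    (hlim : ∀ᵐ x ∂μ, Tendsto (fun j => f j x) atTop (𝓝 (f₀ x)))
    (hnull : ∀ e, ∀ᵐ x ∂μ, f₀ x ≠ e)
    {y : ℕ → V} (hy : ∀ j, herschFun μ (f j) (y j) ≤ 0) :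
    ∃ C, ∀ j, ‖y j‖ ≤ C := by
  by_contra! hunb
  obtain ⟨φ, hφ, hφy⟩ : ∃ φ : ℕ → ℕ, StrictMono φ ∧ ∀ j : ℕ, (j : ℝ) ≤ ‖y (φ j)‖ := by
    have hfreq : ∀ j : ℕ, ∃ᶠ k in atTop, (j : ℝ) ≤ ‖y k‖ := by
      intro j
      rw [Filter.frequently_atTop]
      intro N
      obtain ⟨k, hk⟩ := hunb (j + ∑ i ∈ Finset.range N, ‖y i‖)
      refine ⟨k, ?_, ?_⟩
      · by_contra! h
        have := Finset.single_le_sum (f := fun i => ‖y i‖) (fun i _ => norm_nonneg _)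
          (Finset.mem_range.2 h)
        have h2 : (0 : ℝ) ≤ j := Nat.cast_nonneg j
        linarith
      · have : 0 ≤ ∑ i ∈ Finset.range N, ‖y i‖ := Finset.sum_nonneg fun i _ => norm_nonneg _
        linarith
    exact Filter.extraction_forall_of_frequently hfreq
  have hTinf : Tendsto (fun j => hypT (y (φ j))) atTop atTop :=
    tendsto_atTop_mono (fun j => (hφy j).trans (norm_lt_hypT _).le) tendsto_natCast_atTop_atTop
  have hzmem : ∀ j, (hypT (y (φ j)))⁻¹ • y (φ j) ∈ closedBall (0 : V) 1 := fun j => by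
    rw [mem_closedBall_zero_iff, norm_smul, norm_inv, Real.norm_of_nonneg (hypT_pos _).le,
      inv_mul_le_one₀ (hypT_pos _)]
    exact (norm_lt_hypT _).le
  obtain ⟨z, hz, ψ, hψ, hψz⟩ := (isCompact_closedBall (0 : V) 1).tendsto_subseq hzmem
  set θ : ℕ → ℕ := fun j => φ (ψ j) with hθ
  have hθt : Tendsto θ atTop atTop := (hφ.comp hψ).tendsto_atTop
  have hT : Tendsto (fun j => hypT (y (θ j))) atTop atTop := hTinf.comp hψ.tendsto_atTop
  have hL : Tendsto (fun j => log (hypT (y (θ j)))) atTop atTop := Real.tendsto_log_atTop.comp hT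
  set g : ℕ → X → ℝ := fun j x => log (boostT (y (θ j)) 1 (f (θ j) x)) / log (hypT (y (θ j)))
    with hg
  have hgint : ∀ j, 1 ≤ log (hypT (y (θ j))) → ∫ x, g j x ∂μ ≤ 0 := by
    intro j hj
    rw [integral_div]
    exact div_nonpos_of_nonpos_of_nonneg (hy (θ j)) (by linarith)
  have hev : ∀ᶠ j in atTop, 1 ≤ log (hypT (y (θ j))) := hL.eventually_ge_atTop 1
  have hlimg : Tendsto (fun j => ∫ x, g j x ∂μ) atTop (𝓝 (∫ _, (1 : ℝ) ∂μ)) := by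
    refine tendsto_integral_filter_of_dominated_convergence (fun _ => 1 + log 2) ?_ ?_
      (integrable_const _) ?_
    · exact Eventually.of_forall fun j =>
        (aestronglyMeasurable_log_boostT (hf _) _).mul_const _
    · filter_upwards [hev] with j hj
      filter_upwards [h1 (θ j)] with x hx
      have h2 := abs_log_boostT_le (y (θ j)) hx
      have h3 : log (hypT (y (θ j)) + ‖y (θ j)‖) ≤ log 2 + log (hypT (y (θ j))) := by
        rw [← Real.log_mul two_ne_zero (hypT_pos _).ne']
        refine Real.log_le_log ?_ ?_
        · linarith [hypT_pos (y (θ j)), norm_nonneg (y (θ j))]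
        · linarith [norm_lt_hypT (y (θ j))]
      rw [hg, norm_div, Real.norm_eq_abs, Real.norm_of_nonneg (by linarith : 0 ≤ log _),
        div_le_iff₀ (by linarith)]
      nlinarith [Real.log_nonneg one_le_two]
    · have hall : ∀ᵐ x ∂μ, ∀ j, ‖f j x‖ = 1 := ae_all_iff.2 h1
      filter_upwards [hlim, hnull (-z), h0, hall] with x hx hxz hx0 hx1
      have hpos : 0 < 1 + ⟪z, f₀ x⟫ := by
        have h2 : ‖z‖ ≤ 1 := by simpa using hz
        have h3 := norm_add_sq_real z (f₀ x)
        have h4 : 0 < ‖z + f₀ x‖ ^ 2 := by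
          have : z + f₀ x ≠ 0 := fun h => hxz (eq_neg_of_add_eq_zero_right h)
          positivity
        rw [hx0] at h3
        nlinarith [norm_nonneg z]
      have h5 : Tendsto (fun j => log (1 + ⟪(hypT (y (θ j)))⁻¹ • y (θ j), f (θ j) x⟫))
          atTop (𝓝 (log (1 + ⟪z, f₀ x⟫))) := by
        refine Tendsto.log (Tendsto.const_add 1 ?_) hpos.ne'
        exact Tendsto.inner hψz (hx.comp hθt)
      have h6 := (h5.div_atTop hL).const_add 1
      rw [add_zero] at h6
      refine h6.congr' ?_
      filter_upwards [hev] with j hj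
      have h7 := hypT_pos (y (θ j))
      have h8 := boostT_one_pos (y (θ j)) (hx1 (θ j))
      have h9 : boostT (y (θ j)) 1 (f (θ j) x) = hypT (y (θ j)) *
          (1 + ⟪(hypT (y (θ j)))⁻¹ • y (θ j), f (θ j) x⟫) := by
        rw [boostT, inner_smul_left, conj_trivial, mul_add, mul_inv_cancel_left₀ h7.ne']
      have h10 : 1 + ⟪(hypT (y (θ j)))⁻¹ • y (θ j), f (θ j) x⟫ ≠ 0 := by
        intro h
        rw [h9, h, mul_zero] at h8
        exact lt_irrefl _ h8
      rw [hg]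
      simp only
      rw [h9, Real.log_mul h7.ne' h10, add_div, div_self (by linarith)]
  have hle : ∫ _, (1 : ℝ) ∂μ ≤ 0 := le_of_tendsto hlimg (hev.mono hgint)
  rw [integral_const, smul_eq_mul, mul_one] at hle
  have : μ.real univ = 0 := le_antisymm hle measureReal_nonneg
  rw [measureReal_eq_zero_iff] at this
  exact hμ (Measure.measure_univ_eq_zero.1 this)

/-- `y` minimizes the Hersch functional of `f`. -/
def IsHerschMin (μ : Measure X) (f : X → V) (y : V) : Prop :=
  ∀ y', herschFun μ f y ≤ herschFun μ f y'

lemma exists_isHerschMin (hμ : μ ≠ 0) {f : X → V} (hf : AEStronglyMeasurable f μ)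
    (h1 : ∀ᵐ x ∂μ, ‖f x‖ = 1) (hnull : ∀ e, ∀ᵐ x ∂μ, f x ≠ e) :
    ∃ y, IsHerschMin μ f y := by
  have hcont : Continuous (herschFun μ f) := by
    rw [continuous_iff_seqContinuous]
    intro y y₀ hy
    exact tendsto_herschFun (fun _ => hf) (fun _ => h1) h1
      (Eventually.of_forall fun _ => tendsto_const_nhds) hy
  obtain ⟨C, hC⟩ : ∃ C, ∀ y, herschFun μ f y ≤ 0 → ‖y‖ ≤ C := by
    by_contra! h
    choose y hy hyn using fun j : ℕ => h j
    obtain ⟨C, hC⟩ := bddAbove_norm_of_herschFun_nonpos hμ (fun _ => hf) (fun _ => h1) h1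
      (Eventually.of_forall fun _ => tendsto_const_nhds) hnull hy
    obtain ⟨j, hj⟩ := exists_nat_gt C
    linarith [hC j, hyn j]
  obtain ⟨y, hy, hmin⟩ := (isCompact_closedBall (0 : V) (max C 0)).exists_isMinOn
    ⟨0, by simp⟩ hcont.continuousOn
  refine ⟨y, fun y' => ?_⟩
  have h00 : herschFun μ f y ≤ 0 := by
    rw [← herschFun_zero (μ := μ) f]; exact hmin (by simp)
  by_cases h : herschFun μ f y' ≤ 0
  · exact hmin (by simpa using Or.inl (hC y' h))
  · linarith

/-- Reversed Cauchy–Schwarz inequality in the form used for the convexity of the Hersch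
functional, with equality case. -/
lemma boostT_midpoint {y y' v : V} (hv : ‖v‖ = 1) :
    (boostT y 1 v + boostT y' 1 v) ^ 2 ≤
      (2 + 2 * (hypT y * hypT y' - ⟪y, y'⟫)) * (boostT y 1 v * boostT y' 1 v) ∧
    ((boostT y 1 v + boostT y' 1 v) ^ 2 =
      (2 + 2 * (hypT y * hypT y' - ⟪y, y'⟫)) * (boostT y 1 v * boostT y' 1 v) →
      boostT y' 1 v • y - boostT y 1 v • y' =
        -((boostT y' 1 v * hypT y - boostT y 1 v * hypT y') • v)) := by
  set A := boostT y 1 v with hA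
  set B := boostT y' 1 v with hB
  set Z := B * hypT y - A * hypT y' with hZ
  set z := B • y - A • y' with hz
  have hzv : ⟪z, v⟫ = -Z := by
    simp only [hz, hZ, inner_sub_left, inner_smul_left, conj_trivial]
    have h1 : ⟪y, v⟫ = A - hypT y := by simp [hA, boostT]
    have h2 : ⟪y', v⟫ = B - hypT y' := by simp [hB, boostT]
    rw [h1, h2]; ring
  have hsq : ‖z + Z • v‖ ^ 2 = ‖z‖ ^ 2 - Z ^ 2 := by
    rw [norm_add_sq_real, inner_smul_right, hzv, norm_smul, hv, mul_one, Real.norm_eq_abs,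
      sq_abs]
    ring
  have hzn : ‖z‖ ^ 2 = B ^ 2 * ‖y‖ ^ 2 - 2 * (A * B * ⟪y, y'⟫) + A ^ 2 * ‖y'‖ ^ 2 := by
    rw [hz, norm_sub_sq_real, norm_smul, norm_smul, mul_pow, mul_pow, Real.norm_eq_abs,
      Real.norm_eq_abs, sq_abs, sq_abs, inner_smul_left, inner_smul_right, conj_trivial]
    ring
  have h1 := hypT_sq y
  have h2 := hypT_sq y'
  have hkey : ‖z + Z • v‖ ^ 2 =
      (2 + 2 * (hypT y * hypT y' - ⟪y, y'⟫)) * (A * B) - (A + B) ^ 2 := by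
    rw [hsq, hzn, hZ]
    linear_combination (-B ^ 2) * h1 - A ^ 2 * h2
  refine ⟨by nlinarith [sq_nonneg ‖z + Z • v‖], fun h => ?_⟩
  rw [h, sub_self, sq_eq_zero_iff, norm_eq_zero] at hkey
  exact eq_neg_of_add_eq_zero_left hkey

end Hersch

section Hersch

set_option linter.unusedSectionVars false

variable {V : Type*} [NormedAddCommGroup V] [InnerProductSpace ℝ V] [FiniteDimensional ℝ V]
  {X : Type*} [MeasurableSpace X] {μ : Measure X} [IsFiniteMeasure μ]

lemma one_le_hypT_mul_sub_inner (y y' : V) : 1 ≤ hypT y * hypT y' - ⟪y, y'⟫ := by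
  have h1 := hypT_sq y
  have h2 := hypT_sq y'
  have h3 := real_inner_le_norm y y'
  have h4 : 1 + ‖y‖ * ‖y'‖ ≤ hypT y * hypT y' := by
    refine le_of_sq_le_sq ?_ (mul_pos (hypT_pos y) (hypT_pos y')).le
    rw [mul_pow, h1, h2]
    nlinarith [sq_nonneg (‖y‖ - ‖y'‖)]
  linarith

/-- The normalized midpoint of two points of the hyperboloid. -/
def hypMid (y y' : V) : V := (√(2 + 2 * (hypT y * hypT y' - ⟪y, y'⟫)))⁻¹ • (y + y')

lemma boostT_hypMid (y y' v : V) :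
    boostT (hypMid y y') 1 v =
      (boostT y 1 v + boostT y' 1 v) / √(2 + 2 * (hypT y * hypT y' - ⟪y, y'⟫)) := by
  have hc := one_le_hypT_mul_sub_inner y y'
  set r := √(2 + 2 * (hypT y * hypT y' - ⟪y, y'⟫)) with hr
  have hr2 : r ^ 2 = 2 + 2 * (hypT y * hypT y' - ⟪y, y'⟫) := Real.sq_sqrt (by linarith)
  have hrpos : 0 < r := Real.sqrt_pos.2 (by linarith)
  have h1 : hypT (hypMid y y') = (hypT y + hypT y') / r := by
    rw [hypT, Real.sqrt_eq_iff_mul_self_eq_of_pos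
      (div_pos (add_pos (hypT_pos _) (hypT_pos _)) hrpos)]
    have h2 : ‖hypMid y y'‖ ^ 2 = ‖y + y'‖ ^ 2 / r ^ 2 := by
      rw [hypMid, norm_smul, ← hr, norm_inv, Real.norm_of_nonneg hrpos.le]
      field_simp
    rw [h2, norm_add_sq_real]
    field_simp
    rw [hr2]
    linear_combination hypT_sq y + hypT_sq y'
  rw [boostT, h1, hypMid, ← hr, inner_smul_left, conj_trivial, inner_add_left, boostT, boostT]
  field_simp
  ring

lemma IsHerschMin.eq (hμ : μ ≠ 0) {f : X → V} (hf : AEStronglyMeasurable f μ)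
    (h1 : ∀ᵐ x ∂μ, ‖f x‖ = 1) (hnull : ∀ e, ∀ᵐ x ∂μ, f x ≠ e) {y y' : V}
    (hy : IsHerschMin μ f y) (hy' : IsHerschMin μ f y') : y = y' := by
  by_contra hne
  set c := hypT y * hypT y' - ⟪y, y'⟫ with hcdef
  have hc : 1 ≤ c := one_le_hypT_mul_sub_inner y y'
  have hI := integrable_log_boostT hf h1 y
  have hI' := integrable_log_boostT hf h1 y'
  have hIm := integrable_log_boostT hf h1 (hypMid y y')
  set d : X → ℝ := fun x => 2⁻¹ * (log (boostT y 1 (f x)) + log (boostT y' 1 (f x))) -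
    log (boostT (hypMid y y') 1 (f x)) with hd
  have hdint : Integrable d μ := ((hI.add hI').const_mul _).sub hIm
  have hdeq : ∀ x, ‖f x‖ = 1 → d x = 2⁻¹ * (log ((2 + 2 * c) *
      (boostT y 1 (f x) * boostT y' 1 (f x))) -
        log ((boostT y 1 (f x) + boostT y' 1 (f x)) ^ 2)) := by
    intro x hx
    have hA := boostT_one_pos y hx
    have hB := boostT_one_pos y' hx
    rw [hd]
    simp only
    rw [boostT_hypMid, ← hcdef, Real.log_div (by positivity) (by positivity),
      Real.log_sqrt (by positivity), Real.log_mul (by positivity) (by positivity),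
      Real.log_mul hA.ne' hB.ne', Real.log_pow]
    push_cast
    ring
  have hd0 : 0 ≤ᵐ[μ] d := by
    filter_upwards [h1] with x hx
    have hA := boostT_one_pos y hx
    have hB := boostT_one_pos y' hx
    rw [Pi.zero_apply, hdeq x hx]
    have := Real.log_le_log (by positivity) (boostT_midpoint (y := y) (y' := y') hx).1
    linarith
  have hdi : ∫ x, d x ∂μ ≤ 0 := by
    have e1 : ∫ x, d x ∂μ = 2⁻¹ * (herschFun μ f y + herschFun μ f y') -
        herschFun μ f (hypMid y y') := by
      have e2 := integral_sub ((hI.add hI').const_mul 2⁻¹) hIm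
      rw [integral_const_mul, integral_add' hI hI'] at e2
      exact e2
    rw [e1]
    linarith [hy (hypMid y y'), hy' (hypMid y y')]
  have hdz : d =ᵐ[μ] 0 := (integral_eq_zero_iff_of_nonneg_ae hd0 hdint).1
    (le_antisymm hdi (integral_nonneg_of_ae hd0))
  set e : ℝ → V := fun t => -((hypT y - t * hypT y')⁻¹ • (y - t • y')) with he
  have hfalse : ∀ᵐ x ∂μ, False := by
    filter_upwards [hdz, h1, hnull (e (c + √(c ^ 2 - 1))), hnull (e (c - √(c ^ 2 - 1)))]
      with x hx hx1 he1 he2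
    have hA := boostT_one_pos y hx1
    have hB := boostT_one_pos y' hx1
    rw [hdeq x hx1, Pi.zero_apply] at hx
    have heq : (boostT y 1 (f x) + boostT y' 1 (f x)) ^ 2 =
        (2 + 2 * c) * (boostT y 1 (f x) * boostT y' 1 (f x)) :=
      Real.log_injOn_pos (mem_Ioi.2 (by positivity)) (mem_Ioi.2 (by positivity)) (by linarith)
    have hvec := (boostT_midpoint (y := y) (y' := y') hx1).2 heq
    set A := boostT y 1 (f x)
    set B := boostT y' 1 (f x)
    set t := A / B with ht
    have htpos : 0 < t := div_pos hA hB
    have hAt : A = t * B := by rw [ht]; field_simp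
    have hvec' : y - t • y' = -((hypT y - t * hypT y') • f x) := by
      have h3 : B • (y - t • y') = B • -((hypT y - t * hypT y') • f x) := by
        rw [hAt] at hvec
        have h4 : B • (y - t • y') = B • y - (t * B) • y' := by module
        rw [h4, hvec]
        module
      exact smul_right_injective V hB.ne' h3
    have hroot : (t - c) ^ 2 = c ^ 2 - 1 := by
      have h5 : B ^ 2 * ((t + 1) ^ 2 - (2 + 2 * c) * t) = 0 := by
        rw [hAt] at heq; linear_combination heq
      have h6 := (mul_eq_zero.1 h5).resolve_left (by positivity)
      linear_combination h6
    have hden : hypT y - t * hypT y' ≠ 0 := by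
      intro h0
      rw [h0, zero_smul, neg_zero, sub_eq_zero] at hvec'
      have h7 := hypT_sq y
      have h8 := hypT_sq y'
      rw [hvec', norm_smul, mul_pow, Real.norm_eq_abs, sq_abs, ← hvec', sub_eq_zero.1 h0] at h7
      have h9 : t ^ 2 = 1 := by linear_combination h7 - t ^ 2 * h8
      have h10 : t = 1 := by nlinarith
      rw [h10, one_smul] at hvec'
      exact hne hvec'
    have hfe : f x = e t := by
      rw [he]
      simp only
      rw [hvec', smul_neg, neg_neg, inv_smul_smul₀ hden]
    have hsq := Real.sq_sqrt (show 0 ≤ c ^ 2 - 1 by nlinarith)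
    rw [← hsq, sq_eq_sq_iff_eq_or_eq_neg] at hroot
    rcases hroot with h | h
    · exact he1 (by rw [hfe]; congr 1; linarith)
    · exact he2 (by rw [hfe]; congr 1; linarith)
  rw [ae_iff] at hfalse
  simp only [not_false_eq_true, ofPred_true, Measure.measure_univ_eq_zero] at hfalse
  exact hμ hfalse

/-- The minimizer of the Hersch functional depends continuously on the map. -/
lemma tendsto_isHerschMin (hμ : μ ≠ 0) {f : ℕ → X → V} {f₀ : X → V}
    (hf : ∀ j, AEStronglyMeasurable (f j) μ) (hf₀ : AEStronglyMeasurable f₀ μ)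
    (h1 : ∀ j, ∀ᵐ x ∂μ, ‖f j x‖ = 1) (h0 : ∀ᵐ x ∂μ, ‖f₀ x‖ = 1)
    (hlim : ∀ᵐ x ∂μ, Tendsto (fun j => f j x) atTop (𝓝 (f₀ x)))
    (hnull : ∀ e, ∀ᵐ x ∂μ, f₀ x ≠ e)
    {y : ℕ → V} {y₀ : V} (hy : ∀ j, IsHerschMin μ (f j) (y j)) (hy₀ : IsHerschMin μ f₀ y₀) :
    Tendsto y atTop (𝓝 y₀) := by
  obtain ⟨C, hC⟩ := bddAbove_norm_of_herschFun_nonpos hμ hf h1 h0 hlim hnull (y := y)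
    (fun j => by rw [← herschFun_zero (μ := μ) (f j)]; exact hy j 0)
  refine tendsto_of_subseq_tendsto fun ns hns => ?_
  obtain ⟨z, -, ms, hms, hz⟩ := (isCompact_closedBall (0 : V) C).tendsto_subseq
    (x := fun j => y (ns j)) (fun j => by simpa using hC (ns j))
  refine ⟨ms, ?_⟩
  have hθ : Tendsto (fun j => ns (ms j)) atTop atTop := hns.comp hms.tendsto_atTop
  have hlim' : ∀ᵐ x ∂μ, Tendsto (fun j => f (ns (ms j)) x) atTop (𝓝 (f₀ x)) := by
    filter_upwards [hlim] with x hx using hx.comp hθ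
  have hzmin : IsHerschMin μ f₀ z := by
    intro y'
    exact le_of_tendsto_of_tendsto'
      (tendsto_herschFun (fun j => hf _) (fun j => h1 _) h0 hlim' hz)
      (tendsto_herschFun (fun j => hf _) (fun j => h1 _) h0 hlim'
        (tendsto_const_nhds (x := y')))
      (fun j => hy _ y')
  rw [← hzmin.eq hμ hf₀ h0 hnull hy₀]
  exact hz

lemma hasDerivAt_hypT_line (y v : V) (t : ℝ) :
    HasDerivAt (fun t : ℝ => hypT (y + t • v)) (⟪y + t • v, v⟫ / hypT (y + t • v)) t := by
  have h1 : HasDerivAt (fun t : ℝ => y + t • v) v t := by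
    simpa using ((hasDerivAt_id t).smul_const v).const_add y
  have h2 := (h1.norm_sq.const_add 1).sqrt (by positivity)
  rw [mul_div_mul_left _ _ (two_ne_zero' ℝ)] at h2
  exact h2

lemma hypT_le (y : V) : hypT y ≤ 1 + ‖y‖ := by
  rw [hypT, Real.sqrt_le_left (by positivity)]
  nlinarith [norm_nonneg y]

lemma inv_boostT_le (y : V) {v : V} (hv : ‖v‖ = 1) :
    (boostT y 1 v)⁻¹ ≤ 1 + 2 * ‖y‖ := by
  have h1 := le_boostT_one y hv
  have h2 := norm_lt_hypT y
  have h3 := hypT_le y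
  have h4 := hypT_sq y
  rw [inv_le_comm₀ (boostT_one_pos y hv) (by positivity)]
  refine le_trans ?_ h1
  rw [inv_le_iff_one_le_mul₀ (by positivity)]
  nlinarith

lemma aestronglyMeasurable_confBoost {f : X → V} (hf : AEStronglyMeasurable f μ) (y : V) :
    AEStronglyMeasurable (fun x => confBoost y (f x)) μ := by
  unfold confBoost
  have hT : AEStronglyMeasurable (fun x => boostT y 1 (f x)) μ := by
    unfold boostT
    exact aestronglyMeasurable_const.add (aestronglyMeasurable_const.inner hf)
  refine AEStronglyMeasurable.smul hT.aemeasurable.inv.aestronglyMeasurable ?_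
  exact (show Continuous fun v : V => boostS y 1 v by unfold boostS; fun_prop)
    |>.comp_aestronglyMeasurable hf

lemma integrable_confBoost {f : X → V} (hf : AEStronglyMeasurable f μ)
    (h1 : ∀ᵐ x ∂μ, ‖f x‖ = 1) (y : V) : Integrable (fun x => confBoost y (f x)) μ := by
  refine (integrable_const (1 : ℝ)).mono' (aestronglyMeasurable_confBoost hf y) ?_
  filter_upwards [h1] with x hx using (norm_confBoost y hx).le

/-- The Euler–Lagrange equation of the Hersch functional. -/
lemma IsHerschMin.integral_confBoost {f : X → V} (hf : AEStronglyMeasurable f μ)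
    (h1 : ∀ᵐ x ∂μ, ‖f x‖ = 1) {y : V} (hy : IsHerschMin μ f y) :
    ∫ x, confBoost y (f x) ∂μ = 0 := by
  have hdir : ∀ v : V,
      ∫ x, (⟪y, v⟫ / hypT y + ⟪v, f x⟫) * (boostT y 1 (f x))⁻¹ ∂μ = 0 := by
    intro v
    set F' : ℝ → X → ℝ := fun t x =>
      (⟪y + t • v, v⟫ / hypT (y + t • v) + ⟪v, f x⟫) / boostT (y + t • v) 1 (f x) with hF'
    have hmeas : ∀ t, AEStronglyMeasurable (F' t) μ := by
      intro t
      have hT : AEStronglyMeasurable (fun x => boostT (y + t • v) 1 (f x)) μ := by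
        unfold boostT
        exact aestronglyMeasurable_const.add (aestronglyMeasurable_const.inner hf)
      exact ((aestronglyMeasurable_const.add
        (aestronglyMeasurable_const.inner hf)).aemeasurable.div
          hT.aemeasurable).aestronglyMeasurable
    have hderiv := hasDerivAt_integral_of_dominated_loc_of_deriv_le (μ := μ)
      (F := fun (t : ℝ) x => log (boostT (y + t • v) 1 (f x))) (F' := F') (x₀ := 0)
      (s := ball 0 1) (bound := fun _ => 2 * ‖v‖ * (1 + 2 * (‖y‖ + ‖v‖)))
      (ball_mem_nhds 0 one_pos)
      (Eventually.of_forall fun t => aestronglyMeasurable_log_boostT hf _)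
      (integrable_log_boostT hf h1 _) (hmeas 0)
      (by
        filter_upwards [h1] with x hx t ht
        have ht1 : |t| ≤ 1 := by simpa using (mem_ball_zero_iff.1 ht).le
        rw [hF', norm_div, Real.norm_of_nonneg (boostT_one_pos _ hx).le, div_eq_mul_inv]
        have h2 : ‖y + t • v‖ ≤ ‖y‖ + ‖v‖ := by
          refine (norm_add_le _ _).trans ?_
          rw [norm_smul, Real.norm_eq_abs]
          nlinarith [norm_nonneg v]
        refine mul_le_mul ?_ ((inv_boostT_le _ hx).trans (by linarith))
          (inv_nonneg.2 (boostT_one_pos _ hx).le) (by positivity)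
        refine (norm_add_le _ _).trans ?_
        have h3 : ‖⟪y + t • v, v⟫ / hypT (y + t • v)‖ ≤ ‖v‖ := by
          rw [norm_div, Real.norm_of_nonneg (hypT_pos _).le, div_le_iff₀ (hypT_pos _)]
          refine (norm_inner_le_norm _ _).trans ?_
          nlinarith [norm_lt_hypT (y + t • v), norm_nonneg v]
        have h4 : ‖(⟪v, f x⟫ : ℝ)‖ ≤ ‖v‖ := by
          simpa [hx] using norm_inner_le_norm (𝕜 := ℝ) v (f x)
        linarith)
      (integrable_const _)
      (by
        filter_upwards [h1] with x hx t _
        have h5 : HasDerivAt (fun t : ℝ => boostT (y + t • v) 1 (f x))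
            (⟪y + t • v, v⟫ / hypT (y + t • v) + ⟪v, f x⟫) t := by
          unfold boostT
          refine HasDerivAt.add (by simpa using (hasDerivAt_hypT_line y v t).mul_const 1) ?_
          have h6 : HasDerivAt (fun t : ℝ => ⟪y, f x⟫ + t * ⟪v, f x⟫) ⟪v, f x⟫ t := by
            simpa using ((hasDerivAt_id t).mul_const ⟪v, f x⟫).const_add ⟪y, f x⟫
          refine h6.congr_of_eventuallyEq (Eventually.of_forall fun t => ?_)
          simp [inner_add_left, inner_smul_left]
        exact h5.log (boostT_one_pos _ hx).ne')
    have hmin : IsLocalMin (fun t : ℝ => ∫ x, log (boostT (y + t • v) 1 (f x)) ∂μ) 0 := by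
      refine Eventually.of_forall fun t => ?_
      simpa [herschFun] using hy (y + t • v)
    have h7 := hmin.hasDerivAt_eq_zero hderiv.2
    simpa [hF', div_eq_mul_inv] using h7
  have h_int := integrable_confBoost hf h1 y
  refine ext_inner_left ℝ fun u => ?_
  rw [inner_zero_right, ← integral_inner h_int]
  rw [← hdir (u + (⟪y, u⟫ / (1 + hypT y)) • y)]
  refine integral_congr_ae ?_
  filter_upwards with x
  have hp := hypT_pos y
  have hp1 : 1 + hypT y ≠ 0 := by positivity
  have hsq := hypT_sq y
  rw [confBoost, inner_smul_right, mul_comm]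
  congr 1
  rw [boostS, inner_add_right, inner_smul_right, inner_add_right, inner_add_left,
    inner_smul_right, inner_smul_left, conj_trivial, real_inner_self_eq_norm_sq,
    real_inner_comm y u]
  have h8 : ‖y‖ ^ 2 = (hypT y - 1) * (hypT y + 1) := by linear_combination -hsq
  rw [h8]
  field_simp
  ring

end Hersch

section FoldMap

set_option linter.unusedSectionVars false

variable {V : Type*} [NormedAddCommGroup V] [InnerProductSpace ℝ V]

/-- The displacement in the reflection across the hyperplane `⟪p, x⟫ + k = 0`. -/
def foldShift (k : ℝ) (p x : V) : ℝ := 2 / (1 - k ^ 2) * max 0 (-(⟪p, x⟫ + k))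

/-- The map folding the sphere onto the cap `0 ≤ ⟪p, x⟫ + k`. -/
def foldMap (k : ℝ) (p x : V) : V :=
  (1 - k * foldShift k p x)⁻¹ • (x + foldShift k p x • p)

lemma foldShift_one (p x : V) : foldShift 1 p x = 0 := by simp [foldShift]

lemma foldMap_one (p x : V) : foldMap 1 p x = x := by simp [foldMap, foldShift_one]

lemma foldShift_of_nonneg {k : ℝ} {p x : V} (h : 0 ≤ ⟪p, x⟫ + k) : foldShift k p x = 0 := by
  rw [foldShift, max_eq_left (by linarith), mul_zero]

lemma foldMap_of_nonneg {k : ℝ} {p x : V} (h : 0 ≤ ⟪p, x⟫ + k) : foldMap k p x = x := by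
  simp [foldMap, foldShift_of_nonneg h]

lemma foldShift_of_neg {k : ℝ} {p x : V} (h : ⟪p, x⟫ + k ≤ 0) :
    foldShift k p x = -(2 * (⟪p, x⟫ + k)) / (1 - k ^ 2) := by
  rw [foldShift, max_eq_right (by linarith)]
  ring

lemma one_sub_foldShift_pos {k : ℝ} (hk : k ∈ Icc (0 : ℝ) 1) {p x : V} (hp : ‖p‖ = 1)
    (hx : ‖x‖ = 1) : 0 < 1 - k * foldShift k p x := by
  rcases hk.2.eq_or_lt with rfl | hk1
  · simp [foldShift_one]
  rcases le_total 0 (⟪p, x⟫ + k) with h | h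
  · simp [foldShift_of_nonneg h]
  · have h2 : 0 < 1 - k ^ 2 := by nlinarith [hk.1]
    have h3 : (-1 : ℝ) ≤ ⟪p, x⟫ := by
      have := abs_real_inner_le_norm p x
      rw [hp, hx, one_mul] at this
      exact (abs_le.1 this).1
    have h4 : 1 - k * foldShift k p x = (1 + k ^ 2 + 2 * k * ⟪p, x⟫) / (1 - k ^ 2) := by
      rw [foldShift_of_neg h]
      field_simp
      ring
    rw [h4]
    refine div_pos ?_ h2
    nlinarith [hk.1, mul_le_mul_of_nonneg_left h3 hk.1, sq_pos_of_pos (sub_pos.2 hk1)]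

lemma norm_add_foldShift_sq {k : ℝ} (hk : k ∈ Icc (0 : ℝ) 1) {p x : V} (hp : ‖p‖ = 1)
    (hx : ‖x‖ = 1) :
    ‖x + foldShift k p x • p‖ ^ 2 = (1 - k * foldShift k p x) ^ 2 := by
  rcases hk.2.eq_or_lt with rfl | hk1
  · simp [foldShift_one, hx]
  rcases le_total 0 (⟪p, x⟫ + k) with h | h
  · simp [foldShift_of_nonneg h, hx]
  · have h2 : 0 < 1 - k ^ 2 := by nlinarith [hk.1]
    rw [norm_add_sq_real, inner_smul_right, norm_smul, hp, hx, mul_one, Real.norm_eq_abs, sq_abs,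
      real_inner_comm, foldShift_of_neg h]
    field_simp
    ring

lemma norm_foldMap {k : ℝ} (hk : k ∈ Icc (0 : ℝ) 1) {p x : V} (hp : ‖p‖ = 1)
    (hx : ‖x‖ = 1) : ‖foldMap k p x‖ = 1 := by
  have h1 := one_sub_foldShift_pos hk hp hx
  have h2 := norm_add_foldShift_sq hk hp hx
  rw [pow_left_inj₀ (norm_nonneg _) h1.le two_ne_zero] at h2
  rw [foldMap, norm_smul, h2, norm_inv, Real.norm_of_nonneg h1.le, inv_mul_cancel₀ h1.ne']

lemma foldMap_mem_span {k : ℝ} (hk : k ∈ Icc (0 : ℝ) 1) {p x : V} (hp : ‖p‖ = 1)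
    (hx : ‖x‖ = 1) : x ∈ Submodule.span ℝ {p, foldMap k p x} := by
  have h1 := one_sub_foldShift_pos hk hp hx
  refine Submodule.mem_span_pair.2 ⟨-foldShift k p x, 1 - k * foldShift k p x, ?_⟩
  rw [foldMap, smul_inv_smul₀ h1.ne']
  module

lemma continuous_foldMap {k : ℝ} (hk : k ∈ Icc (0 : ℝ) 1) {p : V} (hp : ‖p‖ = 1) :
    ContinuousOn (foldMap k p) (sphere 0 1) := by
  have h1 : Continuous (foldShift k p) := by unfold foldShift; fun_prop
  unfold foldMap
  refine ContinuousOn.smul (ContinuousOn.inv₀ (by fun_prop) fun x hx => ?_) (by fun_prop)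
  exact (one_sub_foldShift_pos hk hp (by simpa using hx)).ne'

lemma tendsto_foldMap {k : ℕ → ℝ} {p : ℕ → V} {k₀ : ℝ} {p₀ x : V}
    (hk₀ : k₀ ∈ Icc (0 : ℝ) 1) (hp₀ : ‖p₀‖ = 1)
    (hx : ‖x‖ = 1) (hxp : x ≠ -p₀) (hkk : Tendsto k atTop (𝓝 k₀)) (hpp : Tendsto p atTop (𝓝 p₀)) :
    Tendsto (fun j => foldMap (k j) (p j) x) atTop (𝓝 (foldMap k₀ p₀ x)) := by
  have hin : Tendsto (fun j => ⟪p j, x⟫ + k j) atTop (𝓝 (⟪p₀, x⟫ + k₀)) :=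
    (hpp.inner tendsto_const_nhds).add hkk
  rcases hk₀.2.eq_or_lt with rfl | hk1
  · have hpos : 0 < ⟪p₀, x⟫ + 1 := by
      have h3 := norm_add_sq_real p₀ x
      have h4 : 0 < ‖p₀ + x‖ ^ 2 := by
        have : p₀ + x ≠ 0 := fun h => hxp (eq_neg_of_add_eq_zero_right h)
        positivity
      rw [hx, hp₀] at h3
      nlinarith
    rw [foldMap_one]
    refine tendsto_const_nhds.congr' ?_
    filter_upwards [hin.eventually_const_lt hpos] with j hj
    rw [foldMap_of_nonneg hj.le]
  · have h2 : 1 - k₀ ^ 2 ≠ 0 := by nlinarith [hk₀.1]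
    have hs : Tendsto (fun j => foldShift (k j) (p j) x) atTop (𝓝 (foldShift k₀ p₀ x)) := by
      unfold foldShift
      refine Tendsto.mul (Tendsto.div tendsto_const_nhds (tendsto_const_nhds.sub (hkk.pow 2)) h2) ?_
      exact tendsto_const_nhds.max hin.neg
    unfold foldMap
    refine Tendsto.smul (Tendsto.inv₀ (tendsto_const_nhds.sub (hkk.mul hs)) ?_)
      (tendsto_const_nhds.add (hs.smul hpp))
    exact (one_sub_foldShift_pos hk₀ hp₀ hx).ne.symm

/-- Reflection in the hyperplane orthogonal to `p`. -/
def hypRefl (p : V) : V ≃ₗᵢ[ℝ] V := (ℝ ∙ p)ᗮ.reflection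

lemma hypRefl_apply {p : V} (hp : ‖p‖ = 1) (v : V) :
    hypRefl p v = v - (2 * ⟪p, v⟫) • p := by
  rw [hypRefl, Submodule.reflection_orthogonal_apply, Submodule.reflection_singleton_apply, hp]
  simp only [RCLike.ofReal_real_eq_id, id, one_pow, div_one]
  module

lemma foldMap_zero_neg {p : V} (hp : ‖p‖ = 1) (x : V) :
    foldMap 0 (-p) x = hypRefl p (foldMap 0 p x) := by
  have h1 : foldShift 0 p x = 2 * max 0 (-⟪p, x⟫) := by simp [foldShift]
  have h2 : foldShift 0 (-p) x = 2 * max 0 ⟪p, x⟫ := by simp [foldShift]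
  have h3 : max 0 (-⟪p, x⟫) = max 0 ⟪p, x⟫ - ⟪p, x⟫ := by
    rcases le_total 0 (⟪p, x⟫ : ℝ) with h | h
    · rw [max_eq_left (by linarith), max_eq_right h]; ring
    · rw [max_eq_right (by linarith), max_eq_left h]; ring
  rw [hypRefl_apply hp, foldMap, foldMap, h1, h2, h3]
  simp only [zero_mul, sub_zero, inv_one, one_smul, inner_add_right, inner_smul_right,
    real_inner_self_eq_norm_sq, hp]
  module

lemma hypT_map (R : V ≃ₗᵢ[ℝ] V) (y : V) : hypT (R y) = hypT y := by
  rw [hypT, hypT, LinearIsometryEquiv.norm_map]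

lemma boostT_map (R : V ≃ₗᵢ[ℝ] V) (y v : V) (a : ℝ) : boostT (R y) a (R v) = boostT y a v := by
  rw [boostT, boostT, hypT_map, LinearIsometryEquiv.inner_map_map]

lemma confBoost_map (R : V ≃ₗᵢ[ℝ] V) (y v : V) : confBoost (R y) (R v) = R (confBoost y v) := by
  simp [confBoost, boostT_map, boostS, hypT_map, LinearIsometryEquiv.inner_map_map]

lemma IsHerschMin.map {X : Type*} [MeasurableSpace X] {μ : Measure X} {f : X → V} {y : V}
    (hy : IsHerschMin μ f y) (R : V ≃ₗᵢ[ℝ] V) : IsHerschMin μ (fun x => R (f x)) (R y) := by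
  have h : ∀ z, herschFun μ (fun x => R (f x)) (R z) = herschFun μ f z := fun z => by
    simp [herschFun, boostT_map]
  intro y'
  obtain ⟨z, rfl⟩ := R.surjective y'
  rw [h, h]
  exact hy z

lemma tendsto_confBoost {y v : ℕ → V} {y₀ v₀ : V} (h : ‖v₀‖ = 1)
    (hy : Tendsto y atTop (𝓝 y₀)) (hv : Tendsto v atTop (𝓝 v₀)) :
    Tendsto (fun j => confBoost (y j) (v j)) atTop (𝓝 (confBoost y₀ v₀)) := by
  have h1 := (continuousAt_confBoost (q := (y₀, v₀)) h).tendsto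
  have h2 : Tendsto (fun j => (y j, v j)) atTop (𝓝 (y₀, v₀)) := hy.prodMk_nhds hv
  simpa only [Function.comp_def] using h1.comp h2

end FoldMap

section FoldHersch

set_option linter.unusedSectionVars false

variable {V : Type*} [NormedAddCommGroup V] [InnerProductSpace ℝ V] [FiniteDimensional ℝ V]
  [MeasurableSpace V] [BorelSpace V] {μ : Measure V} [IsFiniteMeasure μ]

lemma aestronglyMeasurable_foldMap (hμS : ∀ᵐ x ∂μ, ‖x‖ = 1) {k : ℝ} (hk : k ∈ Icc (0 : ℝ) 1)
    {p : V} (hp : ‖p‖ = 1) : AEStronglyMeasurable (foldMap k p) μ := by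
  have h1 : μ.restrict (sphere 0 1) = μ := Measure.restrict_eq_self_of_ae_mem (by simpa using hμS)
  rw [← h1]
  exact (continuous_foldMap hk hp).aestronglyMeasurable isClosed_sphere.measurableSet

lemma ae_foldMap_ne (hμS : ∀ᵐ x ∂μ, ‖x‖ = 1)
    (hμW : ∀ p e : V, μ (Submodule.span ℝ {p, e} : Set V) = 0) {k : ℝ} (hk : k ∈ Icc (0 : ℝ) 1)
    {p : V} (hp : ‖p‖ = 1) (e : V) : ∀ᵐ x ∂μ, foldMap k p x ≠ e := by
  have h1 : ∀ᵐ x ∂μ, x ∉ (Submodule.span ℝ {p, e} : Set V) := by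
    rw [ae_iff]; simpa using hμW p e
  filter_upwards [hμS, h1] with x hx hxs h
  exact hxs (h ▸ foldMap_mem_span hk hp hx)

lemma ae_norm_foldMap (hμS : ∀ᵐ x ∂μ, ‖x‖ = 1) {k : ℝ} (hk : k ∈ Icc (0 : ℝ) 1)
    {p : V} (hp : ‖p‖ = 1) : ∀ᵐ x ∂μ, ‖foldMap k p x‖ = 1 := by
  filter_upwards [hμS] with x hx using norm_foldMap hk hp hx

lemma ae_tendsto_foldMap (hμS : ∀ᵐ x ∂μ, ‖x‖ = 1)
    (hμW : ∀ p e : V, μ (Submodule.span ℝ {p, e} : Set V) = 0)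
    {k : ℕ → ℝ} {p : ℕ → V} {k₀ : ℝ} {p₀ : V}
    (hk₀ : k₀ ∈ Icc (0 : ℝ) 1) (hp₀ : ‖p₀‖ = 1)
    (hkk : Tendsto k atTop (𝓝 k₀)) (hpp : Tendsto p atTop (𝓝 p₀)) :
    ∀ᵐ x ∂μ, Tendsto (fun j => foldMap (k j) (p j) x) atTop (𝓝 (foldMap k₀ p₀ x)) := by
  have h1 : ∀ᵐ x ∂μ, x ∉ (Submodule.span ℝ {p₀, p₀} : Set V) := by
    rw [ae_iff]; simpa using hμW p₀ p₀
  filter_upwards [hμS, h1] with x hx hxs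
  refine tendsto_foldMap hk₀ hp₀ hx (fun h => hxs ?_) hkk hpp
  rw [h]
  exact Submodule.neg_mem _ (Submodule.subset_span (by simp))

/-- Continuity of the renormalized folded maps with respect to all parameters. -/
lemma tendsto_isHerschMin_foldMap (hμ : μ ≠ 0) (hμS : ∀ᵐ x ∂μ, ‖x‖ = 1)
    (hμW : ∀ p e : V, μ (Submodule.span ℝ {p, e} : Set V) = 0)
    {k : ℕ → ℝ} {p : ℕ → V} {k₀ : ℝ} {p₀ : V}
    (hk : ∀ j, k j ∈ Icc (0 : ℝ) 1) (hp : ∀ j, ‖p j‖ = 1)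
    (hk₀ : k₀ ∈ Icc (0 : ℝ) 1) (hp₀ : ‖p₀‖ = 1)
    (hkk : Tendsto k atTop (𝓝 k₀)) (hpp : Tendsto p atTop (𝓝 p₀))
    {y : ℕ → V} {y₀ : V} (hy : ∀ j, IsHerschMin μ (foldMap (k j) (p j)) (y j))
    (hy₀ : IsHerschMin μ (foldMap k₀ p₀) y₀) :
    ∀ᵐ x ∂μ, Tendsto (fun j => confBoost (y j) (foldMap (k j) (p j) x)) atTop
      (𝓝 (confBoost y₀ (foldMap k₀ p₀ x))) := by
  have hf := ae_tendsto_foldMap hμS hμW hk₀ hp₀ hkk hpp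
  have hyy : Tendsto y atTop (𝓝 y₀) := tendsto_isHerschMin
    (f := fun j => foldMap (k j) (p j)) (f₀ := foldMap k₀ p₀) hμ
    (fun j => aestronglyMeasurable_foldMap hμS (hk j) (hp j))
    (aestronglyMeasurable_foldMap hμS hk₀ hp₀)
    (fun j => ae_norm_foldMap hμS (hk j) (hp j)) (ae_norm_foldMap hμS hk₀ hp₀) hf
    (ae_foldMap_ne hμS hμW hk₀ hp₀) hy hy₀
  filter_upwards [hf, ae_norm_foldMap hμS hk₀ hp₀] with x hx hx1
  exact tendsto_confBoost hx1 hyy hx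

end FoldHersch

section FoldZero

set_option linter.unusedSectionVars false

variable {ι : Type*} [Fintype ι] [Nonempty ι] {μ : Measure (EuclideanSpace ℝ ι)}
  [IsFiniteMeasure μ]

/-- For every weight there is a renormalized folded map orthogonal to it. -/
theorem exists_foldMap_integral_eq_zero (hμ : μ ≠ 0) (hμS : ∀ᵐ x ∂μ, ‖x‖ = 1)
    (hμW : ∀ p e : EuclideanSpace ℝ ι,
      μ (Submodule.span ℝ {p, e} : Set (EuclideanSpace ℝ ι)) = 0)
    {φ : EuclideanSpace ℝ ι → ℝ} (hφ : Integrable φ μ) :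
    ∃ k ∈ Icc (0 : ℝ) 1, ∃ p : EuclideanSpace ℝ ι, ‖p‖ = 1 ∧ ∃ y,
      IsHerschMin μ (foldMap k p) y ∧ ∫ x, φ x • confBoost y (foldMap k p x) ∂μ = 0 := by
  set Y : (EuclideanSpace ℝ ι → EuclideanSpace ℝ ι) → EuclideanSpace ℝ ι := fun f =>
    if h : ∃ y, IsHerschMin μ f y then h.choose else 0 with hYdef
  have hY : ∀ k ∈ Icc (0 : ℝ) 1, ∀ p : EuclideanSpace ℝ ι, ‖p‖ = 1 →
      IsHerschMin μ (foldMap k p) (Y (foldMap k p)) := by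
    intro k hk p hp
    have h := exists_isHerschMin hμ (aestronglyMeasurable_foldMap hμS hk hp)
      (ae_norm_foldMap hμS hk hp) (ae_foldMap_ne hμS hμW hk hp)
    rw [hYdef]
    simp only [dif_pos h]
    exact h.choose_spec
  set H : ℝ → EuclideanSpace ℝ ι → EuclideanSpace ℝ ι := fun k p =>
    ∫ x, φ x • confBoost (Y (foldMap k p)) (foldMap k p x) ∂μ with hH
  have hmeas : ∀ k ∈ Icc (0 : ℝ) 1, ∀ p : EuclideanSpace ℝ ι, ‖p‖ = 1 → ∀ y,
      AEStronglyMeasurable (fun x => confBoost y (foldMap k p x)) μ := fun k hk p hp y =>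
    aestronglyMeasurable_confBoost (aestronglyMeasurable_foldMap hμS hk hp) y
  have hcont : ContinuousOn (fun q : ℝ × EuclideanSpace ℝ ι => H q.1 q.2)
      (Icc 0 1 ×ˢ sphere 0 1) := by
    rw [continuousOn_iff_continuous_domRestrict, continuous_iff_seqContinuous]
    intro q q₀ hq
    have hk : ∀ j, (q j).1.1 ∈ Icc (0 : ℝ) 1 := fun j => (q j).2.1
    have hp : ∀ j, ‖(q j).1.2‖ = 1 := fun j => by simpa using (q j).2.2
    have hk₀ : q₀.1.1 ∈ Icc (0 : ℝ) 1 := q₀.2.1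
    have hp₀ : ‖q₀.1.2‖ = 1 := by simpa using q₀.2.2
    have hq1 : Tendsto (fun j => (q j).1.1) atTop (𝓝 q₀.1.1) :=
      ((continuous_fst.comp continuous_subtype_val).tendsto q₀).comp hq
    have hq2 : Tendsto (fun j => (q j).1.2) atTop (𝓝 q₀.1.2) :=
      ((continuous_snd.comp continuous_subtype_val).tendsto q₀).comp hq
    have hlim := tendsto_isHerschMin_foldMap hμ hμS hμW hk hp hk₀ hp₀ hq1 hq2
      (fun j => hY _ (hk j) _ (hp j)) (hY _ hk₀ _ hp₀)
    refine tendsto_integral_of_dominated_convergence (fun x => ‖φ x‖)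
      (fun j => hφ.aestronglyMeasurable.smul (hmeas _ (hk j) _ (hp j) _)) hφ.norm (fun j => ?_) ?_
    · filter_upwards [ae_norm_foldMap hμS (hk j) (hp j)] with x hx
      rw [norm_smul, norm_confBoost _ hx, mul_one]
    · filter_upwards [hlim] with x hx
      exact hx.const_smul (φ x)
  have h0 : ∀ p ∈ sphere (0 : EuclideanSpace ℝ ι) 1,
      H 0 (-p) = H 0 p - (2 * ⟪p, H 0 p⟫) • p := by
    intro p hp
    have hp1 : ‖p‖ = 1 := by simpa using hp
    have hz : (0 : ℝ) ∈ Icc (0 : ℝ) 1 := by simp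
    have hfun : foldMap 0 (-p) = fun x => hypRefl p (foldMap 0 p x) :=
      funext (foldMap_zero_neg hp1)
    have hy : Y (foldMap 0 (-p)) = hypRefl p (Y (foldMap 0 p)) := by
      have h2 := (hY 0 hz p hp1).map (hypRefl p)
      rw [← hfun] at h2
      exact (hY 0 hz (-p) (by simpa using hp1)).eq hμ
        (aestronglyMeasurable_foldMap hμS hz (by simpa using hp1))
        (ae_norm_foldMap hμS hz (by simpa using hp1))
        (ae_foldMap_ne hμS hμW hz (by simpa using hp1)) h2
    rw [← hypRefl_apply hp1, hH]
    simp only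
    have h3 := (hypRefl p).toContinuousLinearEquiv.integral_comp_comm (μ := μ)
      fun x => φ x • confBoost (Y (foldMap 0 p)) (foldMap 0 p x)
    refine Eq.trans ?_ h3
    rw [hy]
    refine integral_congr_ae (Eventually.of_forall fun x => ?_)
    simp only
    rw [foldMap_zero_neg hp1, confBoost_map]
    exact (map_smul (hypRefl p) _ _).symm
  have h1 : ∀ p ∈ sphere (0 : EuclideanSpace ℝ ι) 1,
      H 1 p = ∫ x, φ x • confBoost (Y fun x => x) x ∂μ := by
    intro p _
    have : foldMap 1 p = fun x => x := funext (foldMap_one p)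
    rw [hH]
    simp only [this]
  obtain ⟨k, hk, p, hp, hz⟩ := exists_zero_of_reflection_symmetric hcont h1 h0
  have hp1 : ‖p‖ = 1 := by simpa using hp
  exact ⟨k, hk, p, hp1, _, hY k hk p hp1, hz⟩

end FoldZero

section PoissonVolume

set_option linter.unusedSectionVars false

variable {V : Type*} [NormedAddCommGroup V] [InnerProductSpace ℝ V]

lemma norm_boostS_norm (y v : V) (h : 0 ≤ boostT y ‖v‖ v) :
    ‖boostS y ‖v‖ v‖ = boostT y ‖v‖ v := by
  have h2 := norm_boostS_sq y ‖v‖ v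
  rw [sub_add_cancel] at h2
  rwa [pow_left_inj₀ (norm_nonneg _) h two_ne_zero] at h2

lemma boostT_norm_pos (y : V) {v : V} (hv : v ≠ 0) : 0 < boostT y ‖v‖ v := by
  have h1 := abs_real_inner_le_norm y v
  have h2 := norm_lt_hypT y
  have h3 : 0 < ‖v‖ := norm_pos_iff.2 hv
  rw [boostT]
  nlinarith [(abs_le.1 h1).1]

lemma boostT_norm_eq (y : V) {v : V} (hv : v ≠ 0) :
    boostT y ‖v‖ v = ‖v‖ * boostT y 1 (‖v‖⁻¹ • v) := by
  have h3 : ‖v‖ ≠ 0 := norm_ne_zero_iff.2 hv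
  rw [boostT, boostT, inner_smul_right]
  field_simp

lemma hypT_neg (y : V) : hypT (-y) = hypT y := by rw [hypT, hypT, norm_neg]

lemma boostS_neg_boostS (y v : V) (a : ℝ) :
    boostS (-y) (boostT y a v) (boostS y a v) = v := by
  have h1 := hypT_sq y
  have hp := hypT_pos y
  have hp1 : 1 + hypT y ≠ 0 := by positivity
  have h2 : ‖y‖ ^ 2 = (hypT y - 1) * (hypT y + 1) := by linear_combination -h1
  have h3 : boostT y a v + ⟪-y, boostS y a v⟫ / (1 + hypT y) = a + ⟪y, v⟫ / (1 + hypT y) := by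
    rw [boostT, boostS, inner_neg_left, inner_add_right, inner_smul_right,
      real_inner_self_eq_norm_sq, h2]
    field_simp
    ring
  rw [boostS, hypT_neg, h3, boostS]
  module

/-- The action of a boost on the light cone, parametrized by its spatial part. -/
def coneBoost (y v : V) : V := boostS y ‖v‖ v

lemma norm_coneBoost (y : V) {v : V} (hv : v ≠ 0) : ‖coneBoost y v‖ = boostT y ‖v‖ v :=
  norm_boostS_norm y v (boostT_norm_pos y hv).le

lemma coneBoost_ne_zero (y : V) {v : V} (hv : v ≠ 0) : coneBoost y v ≠ 0 := by
  rw [← norm_pos_iff, norm_coneBoost y hv]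
  exact boostT_norm_pos y hv

lemma coneBoost_neg_coneBoost (y : V) {v : V} (hv : v ≠ 0) :
    coneBoost (-y) (coneBoost y v) = v := by
  rw [coneBoost, norm_coneBoost y hv, coneBoost, boostS_neg_boostS]

/-- The domain mapped onto the punctured unit ball by `coneBoost y`. -/
def coneBall (y : V) : Set V := {v | v ≠ 0 ∧ boostT y ‖v‖ v < 1}

lemma image_coneBoost (y : V) : coneBoost y '' coneBall y = ball 0 1 \ {0} := by
  ext v
  constructor
  · rintro ⟨w, ⟨hw, hw1⟩, rfl⟩
    exact ⟨by simpa [norm_coneBoost y hw] using hw1, coneBoost_ne_zero y hw⟩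
  · rintro ⟨hv, hv0⟩
    have hv0' : v ≠ 0 := hv0
    have h := coneBoost_neg_coneBoost (-y) hv0'
    rw [neg_neg] at h
    refine ⟨coneBoost (-y) v, ⟨coneBoost_ne_zero _ hv0', ?_⟩, h⟩
    rw [← norm_coneBoost y (coneBoost_ne_zero _ hv0'), h]
    simpa using hv

lemma injOn_coneBoost (y : V) : InjOn (coneBoost y) (coneBall y) :=
  LeftInvOn.injOn (f₁' := coneBoost (-y)) fun _ hv => coneBoost_neg_coneBoost y hv.1

/-- The derivative of `coneBoost`. -/
def coneBoostDeriv (y v : V) : V →L[ℝ] V :=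
  ContinuousLinearMap.id ℝ V +
    (innerSL ℝ (‖v‖⁻¹ • v + (1 + hypT y)⁻¹ • y)).smulRight y

lemma hasFDerivAt_norm' {v : V} (hv : v ≠ 0) :
    HasFDerivAt (fun v : V => ‖v‖) (innerSL ℝ (‖v‖⁻¹ • v)) v := by
  have h1 := (hasStrictFDerivAt_norm_sq v).hasFDerivAt.sqrt (by positivity)
  have h2 : (fun v : V => √(‖v‖ ^ 2)) = fun v => ‖v‖ := by
    ext v; exact Real.sqrt_sq (norm_nonneg v)
  rw [h2] at h1
  refine h1.congr_fderiv ?_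
  ext u
  have h3 : ‖v‖ ≠ 0 := norm_ne_zero_iff.2 hv
  simp only [Real.sqrt_sq (norm_nonneg v), smul_apply, innerSL_apply_apply,
    inner_smul_left, conj_trivial, smul_eq_mul, nsmul_eq_mul, Nat.cast_ofNat]
  field_simp

lemma hasFDerivAt_coneBoost (y : V) {v : V} (hv : v ≠ 0) :
    HasFDerivAt (coneBoost y) (coneBoostDeriv y v) v := by
  unfold coneBoost boostS
  have h1 : HasFDerivAt (fun v : V => (⟪y, v⟫ : ℝ)) (innerSL ℝ y) v :=
    (innerSL ℝ y).hasFDerivAt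
  have h2 := (hasFDerivAt_id v).add
    (((hasFDerivAt_norm' hv).add (h1.mul_const (1 + hypT y)⁻¹)).smul_const y)
  simp only [div_eq_mul_inv]
  refine HasFDerivAt.congr_fderiv h2 ?_
  ext u
  simp [coneBoostDeriv]

variable [FiniteDimensional ℝ V]

lemma det_coneBoostDeriv (y : V) {v : V} (hv : v ≠ 0) :
    (coneBoostDeriv y v).det = boostT y 1 (‖v‖⁻¹ • v) := by
  have h0 : (coneBoostDeriv y v : V →ₗ[ℝ] V) = LinearMap.transvection
      ((innerSL ℝ (‖v‖⁻¹ • v + (1 + hypT y)⁻¹ • y) : V →L[ℝ] ℝ) : V →ₗ[ℝ] ℝ) y := by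
    ext u
    simp [coneBoostDeriv, LinearMap.transvection.apply]
  have h1 := hypT_sq y
  have hp := hypT_pos y
  have hp1 : 1 + hypT y ≠ 0 := by positivity
  have h2 : ‖y‖ ^ 2 = (hypT y - 1) * (hypT y + 1) := by linear_combination -h1
  rw [ContinuousLinearMap.det, h0, LinearMap.transvection.det]
  simp only [ContinuousLinearMap.coe_coe, innerSL_apply_apply, inner_add_left, inner_smul_left,
    conj_trivial, real_inner_self_eq_norm_sq, h2, boostT, inner_smul_right]
  rw [real_inner_comm]
  field_simp
  ring

variable [MeasurableSpace V] [BorelSpace V]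

lemma measurableSet_coneBall (y : V) : MeasurableSet (coneBall y) := by
  unfold coneBall boostT
  refine MeasurableSet.inter (measurableSet_singleton 0).compl ?_
  have h : Continuous fun v : V => hypT y * ‖v‖ + ⟪y, v⟫ := by fun_prop
  exact (isOpen_lt h continuous_const).measurableSet

lemma lintegral_coneBall (y : V) :
    ∫⁻ v in coneBall y, ENNReal.ofReal (boostT y 1 (‖v‖⁻¹ • v)) ∂volume =
      volume (ball (0 : V) 1 \ {0}) := by
  have h := lintegral_image_eq_lintegral_abs_det_fderiv_mul (volume : Measure V)
    (measurableSet_coneBall y)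
    (fun v hv => (hasFDerivAt_coneBoost y hv.1).hasFDerivWithinAt) (injOn_coneBoost y) 1
  rw [image_coneBoost] at h
  simp only [Pi.one_apply, lintegral_one, Measure.restrict_apply_univ, mul_one] at h
  rw [h]
  refine setLIntegral_congr_fun (measurableSet_coneBall y) fun v hv => ?_
  rw [det_coneBoostDeriv y hv.1, abs_of_pos]
  refine boostT_one_pos y ?_
  rw [norm_smul, norm_inv, norm_norm, inv_mul_cancel₀ (norm_ne_zero_iff.2 hv.1)]

lemma lintegral_coneBall_eq_sphere (y : V) {n : ℕ} (hn : Module.finrank ℝ V = n + 1) :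
    ∫⁻ v in coneBall y, ENNReal.ofReal (boostT y 1 (‖v‖⁻¹ • v)) ∂volume =
      ∫⁻ θ, ENNReal.ofReal ((boostT y 1 (θ : V))⁻¹ ^ n / (n + 1))
        ∂(volume : Measure V).toSphere := by
  set F : V → ℝ≥0∞ := (coneBall y).indicator
    fun v => ENNReal.ofReal (boostT y 1 (‖v‖⁻¹ • v)) with hF
  have hτ : Continuous fun v : V => boostT y 1 v := by unfold boostT; fun_prop
  have hFm : Measurable F := by
    refine Measurable.indicator ?_ (measurableSet_coneBall y)
    exact ENNReal.measurable_ofReal.comp (hτ.measurable.comp (by fun_prop))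
  have hsub : ∫⁻ v in ({0}ᶜ : Set V), F v ∂volume = ∫⁻ v, F v ∂volume := by
    have : ({0}ᶜ : Set V) =ᵐ[volume] univ := by
      have : Nontrivial V := Module.nontrivial_of_finrank_pos (R := ℝ) (by omega)
      rw [ae_eq_univ]; simp
    rw [Measure.restrict_congr_set this, Measure.restrict_univ]
  rw [← lintegral_indicator (measurableSet_coneBall y), ← hF, ← hsub,
    ← lintegral_subtype_comap (measurableSet_singleton (0 : V)).compl]
  have hmp := (volume : Measure V).measurePreserving_homeomorphUnitSphereProd
  have h1 : ∫⁻ v : ({0}ᶜ : Set V), F v ∂(volume : Measure V).comap (↑) =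
      ∫⁻ q : sphere (0 : V) 1 × Ioi (0 : ℝ), F ((homeomorphUnitSphereProd V).symm q)
        ∂((volume : Measure V).toSphere.prod
          (Measure.volumeIoiPow (Module.finrank ℝ V - 1))) := by
    rw [← hmp.lintegral_comp_emb (Homeomorph.measurableEmbedding _)]
    simp
  have hpos : ∀ θ : sphere (0 : V) 1, 0 < boostT y 1 (θ : V) := fun θ =>
    boostT_one_pos y (by simp)
  rw [h1, lintegral_prod _ (by
    refine Measurable.aemeasurable (hFm.comp ?_)
    exact (continuous_subtype_val.comp (Homeomorph.continuous _)).measurable)]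
  refine lintegral_congr fun θ => ?_
  have h2 : ∀ r : Ioi (0 : ℝ), F ((homeomorphUnitSphereProd V).symm (θ, r)) =
      (Iio (⟨(boostT y 1 (θ : V))⁻¹, inv_pos.2 (hpos θ)⟩ : Ioi (0 : ℝ))).indicator
        (fun _ => ENNReal.ofReal (boostT y 1 (θ : V))) r := by
    intro r
    have hr : (0 : ℝ) < r := r.2
    have hnorm : ‖(r : ℝ) • (θ : V)‖ = r := by simp [norm_smul, abs_of_pos hr]
    have hne : (r : ℝ) • (θ : V) ≠ 0 := by rw [← norm_pos_iff, hnorm]; exact hr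
    have h3 : ‖(r : ℝ) • (θ : V)‖⁻¹ • (r : ℝ) • (θ : V) = θ := by
      rw [hnorm, inv_smul_smul₀ hr.ne']
    have hmem : (r : ℝ) • (θ : V) ∈ coneBall y ↔
        r ∈ Iio (⟨(boostT y 1 (θ : V))⁻¹, inv_pos.2 (hpos θ)⟩ : Ioi (0 : ℝ)) := by
      rw [coneBall, mem_ofPred_eq, boostT_norm_eq y hne, h3, hnorm, mem_Iio, ← Subtype.coe_lt_coe,
        lt_inv_comm₀ hr (hpos θ), ← one_div, lt_div_iff₀' hr]
      exact and_iff_right hne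
    rw [homeomorphUnitSphereProd_symm_apply_coe, hF]
    simp only [indicator_apply, hmem, h3]
  simp only [h2]
  rw [lintegral_indicator measurableSet_Iio, setLIntegral_const,
    Measure.volumeIoiPow_apply_Iio, ← ENNReal.ofReal_mul (hpos θ).le, hn, Nat.add_sub_cancel]
  congr 1
  have := (hpos θ).ne'
  rw [pow_succ]
  field_simp

/-- The conformal volume element of a conformal transformation of the sphere integrates to
the volume of the sphere. -/
lemma lintegral_inv_boostT_pow (y : V) {n : ℕ} (hn : Module.finrank ℝ V = n + 1) :
    ∫⁻ θ, ENNReal.ofReal ((boostT y 1 (θ : V))⁻¹ ^ n) ∂(volume : Measure V).toSphere =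
      (volume : Measure V).toSphere univ := by
  have h1 := (lintegral_coneBall_eq_sphere y hn).symm.trans (lintegral_coneBall y)
  rw [Measure.toSphere_apply_univ', ← h1, hn, ← lintegral_const_mul' _ _ (by simp)]
  refine lintegral_congr fun θ => ?_
  have h2 : ((n + 1 : ℕ) : ℝ≥0∞) = ENNReal.ofReal (n + 1) := by
    rw [← Nat.cast_add_one, ENNReal.ofReal_natCast]
  rw [h2, ← ENNReal.ofReal_mul (by positivity)]
  congr 1
  field_simp

end PoissonVolume

section SphereMeasure

lemma sphMeasure_apply (n : ℕ) (s : Set (Eu n)) :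
    sphMeasure n s = (volume : Measure (Eu n)).toSphere (Subtype.val ⁻¹' s) := by
  rw [sphMeasure, (MeasurableEmbedding.subtype_coe isClosed_sphere.measurableSet).map_apply]

instance (n : ℕ) : IsFiniteMeasure (sphMeasure n) := by
  unfold sphMeasure; infer_instance

lemma ae_sphMeasure_norm (n : ℕ) : ∀ᵐ x ∂sphMeasure n, ‖x‖ = 1 := by
  rw [ae_iff, sphMeasure_apply]
  convert measure_empty (μ := (volume : Measure (Eu n)).toSphere)
  ext x
  simp

lemma ae_sphMeasure_mem (n : ℕ) : ∀ᵐ x ∂sphMeasure n, x ∈ sphere (0 : Eu n) 1 := by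
  simpa using ae_sphMeasure_norm n

lemma sphMeasure_restrict (n : ℕ) : (sphMeasure n).restrict (sphere 0 1) = sphMeasure n :=
  Measure.restrict_eq_self_of_ae_mem (ae_sphMeasure_mem n)

lemma sigmaVol_pos (n : ℕ) : 0 < sigmaVol n := by
  refine ENNReal.toReal_pos ?_ (measure_ne_top _ _)
  rw [sphMeasure_apply, preimage_univ, Measure.measure_univ_ne_zero]
  exact Measure.toSphere_ne_zero _

lemma integrable_sphMeasure_of_continuousOn {n : ℕ} {F : Type*} [NormedAddCommGroup F]
    {f : Eu n → F} (hf : ContinuousOn f (sphere 0 1)) : Integrable f (sphMeasure n) := by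
  have h := hf.integrableOn_compact (μ := sphMeasure n) (isCompact_sphere 0 1)
  rwa [IntegrableOn, sphMeasure_restrict] at h

lemma sphMeasure_open_inter_pos {n : ℕ} {U : Set (Eu n)} (hU : IsOpen U)
    (hne : (U ∩ sphere 0 1).Nonempty) : 0 < sphMeasure n U := by
  rw [sphMeasure_apply]
  obtain ⟨x, hxU, hxS⟩ := hne
  exact (hU.preimage continuous_subtype_val).measure_pos _ ⟨⟨x, hxS⟩, hxU⟩

lemma sphMeasure_null_of_cone {n : ℕ} {s C : Set (Eu n)} (hC : (volume : Measure (Eu n)) C = 0)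
    (hs : MeasurableSet s) (h : ∀ x ∈ s, ‖x‖ = 1 → ∀ r : ℝ, 0 < r → r • x ∈ C) :
    sphMeasure n s = 0 := by
  rw [sphMeasure_apply, Measure.toSphere_apply' _ (measurable_subtype_coe hs)]
  refine mul_eq_zero_of_right _ (measure_mono_null ?_ hC)
  rintro _ ⟨r, hr, _, ⟨x, hx, rfl⟩, rfl⟩
  exact h x hx (by simp) r hr.1

lemma sphMeasure_submodule {n : ℕ} (W : Submodule ℝ (Eu n)) (hW : W ≠ ⊤) :
    sphMeasure n (W : Set (Eu n)) = 0 :=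
  sphMeasure_null_of_cone (Measure.addHaar_submodule _ W hW)
    W.closed_of_finiteDimensional.measurableSet fun _ hx _ r _ => W.smul_mem r hx

lemma sphMeasure_span_pair {n : ℕ} (hn : 2 ≤ n) (p e : Eu n) :
    sphMeasure n (Submodule.span ℝ {p, e} : Set (Eu n)) = 0 := by
  refine sphMeasure_submodule _ fun h => ?_
  have h1 := finrank_span_le_card (R := ℝ) ({p, e} : Set (Eu n))
  rw [h, finrank_top, finrank_euclideanSpace_fin] at h1
  have h2 : ({p, e} : Set (Eu n)).toFinset.card ≤ 2 := by
    rw [Set.toFinset_insert, Set.toFinset_singleton]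
    exact Finset.card_le_two
  omega

lemma sphMeasure_slice {n : ℕ} (hn : 2 ≤ n) {k : ℝ} (hk : k ∈ Icc (0 : ℝ) 1) {p : Eu n}
    (hp : ‖p‖ = 1) : sphMeasure n {x | ⟪p, x⟫ + k = 0} = 0 := by
  rcases hk.2.eq_or_lt with rfl | hk1
  · have h1 : sphMeasure n ({x | ⟪p, x⟫ + 1 = 0} \ {x | ‖x‖ = 1}) = 0 :=
      measure_mono_null (fun x hx => hx.2) (ae_iff.1 (ae_sphMeasure_norm n))
    have h2 : ({x | ⟪p, x⟫ + 1 = 0} : Set (Eu n)) ⊆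
        ({x | ⟪p, x⟫ + 1 = 0} \ {x | ‖x‖ = 1}) ∪ (Submodule.span ℝ {p, p} : Set (Eu n)) := by
      intro x hx
      by_cases hx1 : ‖x‖ = 1
      · right
        have h3 := norm_add_sq_real p x
        have h4 : ⟪p, x⟫ + 1 = 0 := hx
        rw [hp, hx1, eq_neg_of_add_eq_zero_left h4] at h3
        have h5 : p + x = 0 := by
          rw [← norm_eq_zero, ← sq_eq_zero_iff, h3]; norm_num
        rw [eq_neg_of_add_eq_zero_right h5]
        exact Submodule.neg_mem _ (Submodule.subset_span (by simp))
      · exact Or.inl ⟨hx, hx1⟩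
    exact measure_mono_null h2 (measure_union_null h1 (sphMeasure_span_pair hn p p))
  · have hconv : Convex ℝ {z : Eu n | ⟪p, z⟫ + k * ‖z‖ ≤ 0} := by
      have h1 : ConvexOn ℝ univ fun z : Eu n => ⟪p, z⟫ + k * ‖z‖ := by
        refine ConvexOn.add ?_ ?_
        · exact ((innerSL ℝ p : Eu n →L[ℝ] ℝ) : Eu n →ₗ[ℝ] ℝ).convexOn convex_univ
        · exact (convexOn_norm convex_univ).smul hk.1
      simpa using h1.convex_le 0
    have hnull := hconv.addHaar_frontier (volume : Measure (Eu n))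
    refine sphMeasure_null_of_cone hnull ?_ ?_
    · have : Continuous fun x : Eu n => (⟪p, x⟫ : ℝ) + k := by fun_prop
      exact (isClosed_singleton (x := (0 : ℝ)).preimage this).measurableSet
    · intro x hx hx1 r hr
      have hx' : ⟪p, x⟫ + k = 0 := hx
      have hrx : ‖r • x‖ = r := by rw [norm_smul, hx1, mul_one, Real.norm_of_nonneg hr.le]
      refine ⟨subset_closure ?_, fun h_int => ?_⟩
      · rw [mem_ofPred_eq, inner_smul_right, hrx]
        nlinarith
      · have hcont : Tendsto (fun ε : ℝ => r • x + ε • p) (𝓝 0) (𝓝 (r • x)) := by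
          have : Continuous fun ε : ℝ => r • x + ε • p := by fun_prop
          simpa using this.tendsto 0
        have hev := hcont.eventually (isOpen_interior.mem_nhds h_int)
        obtain ⟨ε, hε, hεpos⟩ :=
          ((hev.filter_mono nhdsWithin_le_nhds).and (self_mem_nhdsWithin (s := Ioi (0 : ℝ)))).exists
        have h3' : r • x + ε • p ∈ {z : Eu n | ⟪p, z⟫ + k * ‖z‖ ≤ 0} := interior_subset hε
        have h3 : ⟪p, r • x + ε • p⟫ + k * ‖r • x + ε • p‖ ≤ 0 := h3'
        have h4 := real_inner_le_norm x (r • x + ε • p)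
        have hεpos' : (0 : ℝ) < ε := hεpos
        rw [hx1, one_mul, inner_add_right, inner_smul_right, inner_smul_right,
          real_inner_self_eq_norm_sq, hx1, real_inner_comm] at h4
        rw [inner_add_right, inner_smul_right, inner_smul_right,
          real_inner_self_eq_norm_sq, hp] at h3
        have h5 := mul_le_mul_of_nonneg_left h4 hk.1
        have h6 : (⟪p, x⟫ : ℝ) = -k := by linarith
        rw [h6] at h3 h5
        have h7 : 0 < ε * (1 - k ^ 2) := mul_pos hεpos' (by nlinarith [hk.1])
        nlinarith

lemma continuousOn_inv_boostT_pow {n : ℕ} (y : Eu n) (m : ℕ) :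
    ContinuousOn (fun x : Eu n => (boostT y 1 x)⁻¹ ^ m) (sphere 0 1) := by
  have h : Continuous fun x : Eu n => boostT y 1 x := by unfold boostT; fun_prop
  exact (h.continuousOn.inv₀ fun x hx => (boostT_one_pos y (by simpa using hx)).ne').pow m

lemma integral_inv_boostT_pow (n : ℕ) (y : Eu n) :
    ∫ x, (boostT y 1 x)⁻¹ ^ n ∂sphMeasure n = sigmaVol n := by
  rw [integral_eq_lintegral_of_nonneg_ae]
  · rw [sphMeasure, (MeasurableEmbedding.subtype_coe
      isClosed_sphere.measurableSet).lintegral_map, lintegral_inv_boostT_pow y (by simp),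
      sigmaVol, sphMeasure_apply, preimage_univ]
  · filter_upwards [ae_sphMeasure_norm n] with x hx
    exact pow_nonneg (inv_nonneg.2 (boostT_one_pos y hx).le) n
  · exact (integrable_sphMeasure_of_continuousOn
      (continuousOn_inv_boostT_pow y n)).aestronglyMeasurable

end SphereMeasure

section FoldTime

variable {V : Type*} [NormedAddCommGroup V] [InnerProductSpace ℝ V]

/-- The inverse conformal factor of `confBoost y ∘ foldMap k p`. -/
def foldTime (k : ℝ) (p y x : V) : ℝ :=
  boostT y (1 - k * foldShift k p x) (x + foldShift k p x • p)

/-- The numerator of `confBoost y ∘ foldMap k p`. -/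
def foldSpace (k : ℝ) (p y x : V) : V :=
  boostS y (1 - k * foldShift k p x) (x + foldShift k p x • p)

lemma boostT_smul (y : V) (c a : ℝ) (v : V) : boostT y (c * a) (c • v) = c * boostT y a v := by
  rw [boostT, boostT, inner_smul_right]; ring

lemma boostS_smul (y : V) (c a : ℝ) (v : V) : boostS y (c * a) (c • v) = c • boostS y a v := by
  rw [boostS, boostS, inner_smul_right, smul_add, smul_smul]
  congr 2
  ring

lemma foldTime_eq {k : ℝ} (hk : k ∈ Icc (0 : ℝ) 1) {p x : V} (hp : ‖p‖ = 1) (hx : ‖x‖ = 1)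
    (y : V) : foldTime k p y x = (1 - k * foldShift k p x) * boostT y 1 (foldMap k p x) := by
  have h1 := one_sub_foldShift_pos hk hp hx
  rw [← boostT_smul, mul_one, foldMap, smul_inv_smul₀ h1.ne', foldTime]

lemma foldSpace_eq {k : ℝ} (hk : k ∈ Icc (0 : ℝ) 1) {p x : V} (hp : ‖p‖ = 1) (hx : ‖x‖ = 1)
    (y : V) : foldSpace k p y x = (1 - k * foldShift k p x) • boostS y 1 (foldMap k p x) := by
  have h1 := one_sub_foldShift_pos hk hp hx
  rw [← boostS_smul, mul_one, foldMap, smul_inv_smul₀ h1.ne', foldSpace]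

lemma foldTime_pos {k : ℝ} (hk : k ∈ Icc (0 : ℝ) 1) {p x : V} (hp : ‖p‖ = 1) (hx : ‖x‖ = 1)
    (y : V) : 0 < foldTime k p y x := by
  rw [foldTime_eq hk hp hx]
  exact mul_pos (one_sub_foldShift_pos hk hp hx) (boostT_one_pos y (norm_foldMap hk hp hx))

lemma inv_foldTime_smul_foldSpace {k : ℝ} (hk : k ∈ Icc (0 : ℝ) 1) {p x : V} (hp : ‖p‖ = 1)
    (hx : ‖x‖ = 1) (y : V) :
    (foldTime k p y x)⁻¹ • foldSpace k p y x = confBoost y (foldMap k p x) := by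
  have h1 := one_sub_foldShift_pos hk hp hx
  rw [foldTime_eq hk hp hx, foldSpace_eq hk hp hx, confBoost, smul_smul, mul_inv_rev, mul_assoc,
    inv_mul_cancel₀ h1.ne', mul_one]

lemma continuous_foldTime (k : ℝ) (p y : V) : Continuous (foldTime k p y) := by
  have h1 : Continuous (foldShift k p) := by unfold foldShift; fun_prop
  unfold foldTime boostT
  fun_prop

lemma foldTime_of_nonneg {k : ℝ} {p x : V} (h : 0 ≤ ⟪p, x⟫ + k) (y : V) :
    foldTime k p y x = boostT y 1 x := by
  simp [foldTime, foldShift_of_nonneg h]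

lemma exists_foldTime_of_neg {k : ℝ} (hk : 0 ≤ k) (hk1 : k < 1) {p : V} (hp : ‖p‖ = 1) (y : V) :
    ∃ y' : V, ∀ x, ⟪p, x⟫ + k ≤ 0 → foldTime k p y x = boostT y' 1 x := by
  have hc : 0 < 1 - k ^ 2 := by nlinarith
  set d := k * hypT y - ⟪y, p⟫ with hd
  set c := 2 / (1 - k ^ 2) with hcdef
  have hcc : c * (1 - k ^ 2) = 2 := div_mul_cancel₀ _ hc.ne'
  have hc0 : 0 < c := div_pos two_pos hc
  have hT : hypT (y + (c * d) • p) = hypT y + c * k * d := by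
    rw [hypT, Real.sqrt_eq_iff_eq_sq (by positivity)]
    · rw [norm_add_sq_real, inner_smul_right, norm_smul, hp, mul_one, Real.norm_eq_abs, sq_abs]
      have h1 := hypT_sq y
      have h2 : (⟪y, p⟫ : ℝ) = k * hypT y - d := by rw [hd]; ring
      rw [h2]
      linear_combination c * d ^ 2 * hcc - h1
    · have h3 := (abs_le.1 (abs_real_inner_le_norm y p)).2
      rw [hp, mul_one] at h3
      have h4 := norm_lt_hypT y
      have h5 : 0 ≤ (1 - k ^ 2) * (hypT y + c * k * d) := by
        have : (1 - k ^ 2) * (hypT y + c * k * d) = (1 + k ^ 2) * hypT y - 2 * k * ⟪y, p⟫ := by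
          rw [hd]; linear_combination k * (k * hypT y - ⟪y, p⟫) * hcc
        rw [this]
        nlinarith [hypT_pos y, sq_nonneg (1 - k)]
      exact nonneg_of_mul_nonneg_right h5 hc
  refine ⟨y + (c * d) • p, fun x hx => ?_⟩
  have hs : foldShift k p x = -(c * (⟪p, x⟫ + k)) := by
    rw [foldShift_of_neg hx, hcdef]; ring
  rw [foldTime, hs, boostT, boostT, hT, inner_add_left, inner_add_right, inner_smul_right,
    real_inner_smul_left, hd]
  ring

end FoldTime

lemma integral_lt_integral_of_ae_le {X : Type*} [MeasurableSpace X] {μ : Measure X}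
    {f g : X → ℝ} (hf : Integrable f μ) (hg : Integrable g μ) (h : f ≤ᵐ[μ] g)
    (hlt : μ {x | f x < g x} ≠ 0) : ∫ x, f x ∂μ < ∫ x, g x ∂μ := by
  rw [← sub_pos, ← integral_sub hg hf, integral_pos_iff_support_of_nonneg_ae
    (h.mono fun x hx => sub_nonneg.2 hx) (hg.sub hf)]
  refine (pos_iff_ne_zero.2 hlt).trans_le (measure_mono fun x hx => ?_)
  exact (sub_pos.2 (show f x < g x from hx)).ne'

lemma integral_inv_foldTime_pow_lt {n : ℕ} {k : ℝ} (hk : k ∈ Icc (0 : ℝ) 1)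
    {p : Eu n} (hp : ‖p‖ = 1) (y : Eu n) :
    ∫ x, (foldTime k p y x)⁻¹ ^ n ∂sphMeasure n < 2 * sigmaVol n := by
  rcases hk.2.eq_or_lt with rfl | hk1
  · have : foldTime 1 p y = boostT y 1 := by
      ext x; simp [foldTime, foldShift_one]
    rw [this, integral_inv_boostT_pow]
    linarith [sigmaVol_pos n]
  obtain ⟨y', hy'⟩ := exists_foldTime_of_neg hk.1 hk1 hp y
  have hI (z : Eu n) : Integrable (fun x => (boostT z 1 x)⁻¹ ^ n) (sphMeasure n) :=
    integrable_sphMeasure_of_continuousOn (continuousOn_inv_boostT_pow z n)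
  have hpos (z : Eu n) {x : Eu n} (hx : ‖x‖ = 1) : 0 < (boostT z 1 x)⁻¹ ^ n :=
    pow_pos (inv_pos.2 (boostT_one_pos z hx)) n
  have h2 : 2 * sigmaVol n =
      ∫ x, ((boostT y 1 x)⁻¹ ^ n + (boostT y' 1 x)⁻¹ ^ n) ∂sphMeasure n := by
    rw [integral_add (hI y) (hI y'), integral_inv_boostT_pow, integral_inv_boostT_pow, two_mul]
  rw [h2]
  refine integral_lt_integral_of_ae_le ?_ ((hI y).add (hI y')) ?_ ?_
  · refine integrable_sphMeasure_of_continuousOn ?_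
    refine ((continuous_foldTime k p y).continuousOn.inv₀ fun x hx => ?_).pow n
    exact (foldTime_pos hk hp (by simpa using hx) y).ne'
  · filter_upwards [ae_sphMeasure_norm n] with x hx
    rcases le_total 0 (⟪p, x⟫ + k) with h | h
    · rw [foldTime_of_nonneg h]
      linarith [hpos y' hx]
    · rw [hy' x h]
      linarith [hpos y hx]
  · have hU : IsOpen {x : Eu n | 0 < ⟪p, x⟫ + k} :=
      isOpen_lt continuous_const (by fun_prop)
    have h3 := sphMeasure_open_inter_pos hU ⟨p, by simp [hp]; linarith [hk.1], by simpa using hp⟩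
    refine fun h0 => h3.ne' (measure_mono_null (t := _ ∪ _) (fun x hx => ?_)
      (measure_union_null h0 (ae_iff.1 (ae_sphMeasure_norm n))))
    by_cases hx1 : ‖x‖ = 1
    · left
      have hx' : 0 < ⟪p, x⟫ + k := hx
      change (foldTime k p y x)⁻¹ ^ n < _
      rw [foldTime_of_nonneg hx'.le]
      linarith [hpos y' hx1]
    · exact Or.inr hx1

section Gradient

variable {n : ℕ}

lemma gradient_apply {f : Eu n → ℝ} {x : Eu n} (j : Fin (n + 1)) :
    gradient f x j = fderiv ℝ f x (EuclideanSpace.single j 1) := by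
  rw [← inner_gradient_left, EuclideanSpace.inner_single_right]
  simp

lemma norm_gradS_sq {f : Eu n → ℝ} (x : Eu n) :
    ‖gradS f x‖ ^ 2 = ∑ j, (fderiv ℝ f x (EuclideanSpace.single j 1 - x j • x)) ^ 2 := by
  rw [EuclideanSpace.real_norm_sq_eq]
  refine Finset.sum_congr rfl fun j _ => ?_
  rw [gradS, map_sub, map_smul, PiLp.sub_apply, PiLp.smul_apply, gradient_apply,
    inner_gradient_left]
  simp only [smul_eq_mul]
  ring

lemma sum_norm_gradS_sq {U : Eu n → Eu n} {x : Eu n} (hU : DifferentiableAt ℝ U x) :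
    ∑ i, ‖gradS (fun z => U z i) x‖ ^ 2 =
      ∑ j, ‖fderiv ℝ U x (EuclideanSpace.single j 1 - x j • x)‖ ^ 2 := by
  have h (i : Fin (n + 1)) (v : Eu n) :
      fderiv ℝ (fun z => U z i) x v = fderiv ℝ U x v i := by
    have h1 := ((EuclideanSpace.proj i : Eu n →L[ℝ] ℝ).hasFDerivAt.comp x hU.hasFDerivAt)
    have h2 := h1.fderiv
    simp only [Function.comp_def, PiLp.proj_apply] at h2
    rw [h2]
    rfl
  simp_rw [norm_gradS_sq, h]
  rw [Finset.sum_comm]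
  simp_rw [EuclideanSpace.real_norm_sq_eq]

lemma sum_norm_proj_sq {x : Eu n} (hx : ‖x‖ = 1) :
    ∑ j, ‖(EuclideanSpace.single j 1 - x j • x : Eu n)‖ ^ 2 = n := by
  have h (j : Fin (n + 1)) :
      ‖(EuclideanSpace.single j 1 - x j • x : Eu n)‖ ^ 2 = 1 - x j ^ 2 := by
    rw [norm_sub_sq_real, inner_smul_right, EuclideanSpace.inner_single_left, norm_smul, hx]
    simp
    ring
  simp_rw [h]
  rw [Finset.sum_sub_distrib, ← EuclideanSpace.real_norm_sq_eq, hx]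
  simp

lemma inner_proj {x : Eu n} (hx : ‖x‖ = 1) (j : Fin (n + 1)) :
    ⟪x, (EuclideanSpace.single j 1 - x j • x : Eu n)⟫ = (0 : ℝ) := by
  rw [inner_sub_right, inner_smul_right, real_inner_self_eq_norm_sq, hx,
    EuclideanSpace.inner_single_right]
  simp

lemma continuous_gradS {f : Eu n → ℝ} (hf : ContDiff ℝ (⊤ : ℕ∞) f) : Continuous (gradS f) := by
  have h : Continuous (gradient f) := by
    unfold gradient
    exact (InnerProductSpace.toDual ℝ (Eu n)).symm.continuous.comp
      (hf.continuous_fderiv (by simp))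
  unfold gradS
  fun_prop

lemma gradS_comb {f g : Eu n → ℝ} {x : Eu n} (hf : DifferentiableAt ℝ f x)
    (hg : DifferentiableAt ℝ g x) (a b : ℝ) :
    gradS (fun z => a * f z + b * g z) x = a • gradS f x + b • gradS g x := by
  have h : gradient (fun z => a * f z + b * g z) x = a • gradient f x + b • gradient g x := by
    unfold gradient
    have := ((hf.hasFDerivAt.const_mul a).add (hg.hasFDerivAt.const_mul b)).fderiv
    have h2 : (fun z => a * f z + b * g z) = (fun z => a * f z) + fun z => b * g z := rfl
    rw [h2, this, map_add, map_smulₛₗ, map_smulₛₗ]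
    simp
  rw [gradS, gradS, gradS, h, inner_add_left, real_inner_smul_left, real_inner_smul_left]
  module

lemma gradS_sub_const (f : Eu n → ℝ) (c : ℝ) :
    gradS (fun z => f z - c) = gradS f := by
  ext1 x
  have h : gradient (fun z => f z - c) x = gradient f x := by
    unfold gradient
    rw [fderiv_sub_const]
  rw [gradS, gradS, h]

end Gradient

section CutoffInv

lemma exists_contDiff_eq_inv {c : ℝ} (hc : 0 < c) :
    ∃ χ : ℝ → ℝ, ContDiff ℝ (⊤ : ℕ∞) χ ∧ ∀ t, c / 2 < t → χ t = t⁻¹ := by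
  refine ⟨fun t => Real.smoothTransition (4 / c * t - 1) * t⁻¹, ?_, fun t ht => ?_⟩
  · refine contDiff_iff_contDiffAt.2 fun t => ?_
    rcases eq_or_ne t 0 with rfl | ht
    · refine (contDiffAt_const (c := (0 : ℝ))).congr_of_eventuallyEq ?_
      filter_upwards [gt_mem_nhds (show (0 : ℝ) < c / 4 by positivity)] with t ht
      rw [Real.smoothTransition.zero_of_nonpos, zero_mul]
      rw [sub_nonpos, div_mul_eq_mul_div, div_le_one hc]
      linarith
    · exact (Real.smoothTransition.contDiffAt.comp t (by fun_prop)).mul (contDiffAt_inv ℝ ht)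
  · beta_reduce
    rw [Real.smoothTransition.one_of_one_le, one_mul]
    rw [le_sub_iff_add_le, div_mul_eq_mul_div, le_div_iff₀ hc]
    linarith

lemma deriv_eq_of_eq_inv {c : ℝ} {χ : ℝ → ℝ} (h : ∀ t, c / 2 < t → χ t = t⁻¹)
    {t : ℝ} (ht : c / 2 < t) : deriv χ t = -(t ^ 2)⁻¹ := by
  have : χ =ᶠ[𝓝 t] fun t => t⁻¹ := by
    filter_upwards [lt_mem_nhds ht] with s hs using h s hs
  rw [this.deriv_eq, deriv_inv]

end CutoffInv

section SmoothFold

variable {V : Type*} [NormedAddCommGroup V] [InnerProductSpace ℝ V]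

/-- Smoothing of the negative part. -/
def smoothNeg (δ s : ℝ) : ℝ := (√(s ^ 2 + δ ^ 2) - s) / 2

/-- Derivative of `smoothNeg`. -/
def smoothNegDeriv (δ s : ℝ) : ℝ := (s / √(s ^ 2 + δ ^ 2) - 1) / 2

lemma contDiff_smoothNeg {δ : ℝ} (hδ : 0 < δ) : ContDiff ℝ (⊤ : ℕ∞) (smoothNeg δ) := by
  unfold smoothNeg
  refine ((ContDiff.sqrt (by fun_prop) fun s => ?_).sub contDiff_id).div_const 2
  positivity

lemma hasDerivAt_smoothNeg {δ : ℝ} (hδ : 0 < δ) (s : ℝ) :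
    HasDerivAt (smoothNeg δ) (smoothNegDeriv δ s) s := by
  have h1 : HasDerivAt (fun s : ℝ => s ^ 2 + δ ^ 2) (2 * s) s := by
    simpa using (hasDerivAt_pow 2 s).add_const (δ ^ 2)
  have h2 := ((h1.sqrt (by positivity)).sub (hasDerivAt_id s)).div_const 2
  refine h2.congr_deriv ?_
  rw [smoothNegDeriv, mul_div_mul_left _ _ two_ne_zero]

lemma abs_le_sqrt_sq_add (s δ : ℝ) : |s| ≤ √(s ^ 2 + δ ^ 2) :=
  Real.abs_le_sqrt (by nlinarith [sq_nonneg δ])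

lemma smoothNeg_mem {δ s : ℝ} (hδ : δ ∈ Ioc (0 : ℝ) 1) (hs : |s| ≤ 2) :
    smoothNeg δ s ∈ Icc (0 : ℝ) 3 := by
  have h1 := abs_le_sqrt_sq_add s δ
  have h2 := le_abs_self s
  have h3 := neg_abs_le s
  have h4 : √(s ^ 2 + δ ^ 2) ≤ 3 := by
    rw [Real.sqrt_le_left (by norm_num)]
    have h5 : s ^ 2 ≤ 2 ^ 2 := sq_le_sq' (by linarith [neg_abs_le s]) (h2.trans hs)
    nlinarith [hδ.1, hδ.2]
  constructor <;> rw [smoothNeg] <;> linarith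

lemma smoothNegDeriv_mem (δ s : ℝ) : smoothNegDeriv δ s ∈ Icc (-1 : ℝ) 0 := by
  have h1 := abs_le_sqrt_sq_add s δ
  have h2 : |s / √(s ^ 2 + δ ^ 2)| ≤ 1 := by
    rw [abs_div, abs_of_nonneg (Real.sqrt_nonneg _)]
    exact div_le_one_of_le₀ h1 (Real.sqrt_nonneg _)
  have := abs_le.1 h2
  constructor <;> rw [smoothNegDeriv] <;> linarith

lemma tendsto_smoothNeg {δ : ℕ → ℝ} (hδ : Tendsto δ atTop (𝓝 0)) (s : ℝ) :
    Tendsto (fun j => smoothNeg (δ j) s) atTop (𝓝 (max 0 (-s))) := by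
  have h : Continuous fun δ => smoothNeg δ s := by unfold smoothNeg; fun_prop
  have h0 : max 0 (-s) = smoothNeg 0 s := ?_
  · rw [h0]
    exact (h.tendsto 0).comp hδ
  rw [smoothNeg]
  rcases le_total 0 s with hs | hs
  · rw [max_eq_left (by linarith)]; simp [Real.sqrt_sq hs]
  · rw [max_eq_right (by linarith)]; simp [Real.sqrt_sq_eq_abs, abs_of_nonpos hs]; ring

lemma tendsto_smoothNegDeriv {δ : ℕ → ℝ} (hδ : Tendsto δ atTop (𝓝 0)) {s : ℝ} (hs : s ≠ 0) :
    Tendsto (fun j => smoothNegDeriv (δ j) s) atTop (𝓝 (if 0 < s then 0 else -1)) := by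
  have h : ContinuousAt (fun δ => smoothNegDeriv δ s) 0 := by
    unfold smoothNegDeriv
    have : √(s ^ 2 + 0 ^ 2) ≠ 0 := by
      have : 0 < s ^ 2 + 0 ^ 2 := by positivity
      positivity
    fun_prop (disch := exact this)
  have h1 : (if 0 < s then (0 : ℝ) else -1) = smoothNegDeriv 0 s := ?_
  · rw [h1]
    exact h.tendsto.comp hδ
  rw [smoothNegDeriv]
  split_ifs with h0
  · simp [Real.sqrt_sq h0.le, hs]
  · have : s ≤ 0 := not_lt.1 h0
    simp [Real.sqrt_sq_eq_abs, abs_of_nonpos this, hs]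
    norm_num

/-- The fold map composed with a boost, with displacement `σ` and regularized inverse `χ`. -/
def foldVal (χ : ℝ → ℝ) (k : ℝ) (p y : V) (σ : ℝ) (x : V) : V :=
  χ (boostT y (1 - k * σ) (x + σ • p)) • boostS y (1 - k * σ) (x + σ • p)

/-- The directional derivative of `foldVal` when the displacement has derivative `τ`. -/
def foldDeriv (χ : ℝ → ℝ) (k : ℝ) (p y : V) (σ τ : ℝ) (x v : V) : V :=
  (deriv χ (boostT y (1 - k * σ) (x + σ • p)) * boostT y (-(k * τ)) (v + τ • p)) •
      boostS y (1 - k * σ) (x + σ • p) +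
    χ (boostT y (1 - k * σ) (x + σ • p)) • boostS y (-(k * τ)) (v + τ • p)

lemma hasDerivAt_foldVal {χ : ℝ → ℝ} (hχ : Differentiable ℝ χ) (k : ℝ) (p y : V) {s : ℝ → ℝ}
    {c : ℝ → V} {τ t : ℝ} {v : V} (hs : HasDerivAt s τ t) (hc : HasDerivAt c v t) :
    HasDerivAt (fun t => foldVal χ k p y (s t) (c t)) (foldDeriv χ k p y (s t) τ (c t) v) t := by
  have ha : HasDerivAt (fun t => 1 - k * s t) (-(k * τ)) t := (hs.const_mul k).const_sub 1
  have hv : HasDerivAt (fun t => c t + s t • p) (v + τ • p) t := hc.add (hs.smul_const p)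
  have hin : HasDerivAt (fun t => (⟪y, c t + s t • p⟫ : ℝ)) ⟪y, v + τ • p⟫ t := by
    simpa using (hasDerivAt_const t y).inner ℝ hv
  have hT : HasDerivAt (fun t => boostT y (1 - k * s t) (c t + s t • p))
      (boostT y (-(k * τ)) (v + τ • p)) t := (ha.const_mul _).add hin
  have hS : HasDerivAt (fun t => boostS y (1 - k * s t) (c t + s t • p))
      (boostS y (-(k * τ)) (v + τ • p)) t :=
    hv.add ((ha.add (hin.div_const _)).smul_const y)
  have hχT := (hχ (boostT y (1 - k * s t) (c t + s t • p))).hasDerivAt.comp t hT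
  refine (hχT.smul hS).congr_deriv ?_
  rw [foldDeriv, add_comm]
  rfl

lemma inner_boostS (y : V) (a b : ℝ) (v z : V) :
    ⟪boostS y a v, boostS y b z⟫ = boostT y a v * boostT y b z - a * b + ⟪v, z⟫ := by
  have h := hypT_sq y
  have h1 : 1 + hypT y ≠ 0 := by linarith [hypT_pos y]
  have h2 : ‖y‖ ^ 2 = (hypT y - 1) * (hypT y + 1) := by linarith
  simp only [boostS, boostT, inner_add_left, inner_add_right, inner_smul_right,
    real_inner_smul_left, real_inner_self_eq_norm_sq]
  rw [h2, real_inner_comm y v]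
  field_simp
  ring

lemma norm_foldDeriv_sq {χ : ℝ → ℝ} {k σ τ : ℝ} {p y x v : V} {T : ℝ}
    (hT : T = boostT y (1 - k * σ) (x + σ • p)) (hT0 : T ≠ 0)
    (hχ : χ T = T⁻¹) (hχ' : deriv χ T = -(T ^ 2)⁻¹)
    (h1 : ‖x + σ • p‖ ^ 2 = (1 - k * σ) ^ 2)
    (h2 : ‖v + τ • p‖ ^ 2 - (k * τ) ^ 2 = ‖v‖ ^ 2)
    (h3 : ⟪x + σ • p, v + τ • p⟫ + (1 - k * σ) * (k * τ) = 0) :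
    ‖foldDeriv χ k p y σ τ x v‖ ^ 2 = ‖v‖ ^ 2 / T ^ 2 := by
  have hin := inner_boostS y (1 - k * σ) (-(k * τ)) (x + σ • p) (v + τ • p)
  have hS := norm_boostS_sq y (1 - k * σ) (x + σ • p)
  have hS' := norm_boostS_sq y (-(k * τ)) (v + τ • p)
  rw [← hT] at hin hS
  rw [foldDeriv, ← hT, hχ, hχ', norm_add_sq_real, norm_smul, norm_smul, mul_pow, mul_pow,
    Real.norm_eq_abs, Real.norm_eq_abs, sq_abs, sq_abs, inner_smul_right, real_inner_smul_left,
    hin, hS, hS', h1, ← h2, eq_sub_of_add_eq h3]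
  field_simp
  ring

end SmoothFold

section SmoothApprox

lemma exists_pos_lower_bound_foldTime {n : ℕ} {k : ℝ} (hk : k ∈ Icc (0 : ℝ) 1)
    {p : Eu n} (hp : ‖p‖ = 1) (y : Eu n) :
    ∃ c, 0 < c ∧ ∀ x, ‖x‖ = 1 → c ≤ foldTime k p y x := by
  obtain ⟨x, hx, hmin⟩ := (isCompact_sphere (0 : Eu n) 1).exists_isMinOn ⟨p, by simpa using hp⟩
    (continuous_foldTime k p y).continuousOn
  exact ⟨_, foldTime_pos hk hp (by simpa using hx) y, fun z hz => hmin (by simpa using hz)⟩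

lemma norm_foldDeriv_sq_of_inner_eq_zero {V : Type*} [NormedAddCommGroup V]
    [InnerProductSpace ℝ V] {χ : ℝ → ℝ} {k : ℝ} (hk : k ∈ Icc (0 : ℝ) 1) {p x v y : V}
    (hp : ‖p‖ = 1) (hx : ‖x‖ = 1) (hxv : ⟪x, v⟫ = (0 : ℝ))
    (hχ : χ (foldTime k p y x) = (foldTime k p y x)⁻¹)
    (hχ' : deriv χ (foldTime k p y x) = -(foldTime k p y x ^ 2)⁻¹) :
    ‖foldDeriv χ k p y (foldShift k p x)
      (2 / (1 - k ^ 2) * (if 0 < ⟪p, x⟫ + k then 0 else -1) * ⟪p, v⟫) x v‖ ^ 2 =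
      ‖v‖ ^ 2 / foldTime k p y x ^ 2 := by
  set D : ℝ := 2 / (1 - k ^ 2) * (if 0 < ⟪p, x⟫ + k then 0 else -1) with hD
  have hD1 : D * (2 + D * (1 - k ^ 2)) = 0 ∧
      D * (⟪p, x⟫ + k) + foldShift k p x * (1 + D * (1 - k ^ 2)) = 0 := by
    rcases hk.2.eq_or_lt with rfl | hk1
    · simp [hD, foldShift_one]
    have hc : 1 - k ^ 2 ≠ 0 := by nlinarith [hk.1]
    by_cases hs : 0 < ⟪p, x⟫ + k
    · simp [hD, hs, foldShift_of_nonneg hs.le]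
    · rw [foldShift_of_neg (not_lt.1 hs), hD, if_neg hs]
      constructor <;> field_simp <;> ring
  refine norm_foldDeriv_sq rfl (foldTime_pos hk hp hx y).ne' hχ hχ'
    (norm_add_foldShift_sq hk hp hx) ?_ ?_
  · rw [norm_add_sq_real, inner_smul_right, norm_smul, hp, mul_one, Real.norm_eq_abs, sq_abs,
      real_inner_comm p v]
    linear_combination ⟪p, v⟫ ^ 2 * hD1.1
  · rw [inner_add_left, inner_add_right, inner_add_right, inner_smul_right, inner_smul_right,
      real_inner_smul_left, real_inner_smul_left, hxv, real_inner_self_eq_norm_sq, hp,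
      real_inner_comm p x]
    linear_combination ⟪p, v⟫ * hD1.2

lemma exists_smooth_approx_confBoost_foldMap {n : ℕ} {k : ℝ} (hk : k ∈ Icc (0 : ℝ) 1)
    {p : Eu n} (hp : ‖p‖ = 1) (y : Eu n) :
    ∃ U : ℕ → Eu n → Eu n, (∀ j, ContDiff ℝ (⊤ : ℕ∞) (U j)) ∧
      (∃ C, ∀ j x, ‖x‖ = 1 → ‖U j x‖ ≤ C ∧ ∑ i, ‖gradS (fun z => U j z i) x‖ ^ 2 ≤ C) ∧
      (∀ x, ‖x‖ = 1 → Tendsto (fun j => U j x) atTop (𝓝 (confBoost y (foldMap k p x)))) ∧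
      ∀ x, ‖x‖ = 1 → ⟪p, x⟫ + k ≠ 0 →
        Tendsto (fun j => ∑ i, ‖gradS (fun z => U j z i) x‖ ^ 2) atTop
          (𝓝 (n / foldTime k p y x ^ 2)) := by
  obtain ⟨c, hc, hcle⟩ := exists_pos_lower_bound_foldTime hk hp y
  obtain ⟨χ, hχ, hχinv⟩ := exists_contDiff_eq_inv hc
  have hχd : Differentiable ℝ χ := hχ.differentiable (by simp)
  have hχc : Continuous χ := hχ.continuous
  have hχ'c : Continuous (deriv χ) := hχ.continuous_deriv (by simp)
  set κ : ℝ := 2 / (1 - k ^ 2) with hκ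
  have hκ0 : 0 ≤ κ := div_nonneg two_pos.le (by nlinarith [hk.1, hk.2])
  set δ : ℕ → ℝ := fun j => 1 / ((j : ℝ) + 1) with hδdef
  have hδ0 : Tendsto δ atTop (𝓝 0) := tendsto_one_div_add_atTop_nhds_zero_nat
  have hδ (j : ℕ) : δ j ∈ Ioc (0 : ℝ) 1 := by
    refine ⟨by positivity, ?_⟩
    rw [hδdef, div_le_one (by positivity)]
    linarith [Nat.cast_nonneg (α := ℝ) j]
  set σ : ℕ → Eu n → ℝ := fun j z => κ * smoothNeg (δ j) (⟪p, z⟫ + k) with hσ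
  set d : ℕ → Eu n → ℝ := fun j x => κ * smoothNegDeriv (δ j) (⟪p, x⟫ + k) with hd
  have hin (q : Eu n) : ContDiff ℝ (⊤ : ℕ∞) fun z : Eu n => (⟪q, z⟫ : ℝ) :=
    contDiff_const.inner ℝ contDiff_id
  have hσs (j : ℕ) : ContDiff ℝ (⊤ : ℕ∞) (σ j) :=
    contDiff_const.mul ((contDiff_smoothNeg (hδ j).1).comp ((hin p).add contDiff_const))
  set U : ℕ → Eu n → Eu n := fun j z => foldVal χ k p y (σ j z) z with hU
  have hUs (j : ℕ) : ContDiff ℝ (⊤ : ℕ∞) (U j) := by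
    have h1 := hσs j
    have h2 : ContDiff ℝ (⊤ : ℕ∞) fun z => z + σ j z • p := by fun_prop
    have h3 : ContDiff ℝ (⊤ : ℕ∞) fun z => (⟪y, z + σ j z • p⟫ : ℝ) := (hin y).comp h2
    have h4 : ContDiff ℝ (⊤ : ℕ∞) fun z => 1 - k * σ j z := by fun_prop
    refine ContDiff.smul (hχ.comp ?_) ?_
    · exact (contDiff_const.mul h4).add h3
    · exact h2.add ((h4.add (h3.div_const _)).smul contDiff_const)
  have hfd (j : ℕ) (x v : Eu n) :
      fderiv ℝ (U j) x v = foldDeriv χ k p y (σ j x) (d j x * ⟪p, v⟫) x v := by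
    have hc : HasDerivAt (fun t : ℝ => x + t • v) v 0 := by
      simpa using ((hasDerivAt_id (0 : ℝ)).smul_const v).const_add x
    have hin : HasDerivAt (fun t : ℝ => (⟪p, x + t • v⟫ : ℝ) + k) ⟪p, v⟫ 0 := by
      simpa using ((hasDerivAt_const (0 : ℝ) p).inner ℝ hc).add_const k
    have hs : HasDerivAt (fun t : ℝ => σ j (x + t • v)) (d j x * ⟪p, v⟫) 0 := by
      have h1 := hasDerivAt_smoothNeg (hδ j).1 ((⟪p, x + (0 : ℝ) • v⟫ : ℝ) + k)
      have h2 := (h1.comp (0 : ℝ) hin).const_mul κ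
      refine h2.congr_deriv ?_
      simp only [hd, zero_smul, add_zero]
      ring
    have h3 := hasDerivAt_foldVal hχd k p y hs hc
    have h4 : HasFDerivAt (U j) (fderiv ℝ (U j) x) (x + (0 : ℝ) • v) := by
      rw [zero_smul, add_zero]
      exact ((hUs j).differentiable (by simp) x).hasFDerivAt
    have h5 := h4.comp_hasDerivAt (0 : ℝ) hc
    have h6 := h5.unique h3
    simpa using h6
  set G : ℝ × ℝ × Eu n → ℝ := fun q => ∑ j,
    ‖foldDeriv χ k p y q.1 (q.2.1 * ⟪p, (EuclideanSpace.single j 1 - q.2.2 j • q.2.2 : Eu n)⟫)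
      q.2.2 (EuclideanSpace.single j 1 - q.2.2 j • q.2.2)‖ ^ 2 with hG
  have hGsum (j : ℕ) (x : Eu n) :
      ∑ i, ‖gradS (fun z => U j z i) x‖ ^ 2 = G (σ j x, d j x, x) := by
    rw [sum_norm_gradS_sq ((hUs j).differentiable (by simp) x)]
    simp_rw [hfd, hG]
  have hGc : Continuous G := by
    refine continuous_finsetSum _ fun j _ => Continuous.pow (Continuous.norm ?_) 2
    have hv : Continuous fun q : ℝ × ℝ × Eu n =>
        (EuclideanSpace.single j 1 - q.2.2 j • q.2.2 : Eu n) := by fun_prop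
    have hτ : Continuous fun q : ℝ × ℝ × Eu n =>
      q.2.1 * (⟪p, (EuclideanSpace.single j 1 - q.2.2 j • q.2.2 : Eu n)⟫ : ℝ) := by fun_prop
    have hT : Continuous fun q : ℝ × ℝ × Eu n =>
      boostT y (1 - k * q.1) (q.2.2 + q.1 • p) := by unfold boostT; fun_prop
    unfold foldDeriv
    refine Continuous.add (((hχ'c.comp hT).mul ?_).smul ?_) ((hχc.comp hT).smul ?_)
    · unfold boostT; fun_prop
    · unfold boostS; fun_prop
    · unfold boostS; fun_prop
  set W : ℝ × Eu n → Eu n := fun q => foldVal χ k p y q.1 q.2 with hW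
  have hWc : Continuous W := by
    have hT : Continuous fun q : ℝ × Eu n =>
      boostT y (1 - k * q.1) (q.2 + q.1 • p) := by unfold boostT; fun_prop
    refine (hχc.comp hT).smul ?_
    unfold boostS; fun_prop
  have hs2 {x : Eu n} (hx : ‖x‖ = 1) : |⟪p, x⟫ + k| ≤ 2 := by
    have h1 := abs_real_inner_le_norm p x
    rw [hp, hx, one_mul] at h1
    have h2 := abs_le.1 h1
    exact abs_le.2 ⟨by linarith [hk.1], by linarith [hk.2]⟩
  have hσm (j : ℕ) {x : Eu n} (hx : ‖x‖ = 1) : σ j x ∈ Icc 0 (κ * 3) :=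
    have h := smoothNeg_mem (hδ j) (hs2 hx)
    ⟨mul_nonneg hκ0 h.1, mul_le_mul_of_nonneg_left h.2 hκ0⟩
  have hdm (j : ℕ) (x : Eu n) : d j x ∈ Icc (κ * (-1)) (κ * 0) :=
    have h := smoothNegDeriv_mem (δ j) (⟪p, x⟫ + k)
    ⟨mul_le_mul_of_nonneg_left h.1 hκ0, mul_le_mul_of_nonneg_left h.2 hκ0⟩
  have hσlim (x : Eu n) : Tendsto (fun j => σ j x) atTop (𝓝 (foldShift k p x)) :=
    (tendsto_smoothNeg hδ0 _).const_mul κ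
  have hχT {x : Eu n} (hx : ‖x‖ = 1) : c / 2 < foldTime k p y x := by
    linarith [hcle x hx]
  refine ⟨U, hUs, ?_, fun x hx => ?_, fun x hx hxs => ?_⟩
  · obtain ⟨C₁, hC₁⟩ := (isCompact_Icc.prod (isCompact_Icc.prod (isCompact_sphere (0 : Eu n) 1)))
      |>.exists_bound_of_continuousOn (s := Icc 0 (κ * 3) ×ˢ Icc (κ * (-1)) (κ * 0) ×ˢ sphere 0 1)
        hGc.continuousOn
    obtain ⟨C₂, hC₂⟩ := (isCompact_Icc.prod (isCompact_sphere (0 : Eu n) 1))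
      |>.exists_bound_of_continuousOn (s := Icc 0 (κ * 3) ×ˢ sphere 0 1) hWc.continuousOn
    refine ⟨max C₁ C₂, fun j x hx => ⟨?_, ?_⟩⟩
    · exact (hC₂ (σ j x, x) ⟨hσm j hx, by simpa using hx⟩).trans (le_max_right _ _)
    · rw [hGsum]
      exact (le_abs_self _).trans ((hC₁ (σ j x, d j x, x)
        ⟨hσm j hx, hdm j x, by simpa using hx⟩).trans (le_max_left _ _))
  · have h1 := (hWc.tendsto (foldShift k p x, x)).comp
      ((hσlim x).prodMk_nhds tendsto_const_nhds)
    have h2 : W (foldShift k p x, x) = confBoost y (foldMap k p x) := by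
      rw [← inv_foldTime_smul_foldSpace hk hp hx y, ← hχinv _ (hχT hx)]
      rfl
    rw [h2] at h1
    exact h1
  · have hdlim : Tendsto (fun j => d j x) atTop
        (𝓝 (κ * (if 0 < ⟪p, x⟫ + k then 0 else -1))) :=
      (tendsto_smoothNegDeriv hδ0 hxs).const_mul κ
    have h1 := (hGc.tendsto _).comp
      ((hσlim x).prodMk_nhds (hdlim.prodMk_nhds (tendsto_const_nhds (x := x))))
    have h2 : (n : ℝ) / foldTime k p y x ^ 2 =
        G (foldShift k p x, κ * (if 0 < ⟪p, x⟫ + k then 0 else -1), x) := ?_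
    · simp_rw [hGsum]
      rw [h2]
      exact h1
    simp_rw [hG]
    rw [← sum_norm_proj_sq hx, Finset.sum_div]
    refine Finset.sum_congr rfl fun j _ => ?_
    exact (norm_foldDeriv_sq_of_inner_eq_zero hk hp hx (inner_proj hx j) (hχinv _ (hχT hx))
      (deriv_eq_of_eq_inv hχinv (hχT hx))).symm

end SmoothApprox

section ConformalMeasure

variable {n : ℕ} {w : Eu n → ℝ}

lemma IsConformalFactor.pos (hw : IsConformalFactor n w) {x : Eu n} (hx : ‖x‖ = 1) : 0 < w x :=
  hw.2 x (by simpa [sphSet] using hx)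

lemma IsConformalFactor.continuous (hw : IsConformalFactor n w) : Continuous w := hw.1.continuous

lemma integrable_sphMeasure_of_continuous {F : Type*} [NormedAddCommGroup F] {f : Eu n → F}
    (hf : Continuous f) : Integrable f (sphMeasure n) :=
  integrable_sphMeasure_of_continuousOn hf.continuousOn

lemma isFiniteMeasure_confMeasure (hw : IsConformalFactor n w) :
    IsFiniteMeasure (confMeasure n w) :=
  isFiniteMeasure_withDensity_ofReal
    (integrable_sphMeasure_of_continuous (hw.continuous.pow n)).hasFiniteIntegral

lemma confMeasure_absolutelyContinuous : confMeasure n w ≪ sphMeasure n :=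
  withDensity_absolutelyContinuous _ _

lemma sphMeasure_absolutelyContinuous_confMeasure (hw : IsConformalFactor n w) :
    sphMeasure n ≪ confMeasure n w := by
  refine withDensity_absolutelyContinuous' ?_ ?_
  · exact ((hw.continuous.pow n).measurable.ennreal_ofReal).aemeasurable
  · filter_upwards [ae_sphMeasure_norm n] with x hx
    exact (ENNReal.ofReal_pos.2 (pow_pos (hw.pos hx) n)).ne'

lemma ae_confMeasure_norm : ∀ᵐ x ∂confMeasure n w, ‖x‖ = 1 :=
  confMeasure_absolutelyContinuous.ae_le (ae_sphMeasure_norm n)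

lemma confMeasure_span_pair (hn : 2 ≤ n) (p e : Eu n) :
    confMeasure n w (Submodule.span ℝ {p, e} : Set (Eu n)) = 0 :=
  confMeasure_absolutelyContinuous (sphMeasure_span_pair hn p e)

lemma confMeasure_open_inter_pos (hw : IsConformalFactor n w) {U : Set (Eu n)} (hU : IsOpen U)
    (hne : (U ∩ sphere 0 1).Nonempty) : 0 < confMeasure n w U :=
  pos_iff_ne_zero.2 fun h => (sphMeasure_open_inter_pos hU hne).ne'
    (sphMeasure_absolutelyContinuous_confMeasure hw h)

lemma confMeasure_ne_zero (hw : IsConformalFactor n w) : confMeasure n w ≠ 0 := by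
  intro h
  refine (confMeasure_open_inter_pos hw isOpen_univ ⟨e1 n, trivial, ?_⟩).ne' (by rw [h]; rfl)
  simp [e1]

lemma confVol_pos (hw : IsConformalFactor n w) : 0 < confVol n w := by
  have := isFiniteMeasure_confMeasure hw
  exact ENNReal.toReal_pos (Measure.measure_univ_ne_zero.2 (confMeasure_ne_zero hw))
    (measure_ne_top _ _)

lemma integral_confMeasure (hw : IsConformalFactor n w) (f : Eu n → ℝ) :
    ∫ x, f x ∂confMeasure n w = ∫ x, w x ^ n * f x ∂sphMeasure n := by
  have hm : Measurable fun x => ENNReal.ofReal (w x ^ n) :=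
    (hw.continuous.pow n).measurable.ennreal_ofReal
  rw [confMeasure, integral_withDensity_eq_integral_toReal_smul hm (ae_of_all _ fun _ => ENNReal.ofReal_lt_top)]
  refine integral_congr_ae ?_
  filter_upwards [ae_sphMeasure_norm n] with x hx
  rw [ENNReal.toReal_ofReal (pow_nonneg (hw.pos hx).le n), smul_eq_mul]

lemma confVol_eq (hw : IsConformalFactor n w) : confVol n w = ∫ x, w x ^ n ∂sphMeasure n := by
  have h := integral_confMeasure hw fun _ => 1
  simp only [integral_const, smul_eq_mul, mul_one] at h
  exact h

lemma integrable_confMeasure_of_continuous (hw : IsConformalFactor n w) {F : Type*}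
    [NormedAddCommGroup F] {f : Eu n → F} (hf : Continuous f) :
    Integrable f (confMeasure n w) := by
  have := isFiniteMeasure_confMeasure hw
  have h := hf.continuousOn.integrableOn_compact (μ := confMeasure n w)
    (isCompact_sphere (0 : Eu n) 1)
  rwa [IntegrableOn, Measure.restrict_eq_self_of_ae_mem] at h
  simpa using ae_confMeasure_norm

lemma integral_conformal_energy_lt (hn : 2 ≤ n) (hw : IsConformalFactor n w) {t : Eu n → ℝ}
    (ht : Continuous t) (htpos : ∀ x, ‖x‖ = 1 → 0 < t x) {B : ℝ}
    (hB : ∫ x, (t x)⁻¹ ^ n ∂sphMeasure n < B) :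
    ∫ x, w x ^ (n - 2) * (n / t x ^ 2) ∂sphMeasure n <
      n * B ^ ((2 : ℝ) / n) * confVol n w ^ (1 - (2 : ℝ) / n) := by
  have hn0 : (0 : ℝ) < n := by positivity
  have h_int : 0 ≤ ∫ x, (t x)⁻¹ ^ n ∂sphMeasure n := by
    refine integral_nonneg_of_ae ?_
    filter_upwards [ae_sphMeasure_norm n] with x hx
    exact pow_nonneg (inv_nonneg.2 (htpos x hx).le) n
  have key : ∫ x, w x ^ (n - 2) * (t x)⁻¹ ^ 2 ∂sphMeasure n ≤
      confVol n w ^ (1 - (2 : ℝ) / n) * (∫ x, (t x)⁻¹ ^ n ∂sphMeasure n) ^ ((2 : ℝ) / n) := by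
    rcases hn.eq_or_lt with rfl | hn3
    · simp
    · have hn2 : (2 : ℝ) < n := by exact_mod_cast hn3
      have hpq : Real.HolderConjugate ((n : ℝ) / (n - 2)) (n / 2) := by
        rw [Real.holderConjugate_iff, lt_div_iff₀ (by linarith)]
        refine ⟨by linarith, ?_⟩
        have : (n : ℝ) - 2 ≠ 0 := by linarith
        field_simp
        ring
      have hcw : Continuous fun x => w x ^ (n - 2) := hw.continuous.pow _
      have hct : ContinuousOn (fun x => (t x)⁻¹ ^ 2) (sphere 0 1) :=
        (ht.continuousOn.inv₀ fun x hx => (htpos x (by simpa using hx)).ne').pow 2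
      have hmem {f : Eu n → ℝ} (hf : ContinuousOn f (sphere 0 1)) (q : ℝ≥0∞) :
          MemLp f q (sphMeasure n) := by
        obtain ⟨C, hC⟩ := (isCompact_sphere (0 : Eu n) 1).exists_bound_of_continuousOn hf
        refine MemLp.of_bound (integrable_sphMeasure_of_continuousOn hf).aestronglyMeasurable C ?_
        filter_upwards [ae_sphMeasure_mem n] with x hx using hC x hx
      have h := integral_mul_le_Lp_mul_Lq_of_nonneg hpq (μ := sphMeasure n)
        (f := fun x => w x ^ (n - 2)) (g := fun x => (t x)⁻¹ ^ 2)
        (by filter_upwards [ae_sphMeasure_norm n] with x hx using pow_nonneg (hw.pos hx).le _)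
        (by filter_upwards [ae_sphMeasure_norm n] with x hx using sq_nonneg _)
        (hmem hcw.continuousOn _) (hmem hct _)
      have e1 : ∫ x, (w x ^ (n - 2)) ^ ((n : ℝ) / (n - 2)) ∂sphMeasure n = confVol n w := by
        rw [confVol_eq hw]
        refine integral_congr_ae ?_
        filter_upwards [ae_sphMeasure_norm n] with x hx
        rw [← Real.rpow_natCast, ← Real.rpow_mul (hw.pos hx).le, Nat.cast_sub hn, Nat.cast_ofNat,
          mul_div_cancel₀ _ (by linarith), Real.rpow_natCast]
      have e2 : ∫ x, ((t x)⁻¹ ^ 2) ^ ((n : ℝ) / 2) ∂sphMeasure n =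
          ∫ x, (t x)⁻¹ ^ n ∂sphMeasure n := by
        refine integral_congr_ae ?_
        filter_upwards [ae_sphMeasure_norm n] with x hx
        rw [← Real.rpow_natCast, ← Real.rpow_mul (inv_nonneg.2 (htpos x hx).le), Nat.cast_ofNat,
          mul_div_cancel₀ _ two_ne_zero, Real.rpow_natCast]
      rw [e1, e2] at h
      convert h using 3
      · field_simp
      · field_simp
  have hlt : (∫ x, (t x)⁻¹ ^ n ∂sphMeasure n) ^ ((2 : ℝ) / n) < B ^ ((2 : ℝ) / n) :=
    Real.rpow_lt_rpow h_int hB (by positivity)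
  have hV := Real.rpow_pos_of_pos (confVol_pos hw) (1 - (2 : ℝ) / n)
  calc ∫ x, w x ^ (n - 2) * (n / t x ^ 2) ∂sphMeasure n
      = n * ∫ x, w x ^ (n - 2) * (t x)⁻¹ ^ 2 ∂sphMeasure n := by
        rw [← integral_const_mul]
        refine integral_congr_ae (ae_of_all _ fun x => ?_)
        simp only [inv_pow, div_eq_mul_inv]
        ring
    _ ≤ n * (confVol n w ^ (1 - (2 : ℝ) / n) *
          (∫ x, (t x)⁻¹ ^ n ∂sphMeasure n) ^ ((2 : ℝ) / n)) := by gcongr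
    _ < n * (confVol n w ^ (1 - (2 : ℝ) / n) * B ^ ((2 : ℝ) / n)) := by gcongr
    _ = _ := by ring

end ConformalMeasure

section QuadraticForms

lemma quadratic_pos {A B C : ℝ} (hA : 0 < A) (h : B ^ 2 < A * C) {a b : ℝ}
    (hab : ¬(a = 0 ∧ b = 0)) : 0 < a ^ 2 * A + 2 * (a * b) * B + b ^ 2 * C := by
  refine pos_of_mul_pos_right ?_ hA.le
  have h1 : A * (a ^ 2 * A + 2 * (a * b) * B + b ^ 2 * C) =
      (a * A + b * B) ^ 2 + b ^ 2 * (A * C - B ^ 2) := by ring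
  rw [h1]
  rcases eq_or_ne b 0 with rfl | hb
  · have ha : a ≠ 0 := fun ha => hab ⟨ha, rfl⟩
    simp only [zero_mul, add_zero, ne_eq, OfNat.ofNat_ne_zero, not_false_eq_true, zero_pow]
    positivity
  · have h2 : 0 < A * C - B ^ 2 := sub_pos.2 h
    positivity

lemma sq_le_of_quadratic_nonneg {A B C : ℝ}
    (h : ∀ a b : ℝ, 0 ≤ a ^ 2 * A + 2 * (a * b) * B + b ^ 2 * C) : B ^ 2 ≤ A * C := by
  have h1 : discrim A (2 * B) C ≤ 0 :=
    discrim_le_zero fun x => by have := h x 1; linarith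
  rw [discrim] at h1
  linarith

variable {n : ℕ} {w f g : Eu n → ℝ}

/-- The polar form of `dirichlet`. -/
def dirForm (n : ℕ) (w f g : Eu n → ℝ) : ℝ :=
  ∫ x, w x ^ (n - 2) * ⟪gradS f x, gradS g x⟫ ∂sphMeasure n

/-- The polar form of `l2sq`. -/
def l2Form (n : ℕ) (w f g : Eu n → ℝ) : ℝ := ∫ x, f x * g x ∂confMeasure n w

lemma l2sq_nonneg : 0 ≤ l2sq n w f := integral_nonneg fun _ => sq_nonneg _

lemma dirichlet_nonneg (hw : IsConformalFactor n w) : 0 ≤ dirichlet n w f := by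
  refine integral_nonneg_of_ae ?_
  filter_upwards [ae_sphMeasure_norm n] with x hx
  exact mul_nonneg (pow_nonneg (hw.pos hx).le _) (sq_nonneg _)

lemma dirichlet_comb (hw : IsConformalFactor n w) (hf : ContDiff ℝ (⊤ : ℕ∞) f)
    (hg : ContDiff ℝ (⊤ : ℕ∞) g) (a b : ℝ) :
    dirichlet n w (fun x => a * f x + b * g x) =
      a ^ 2 * dirichlet n w f + 2 * (a * b) * dirForm n w f g + b ^ 2 * dirichlet n w g := by
  have hwc := hw.continuous
  have hfc := continuous_gradS hf
  have hgc := continuous_gradS hg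
  have h (x : Eu n) : w x ^ (n - 2) * ‖gradS (fun x => a * f x + b * g x) x‖ ^ 2 =
      a ^ 2 * (w x ^ (n - 2) * ‖gradS f x‖ ^ 2) +
        2 * (a * b) * (w x ^ (n - 2) * ⟪gradS f x, gradS g x⟫) +
        b ^ 2 * (w x ^ (n - 2) * ‖gradS g x‖ ^ 2) := by
    rw [gradS_comb (hf.differentiable (by simp) x) (hg.differentiable (by simp) x),
      norm_add_sq_real, inner_smul_right, real_inner_smul_left, norm_smul, norm_smul, mul_pow,
      mul_pow, Real.norm_eq_abs, Real.norm_eq_abs, sq_abs, sq_abs]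
    ring
  have i1 := (integrable_sphMeasure_of_continuous (n := n)
    (f := fun x => w x ^ (n - 2) * ‖gradS f x‖ ^ 2) (by fun_prop)).const_mul (a ^ 2)
  have i2 := (integrable_sphMeasure_of_continuous (n := n)
    (f := fun x => w x ^ (n - 2) * (⟪gradS f x, gradS g x⟫ : ℝ))
    (by fun_prop)).const_mul (2 * (a * b))
  have i3 := (integrable_sphMeasure_of_continuous (n := n)
    (f := fun x => w x ^ (n - 2) * ‖gradS g x‖ ^ 2) (by fun_prop)).const_mul (b ^ 2)
  simp only [dirichlet, dirForm, h]
  have i12 : Integrable (fun x => a ^ 2 * (w x ^ (n - 2) * ‖gradS f x‖ ^ 2) +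
      2 * (a * b) * (w x ^ (n - 2) * ⟪gradS f x, gradS g x⟫)) (sphMeasure n) := i1.add i2
  rw [integral_add i12 i3, integral_add i1 i2, integral_const_mul, integral_const_mul,
    integral_const_mul]

lemma l2sq_comb (hw : IsConformalFactor n w) (hf : Continuous f) (hg : Continuous g) (a b : ℝ) :
    l2sq n w (fun x => a * f x + b * g x) =
      a ^ 2 * l2sq n w f + 2 * (a * b) * l2Form n w f g + b ^ 2 * l2sq n w g := by
  have h (x : Eu n) : (a * f x + b * g x) ^ 2 =
      a ^ 2 * f x ^ 2 + 2 * (a * b) * (f x * g x) + b ^ 2 * g x ^ 2 := by ring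
  have i1 := (integrable_confMeasure_of_continuous hw
    (f := fun x => f x ^ 2) (by fun_prop)).const_mul (a ^ 2)
  have i2 := (integrable_confMeasure_of_continuous hw
    (f := fun x => f x * g x) (by fun_prop)).const_mul (2 * (a * b))
  have i3 := (integrable_confMeasure_of_continuous hw
    (f := fun x => g x ^ 2) (by fun_prop)).const_mul (b ^ 2)
  simp only [l2sq, l2Form, h]
  have i12 : Integrable (fun x => a ^ 2 * f x ^ 2 + 2 * (a * b) * (f x * g x))
      (confMeasure n w) := i1.add i2
  rw [integral_add i12 i3, integral_add i1 i2, integral_const_mul, integral_const_mul,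
    integral_const_mul]

lemma meanZero_comb (hw : IsConformalFactor n w) (hf : Continuous f) (hg : Continuous g)
    (hf0 : MeanZero n w f) (hg0 : MeanZero n w g) (a b : ℝ) :
    MeanZero n w fun x => a * f x + b * g x := by
  rw [MeanZero, integral_add ((integrable_confMeasure_of_continuous hw hf).const_mul a)
    ((integrable_confMeasure_of_continuous hw hg).const_mul b), integral_const_mul,
    integral_const_mul, hf0, hg0]
  simp

/-- Two test functions on whose span `dirichlet < M * l2sq` bound the second eigenvalue. -/
lemma lambda2_le (hw : IsConformalFactor n w) {M : ℝ} (hf : ContDiff ℝ (⊤ : ℕ∞) f)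
    (hg : ContDiff ℝ (⊤ : ℕ∞) g) (hf0 : MeanZero n w f) (hg0 : MeanZero n w g)
    (hA : 0 < M * l2sq n w f - dirichlet n w f)
    (hB : (M * l2Form n w f g - dirForm n w f g) ^ 2 <
      (M * l2sq n w f - dirichlet n w f) * (M * l2sq n w g - dirichlet n w g)) :
    lambda2 n w ≤ M := by
  have hM : 0 ≤ M := by
    by_contra! h
    nlinarith [l2sq_nonneg (n := n) (w := w) (f := f), dirichlet_nonneg (f := f) hw]
  have key (a b : ℝ) (hab : ¬(a = 0 ∧ b = 0)) :
      dirichlet n w (fun x => a * f x + b * g x) <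
        M * l2sq n w (fun x => a * f x + b * g x) := by
    rw [dirichlet_comb hw hf hg, l2sq_comb hw hf.continuous hg.continuous]
    linarith [quadratic_pos hA hB hab]
  have hratio (a b : ℝ) : 0 ≤ dirichlet n w (fun x => a * f x + b * g x) /
      l2sq n w (fun x => a * f x + b * g x) :=
    div_nonneg (dirichlet_nonneg hw) l2sq_nonneg
  have hle : sSup { q : ℝ | ∃ a b : ℝ, ¬(a = 0 ∧ b = 0) ∧
      q = dirichlet n w (fun x => a * f x + b * g x) /
          l2sq n w (fun x => a * f x + b * g x) } ≤ M := by
    refine csSup_le ⟨_, 1, 0, by simp, rfl⟩ ?_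
    rintro q ⟨a, b, hab, rfl⟩
    refine div_le_of_le_mul₀ l2sq_nonneg hM (key a b hab).le
  refine le_trans (csInf_le ⟨0, ?_⟩ ⟨f, g, hf, hg, hf0, hg0, ?_, rfl⟩) hle
  · rintro Λ ⟨V, W, -, -, -, -, -, rfl⟩
    refine Real.sSup_nonneg ?_
    rintro q ⟨a, b, -, rfl⟩
    exact div_nonneg (dirichlet_nonneg hw) l2sq_nonneg
  · intro a b h
    by_contra hab
    have h1 := key a b hab
    have h2 : l2sq n w (fun x => a * f x + b * g x) = 0 := by
      refine integral_eq_zero_of_ae ?_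
      filter_upwards [ae_confMeasure_norm (n := n) (w := w)] with x hx
      simp [h x (by simpa [sphSet] using hx)]
    rw [h2, mul_zero] at h1
    exact h1.not_ge (dirichlet_nonneg hw)

end QuadraticForms

section MinimizingSequence

variable {n : ℕ} {w : Eu n → ℝ}

lemma meanZero_sub_average (hw : IsConformalFactor n w) {f : Eu n → ℝ} (hf : Continuous f) :
    MeanZero n w fun x => f x - (∫ z, f z ∂confMeasure n w) / confVol n w := by
  have := isFiniteMeasure_confMeasure hw
  rw [MeanZero, integral_sub (integrable_confMeasure_of_continuous hw hf) (integrable_const _),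
    integral_const, smul_eq_mul, sub_eq_zero]
  exact (mul_div_cancel₀ _ (confVol_pos hw).ne').symm

lemma exists_meanZero_l2sq_pos (hw : IsConformalFactor n w) :
    ∃ f : Eu n → ℝ, ContDiff ℝ (⊤ : ℕ∞) f ∧ MeanZero n w f ∧ 0 < l2sq n w f := by
  have hc : ContDiff ℝ (⊤ : ℕ∞) fun x : Eu n => x 0 := by fun_prop
  set c := (∫ z : Eu n, z 0 ∂confMeasure n w) / confVol n w
  have hfc : Continuous fun x : Eu n => x 0 - c := by fun_prop
  refine ⟨fun x => x 0 - c, by fun_prop, meanZero_sub_average hw hc.continuous, ?_⟩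
  rw [l2sq, integral_pos_iff_support_of_nonneg (fun x => sq_nonneg _)
    (integrable_confMeasure_of_continuous hw (hfc.pow 2))]
  refine confMeasure_open_inter_pos hw (hfc.pow 2).isOpen_support ?_
  have hs : e1 n ∈ sphere (0 : Eu n) 1 := by simp [e1]
  by_cases h : (1 : ℝ) - c = 0
  · refine ⟨-e1 n, ?_, by simpa using hs⟩
    have : (-1 : ℝ) - c ≠ 0 := by linarith
    simpa [e1] using this
  · refine ⟨e1 n, ?_, hs⟩
    simpa [e1] using h

lemma exists_minimizing_sequence (hw : IsConformalFactor n w) :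
    ∃ lam : ℝ, 0 ≤ lam ∧
      (∀ f : Eu n → ℝ, ContDiff ℝ (⊤ : ℕ∞) f → MeanZero n w f →
        lam * l2sq n w f ≤ dirichlet n w f) ∧
      ∃ φ : ℕ → Eu n → ℝ, (∀ j, ContDiff ℝ (⊤ : ℕ∞) (φ j)) ∧ (∀ j, MeanZero n w (φ j)) ∧
        (∀ j, l2sq n w (φ j) = 1) ∧ Tendsto (fun j => dirichlet n w (φ j)) atTop (𝓝 lam) := by
  set A : Set ℝ := {q | ∃ f : Eu n → ℝ, ContDiff ℝ (⊤ : ℕ∞) f ∧ MeanZero n w f ∧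
    l2sq n w f = 1 ∧ q = dirichlet n w f} with hA
  have hnorm (f : Eu n → ℝ) (hf : ContDiff ℝ (⊤ : ℕ∞) f) (hf0 : MeanZero n w f)
      (hpos : 0 < l2sq n w f) : dirichlet n w f / l2sq n w f ∈ A := by
    set c := (√(l2sq n w f))⁻¹
    have hc : c ^ 2 * l2sq n w f = 1 := by
      rw [inv_pow, Real.sq_sqrt hpos.le, inv_mul_cancel₀ hpos.ne']
    refine ⟨fun x => c * f x + 0 * f x, by fun_prop,
      meanZero_comb hw hf.continuous hf.continuous hf0 hf0 c 0, ?_, ?_⟩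
    · rw [l2sq_comb hw hf.continuous hf.continuous]; simpa using hc
    · rw [dirichlet_comb hw hf hf, div_eq_iff hpos.ne']
      linear_combination -dirichlet n w f * hc
  have hne : A.Nonempty := by
    obtain ⟨f, h1, h2, h3⟩ := exists_meanZero_l2sq_pos hw
    exact ⟨_, hnorm f h1 h2 h3⟩
  have hbdd : ∀ q ∈ A, 0 ≤ q := by
    rintro q ⟨f, -, -, -, rfl⟩
    exact dirichlet_nonneg hw
  obtain ⟨q, -, hqlim, hqA⟩ := exists_seq_tendsto_sInf hne ⟨0, hbdd⟩
  choose φ h1 h2 h3 h4 using hqA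
  refine ⟨sInf A, Real.sInf_nonneg hbdd, fun f hf hf0 => ?_, φ, h1, h2, h3, ?_⟩
  · rcases (l2sq_nonneg (n := n) (w := w) (f := f)).eq_or_lt with h | h
    · rw [← h, mul_zero]; exact dirichlet_nonneg hw
    · rw [← le_div_iff₀ h]
      exact csInf_le ⟨0, hbdd⟩ (hnorm f hf hf0 h)
  · exact hqlim.congr h4

end MinimizingSequence

section CauchySchwarz

variable {X : Type*} [MeasurableSpace X] {μ : Measure X}

lemma sq_integral_mul_le {f g : X → ℝ} (hf : Integrable (fun x => f x ^ 2) μ)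
    (hfg : Integrable (fun x => f x * g x) μ) (hg : Integrable (fun x => g x ^ 2) μ) :
    (∫ x, f x * g x ∂μ) ^ 2 ≤ (∫ x, f x ^ 2 ∂μ) * ∫ x, g x ^ 2 ∂μ := by
  refine sq_le_of_quadratic_nonneg fun a b => ?_
  have i12 : Integrable (fun x => a ^ 2 * f x ^ 2 + 2 * (a * b) * (f x * g x)) μ :=
    (hf.const_mul _).add (hfg.const_mul _)
  rw [← integral_const_mul, ← integral_const_mul, ← integral_const_mul,
    ← integral_add (hf.const_mul _) (hfg.const_mul _), ← integral_add i12 (hg.const_mul _)]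
  refine integral_nonneg fun x => ?_
  have : a ^ 2 * f x ^ 2 + 2 * (a * b) * (f x * g x) + b ^ 2 * g x ^ 2 =
      (a * f x + b * g x) ^ 2 := by ring
  simp only [this, Pi.zero_apply]
  positivity

lemma tendsto_integral_smul_of_bounded [IsFiniteMeasure μ] {V : Type*} [NormedAddCommGroup V]
    [NormedSpace ℝ V] {φ : ℕ → X → ℝ} (hφ : ∀ j, Integrable (φ j) μ)
    (hφ2 : ∀ j, Integrable (fun x => φ j x ^ 2) μ) (hφ1 : ∀ j, ∫ x, φ j x ^ 2 ∂μ = 1)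
    {u : ℕ → X → V} {u₀ : X → V} (hu : ∀ j, AEStronglyMeasurable (u j) μ)
    (hu₀ : AEStronglyMeasurable u₀ μ) (h1 : ∀ j, ∀ᵐ x ∂μ, ‖u j x‖ = 1)
    (h0 : ∀ᵐ x ∂μ, ‖u₀ x‖ = 1) (hlim : ∀ᵐ x ∂μ, Tendsto (fun j => u j x) atTop (𝓝 (u₀ x)))
    (hz : ∀ j, ∫ x, φ j x • u j x ∂μ = 0) :
    Tendsto (fun j => ∫ x, φ j x • u₀ x ∂μ) atTop (𝓝 0) := by
  have hd : Tendsto (fun j => ∫ x, ‖u₀ x - u j x‖ ^ 2 ∂μ) atTop (𝓝 0) := by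
    rw [← integral_zero X ℝ (μ := μ)]
    refine tendsto_integral_of_dominated_convergence (fun _ => 4)
      (fun j => ((hu₀.sub (hu j)).norm.pow 2)) (integrable_const _) (fun j => ?_) ?_
    · filter_upwards [h1 j, h0] with x hx hx0
      have := norm_sub_le (u₀ x) (u j x)
      rw [norm_pow, norm_norm]
      nlinarith [norm_nonneg (u₀ x - u j x)]
    · filter_upwards [hlim] with x hx
      simpa using ((tendsto_const_nhds (x := u₀ x)).sub hx).norm.pow 2
  have hi {v : X → V} (j : ℕ) (hv : AEStronglyMeasurable v μ) (hv1 : ∀ᵐ x ∂μ, ‖v x‖ = 1) :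
      Integrable (fun x => φ j x • v x) μ := by
    refine (hφ j).norm.mono' ((hφ j).1.smul hv) ?_
    filter_upwards [hv1] with x hx
    rw [norm_smul, hx, mul_one]
  refine squeeze_zero_norm (fun j => ?_) (by simpa using hd.sqrt)
  have heq : ∫ x, φ j x • u₀ x ∂μ = ∫ x, φ j x • (u₀ x - u j x) ∂μ := by
    simp only [smul_sub]
    rw [integral_sub (hi j hu₀ h0) (hi j (hu j) (h1 j)), hz, sub_zero]
  have hdi : AEStronglyMeasurable (fun x => ‖u₀ x - u j x‖) μ := (hu₀.sub (hu j)).norm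
  have hle : ∀ᵐ x ∂μ, ‖u₀ x - u j x‖ ≤ 2 := by
    filter_upwards [h1 j, h0] with x hx hx0
    linarith [norm_sub_le (u₀ x) (u j x)]
  have h2 : Integrable (fun x => ‖φ j x‖ * ‖u₀ x - u j x‖) μ := by
    refine ((hφ j).norm.mul_const 2).mono' ((hφ j).1.norm.mul hdi) ?_
    filter_upwards [hle] with x hx
    rw [norm_mul, norm_norm, norm_norm]
    gcongr
  have h3 : Integrable (fun x => ‖u₀ x - u j x‖ ^ 2) μ := by
    refine (integrable_const (4 : ℝ)).mono' (hdi.pow 2) ?_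
    filter_upwards [hle] with x hx
    rw [norm_pow, norm_norm]
    nlinarith [norm_nonneg (u₀ x - u j x)]
  rw [heq]
  refine (norm_integral_le_integral_norm _).trans (Real.le_sqrt_of_sq_le ?_)
  have h4 := sq_integral_mul_le (f := fun x => ‖φ j x‖) (by simpa using hφ2 j) h2 h3
  simpa only [norm_smul, Real.norm_eq_abs, sq_abs, hφ1, one_mul] using h4

end CauchySchwarz

section LimitMap

variable {n : ℕ} {w : Eu n → ℝ}

/-- A sequence of weights is asymptotically orthogonal to some renormalized folded map. -/
lemma exists_foldMap_tendsto_integral (hn : 2 ≤ n) (hw : IsConformalFactor n w)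
    {φ : ℕ → Eu n → ℝ} (hφ : ∀ j, Continuous (φ j)) (hφ1 : ∀ j, l2sq n w (φ j) = 1) :
    ∃ k ∈ Icc (0 : ℝ) 1, ∃ p : Eu n, ‖p‖ = 1 ∧ ∃ y : Eu n,
      ∫ x, confBoost y (foldMap k p x) ∂confMeasure n w = 0 ∧
      ∃ s : ℕ → ℕ, StrictMono s ∧
        Tendsto (fun j => ∫ x, φ (s j) x • confBoost y (foldMap k p x) ∂confMeasure n w) atTop
          (𝓝 0) := by
  have := isFiniteMeasure_confMeasure hw
  set μ := confMeasure n w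
  have hμ : μ ≠ 0 := confMeasure_ne_zero hw
  have hμS : ∀ᵐ x ∂μ, ‖x‖ = 1 := ae_confMeasure_norm
  have hμW : ∀ p e : Eu n, μ (Submodule.span ℝ {p, e} : Set (Eu n)) = 0 :=
    confMeasure_span_pair hn
  have hφi (j : ℕ) : Integrable (φ j) μ := integrable_confMeasure_of_continuous hw (hφ j)
  choose k hk p hp y hy hz using fun j => exists_foldMap_integral_eq_zero hμ hμS hμW (hφi j)
  obtain ⟨⟨k₀, p₀⟩, hmem, s, hs, hlim⟩ :=
    ((isCompact_Icc (a := (0 : ℝ)) (b := 1)).prod (isCompact_sphere (0 : Eu n) 1)).tendsto_subseq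
      (x := fun j => (k j, p j)) fun j => ⟨hk j, by simpa using hp j⟩
  have hk₀ : k₀ ∈ Icc (0 : ℝ) 1 := hmem.1
  have hp₀ : ‖p₀‖ = 1 := by simpa using hmem.2
  have hkk : Tendsto (fun j => k (s j)) atTop (𝓝 k₀) := (continuous_fst.tendsto _).comp hlim
  have hpp : Tendsto (fun j => p (s j)) atTop (𝓝 p₀) := (continuous_snd.tendsto _).comp hlim
  have hm {k : ℝ} (hk : k ∈ Icc (0 : ℝ) 1) {p : Eu n} (hp : ‖p‖ = 1) (y : Eu n) :
      AEStronglyMeasurable (fun x => confBoost y (foldMap k p x)) μ :=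
    aestronglyMeasurable_confBoost (aestronglyMeasurable_foldMap hμS hk hp) y
  have hone {k : ℝ} (hk : k ∈ Icc (0 : ℝ) 1) {p : Eu n} (hp : ‖p‖ = 1) (y : Eu n) :
      ∀ᵐ x ∂μ, ‖confBoost y (foldMap k p x)‖ = 1 := by
    filter_upwards [ae_norm_foldMap hμS hk hp] with x hx using norm_confBoost y hx
  obtain ⟨y₀, hy₀⟩ := exists_isHerschMin hμ (aestronglyMeasurable_foldMap hμS hk₀ hp₀)
    (ae_norm_foldMap hμS hk₀ hp₀) (ae_foldMap_ne hμS hμW hk₀ hp₀)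
  refine ⟨k₀, hk₀, p₀, hp₀, y₀, hy₀.integral_confBoost
    (aestronglyMeasurable_foldMap hμS hk₀ hp₀) (ae_norm_foldMap hμS hk₀ hp₀), s, hs, ?_⟩
  exact tendsto_integral_smul_of_bounded (fun j => hφi (s j))
    (fun j => integrable_confMeasure_of_continuous hw ((hφ (s j)).pow 2)) (fun j => hφ1 (s j))
    (fun j => hm (hk (s j)) (hp (s j)) (y (s j))) (hm hk₀ hp₀ y₀)
    (fun j => hone (hk (s j)) (hp (s j)) (y (s j))) (hone hk₀ hp₀ y₀)
    (tendsto_isHerschMin_foldMap hμ hμS hμW (fun j => hk (s j)) (fun j => hp (s j)) hk₀ hp₀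
      hkk hpp (fun j => hy (s j)) hy₀) (fun j => hz (s j))

end LimitMap

section Gap

variable {n : ℕ} {w : Eu n → ℝ}

/-- Smooth approximation, in energy, of a balanced folded map. -/
lemma exists_meanZero_smooth_approx (hn : 2 ≤ n) (hw : IsConformalFactor n w) {k : ℝ}
    (hk : k ∈ Icc (0 : ℝ) 1) {p : Eu n} (hp : ‖p‖ = 1) (y : Eu n)
    (hz : ∫ x, confBoost y (foldMap k p x) ∂confMeasure n w = 0) :
    ∃ ψ : ℕ → Fin (n + 1) → Eu n → ℝ, (∀ j i, ContDiff ℝ (⊤ : ℕ∞) (ψ j i)) ∧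
      (∀ j i, MeanZero n w (ψ j i)) ∧
      (∀ i, Tendsto (fun j => ∫ x, (ψ j i x - confBoost y (foldMap k p x) i) ^ 2
        ∂confMeasure n w) atTop (𝓝 0)) ∧
      Tendsto (fun j => ∑ i, l2sq n w (ψ j i)) atTop (𝓝 (confVol n w)) ∧
      Tendsto (fun j => ∑ i, dirichlet n w (ψ j i)) atTop
        (𝓝 (∫ x, w x ^ (n - 2) * (n / foldTime k p y x ^ 2) ∂sphMeasure n)) := by
  have := isFiniteMeasure_confMeasure hw
  obtain ⟨U, hU, ⟨C, hC⟩, hlim, hgrad⟩ := exists_smooth_approx_confBoost_foldMap hk hp y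
  set μ := confMeasure n w with hμdef
  set u : Eu n → Eu n := fun x => confBoost y (foldMap k p x) with hu
  have hμS : ∀ᵐ x ∂μ, ‖x‖ = 1 := ae_confMeasure_norm
  have hu1 : ∀ᵐ x ∂μ, ‖u x‖ = 1 := by
    filter_upwards [ae_norm_foldMap hμS hk hp] with x hx using norm_confBoost y hx
  have hum : AEStronglyMeasurable u μ :=
    aestronglyMeasurable_confBoost (aestronglyMeasurable_foldMap hμS hk hp) y
  have hui (i) : AEStronglyMeasurable (fun x => u x i) μ :=
    (EuclideanSpace.proj (𝕜 := ℝ) i).continuous.comp_aestronglyMeasurable hum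
  have hUi (j i) : ContDiff ℝ (⊤ : ℕ∞) fun x => U j x i :=
    (EuclideanSpace.proj (𝕜 := ℝ) i).contDiff.comp (hU j)
  have hzi (i) : ∫ x, u x i ∂μ = 0 := by
    have h := (EuclideanSpace.proj (𝕜 := ℝ) i).integral_comp_comm
      (integrable_confBoost (aestronglyMeasurable_foldMap hμS hk hp)
        (ae_norm_foldMap hμS hk hp) y)
    rw [hz, map_zero] at h
    exact h
  have hlimi {x : Eu n} (hx : ‖x‖ = 1) (i) : Tendsto (fun j => U j x i) atTop (𝓝 (u x i)) :=
    ((EuclideanSpace.proj (𝕜 := ℝ) i).continuous.tendsto _).comp (hlim x hx)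
  have hbd {x : Eu n} (hx : ‖x‖ = 1) (j i) : |U j x i| ≤ C :=
    (PiLp.norm_apply_le (U j x) i).trans (hC j x hx).1
  set m : ℕ → Fin (n + 1) → ℝ := fun j i => (∫ z, U j z i ∂μ) / confVol n w with hm
  have hm0 (i) : Tendsto (fun j => m j i) atTop (𝓝 0) := by
    have h : Tendsto (fun j => ∫ z, U j z i ∂μ) atTop (𝓝 (∫ x, u x i ∂μ)) := by
      refine tendsto_integral_of_dominated_convergence (fun _ => C)
        (fun j => (hUi j i).continuous.aestronglyMeasurable) (integrable_const _) (fun j => ?_) ?_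
      · filter_upwards [hμS] with x hx using hbd hx j i
      · filter_upwards [hμS] with x hx using hlimi hx i
    rw [hzi] at h
    simpa using h.div_const (confVol n w)
  have hmb (i) : ∃ D, ∀ j, |m j i| ≤ D := by
    obtain ⟨D, hD⟩ := (hm0 i).norm.bddAbove_range
    exact ⟨D, fun j => hD ⟨j, rfl⟩⟩
  choose D hD using hmb
  refine ⟨fun j i x => U j x i - m j i, fun j i => (hUi j i).sub contDiff_const,
    fun j i => meanZero_sub_average hw (hUi j i).continuous, fun i => ?_, ?_, ?_⟩
  · rw [← integral_zero (Eu n) ℝ (μ := μ)]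
    refine tendsto_integral_of_dominated_convergence (fun _ => (C + D i + 1) ^ 2)
      (fun j => ((((hUi j i).continuous.sub continuous_const).aestronglyMeasurable).sub
        (hui i)).pow 2) (integrable_const _) (fun j => ?_) ?_
    · filter_upwards [hμS, hu1] with x hx hux
      rw [norm_pow, Real.norm_eq_abs]
      have h1 := abs_le.1 (hbd hx j i)
      have h2 := abs_le.1 (hD i j)
      have h3 := abs_le.1 ((PiLp.norm_apply_le (u x) i).trans hux.le)
      refine pow_le_pow_left₀ (abs_nonneg _) (abs_le.2 ⟨?_, ?_⟩) 2 <;> linarith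
    · filter_upwards [hμS] with x hx
      simpa using (((hlimi hx i).sub (hm0 i)).sub_const (u x i)).pow 2
  · have hi (i) : Tendsto (fun j => l2sq n w (fun x => U j x i - m j i)) atTop
        (𝓝 (∫ x, u x i ^ 2 ∂μ)) := by
      refine tendsto_integral_of_dominated_convergence (fun _ => (C + D i) ^ 2)
        (fun j => (((hUi j i).continuous.sub continuous_const).aestronglyMeasurable).pow 2)
        (integrable_const _) (fun j => ?_) ?_
      · filter_upwards [hμS] with x hx
        rw [norm_pow, Real.norm_eq_abs]
        have h1 := abs_le.1 (hbd hx j i)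
        have h2 := abs_le.1 (hD i j)
        refine pow_le_pow_left₀ (abs_nonneg _) (abs_le.2 ⟨?_, ?_⟩) 2 <;> linarith
      · filter_upwards [hμS] with x hx
        simpa using ((hlimi hx i).sub (hm0 i)).pow 2
    have hsum : ∑ i, ∫ x, u x i ^ 2 ∂μ = confVol n w := by
      rw [← integral_finsetSum]
      · have h : ∀ᵐ x ∂μ, ∑ i, u x i ^ 2 = 1 := by
          filter_upwards [hu1] with x hx
          rw [← EuclideanSpace.real_norm_sq_eq, hx, one_pow]
        rw [integral_congr_ae h, integral_const, smul_eq_mul, mul_one]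
        rfl
      · intro i _
        refine (integrable_const (1 : ℝ)).mono' ((hui i).pow 2) ?_
        filter_upwards [hu1] with x hx
        rw [norm_pow]
        exact pow_le_one₀ (norm_nonneg _) ((PiLp.norm_apply_le (u x) i).trans hx.le)
    rw [← hsum]
    exact tendsto_finsetSum _ fun i _ => hi i
  · have hwc := hw.continuous
    have hgc (j i) := continuous_gradS (hUi j i)
    have heq (j) : ∑ i, dirichlet n w (fun x => U j x i - m j i) =
        ∫ x, w x ^ (n - 2) * ∑ i, ‖gradS (fun z => U j z i) x‖ ^ 2 ∂sphMeasure n := by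
      simp only [dirichlet, gradS_sub_const, Finset.mul_sum]
      rw [integral_finsetSum]
      intro i _
      have := hgc j i
      exact integrable_sphMeasure_of_continuous (by fun_prop)
    simp only [heq]
    refine tendsto_integral_of_dominated_convergence (fun x => w x ^ (n - 2) * C)
      (fun j => Continuous.aestronglyMeasurable ?_)
      (integrable_sphMeasure_of_continuous (by fun_prop)) (fun j => ?_) ?_
    · have := hgc j
      fun_prop
    · filter_upwards [ae_sphMeasure_norm n] with x hx
      have hwx := (hw.pos hx).le
      rw [norm_mul, norm_pow, Real.norm_of_nonneg hwx,
        Real.norm_of_nonneg (Finset.sum_nonneg fun i _ => sq_nonneg _)]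
      exact mul_le_mul_of_nonneg_left (hC j x hx).2 (pow_nonneg hwx _)
    · have hsl : ∀ᵐ x ∂sphMeasure n, ⟪p, x⟫ + k ≠ 0 := by
        rw [ae_iff]
        simpa using sphMeasure_slice hn hk hp
      filter_upwards [ae_sphMeasure_norm n, hsl] with x hx hxs
      exact (hgrad x hx hxs).const_mul _

/-- Test functions with a definite gap, close to a component of a balanced folded map. -/
lemma exists_gap (hn : 2 ≤ n) (hw : IsConformalFactor n w) {k : ℝ}
    (hk : k ∈ Icc (0 : ℝ) 1) {p : Eu n} (hp : ‖p‖ = 1) (y : Eu n)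
    (hz : ∫ x, confBoost y (foldMap k p x) ∂confMeasure n w = 0) {M : ℝ}
    (hM : ∫ x, w x ^ (n - 2) * (n / foldTime k p y x ^ 2) ∂sphMeasure n < M * confVol n w) :
    ∃ ε B : ℝ, 0 < ε ∧ ∀ η : ℝ, 0 < η → ∃ (ψ : Eu n → ℝ) (i : Fin (n + 1)),
      ContDiff ℝ (⊤ : ℕ∞) ψ ∧ MeanZero n w ψ ∧ ε ≤ M * l2sq n w ψ - dirichlet n w ψ ∧
      dirichlet n w ψ ≤ B ∧
      ∫ x, (ψ x - confBoost y (foldMap k p x) i) ^ 2 ∂confMeasure n w ≤ η := by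
  obtain ⟨ψ, h1, h2, h3, h4, h5⟩ := exists_meanZero_smooth_approx hn hw hk hp y hz
  set E := ∫ x, w x ^ (n - 2) * (n / foldTime k p y x ^ 2) ∂sphMeasure n
  set gap := M * confVol n w - E with hgap
  have hgap0 : 0 < gap := sub_pos.2 hM
  refine ⟨gap / 2 / (n + 1), E + 1, by positivity, fun η hη => ?_⟩
  have h6 : ∀ᶠ j in atTop, ∀ i, ∫ x, (ψ j i x - confBoost y (foldMap k p x) i) ^ 2
      ∂confMeasure n w < η :=
    eventually_all.2 fun i => (h3 i).eventually_lt_const hη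
  have h7 : ∀ᶠ j in atTop, gap / 2 <
      M * ∑ i, l2sq n w (ψ j i) - ∑ i, dirichlet n w (ψ j i) :=
    ((h4.const_mul M).sub h5).eventually_const_lt (by linarith)
  have h8 : ∀ᶠ j in atTop, ∑ i, dirichlet n w (ψ j i) < E + 1 :=
    h5.eventually_lt_const (by linarith)
  obtain ⟨j, h6, h7, h8⟩ := (h6.and (h7.and h8)).exists
  obtain ⟨i, -, hi⟩ : ∃ i ∈ Finset.univ, gap / 2 / (n + 1) <
      M * l2sq n w (ψ j i) - dirichlet n w (ψ j i) := by
    refine Finset.exists_lt_of_sum_lt ?_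
    rw [Finset.sum_sub_distrib, ← Finset.mul_sum, Finset.sum_const, Finset.card_univ,
      Fintype.card_fin, nsmul_eq_mul]
    refine lt_of_eq_of_lt ?_ h7
    push_cast
    field_simp
  refine ⟨ψ j i, i, h1 j i, h2 j i, hi.le, ?_, (h6 i).le⟩
  exact (Finset.single_le_sum (f := fun i => dirichlet n w (ψ j i))
    (fun i _ => dirichlet_nonneg hw) (Finset.mem_univ i)).trans h8.le

end Gap

section Main

variable {n : ℕ} {w : Eu n → ℝ}

/-- Cauchy–Schwarz for the form `dirichlet - lam * l2sq`, nonnegative on mean-zero functions. -/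
lemma sq_dirForm_sub_le (hw : IsConformalFactor n w) {lam : ℝ}
    (hlam : ∀ f : Eu n → ℝ, ContDiff ℝ (⊤ : ℕ∞) f → MeanZero n w f →
      lam * l2sq n w f ≤ dirichlet n w f)
    {f g : Eu n → ℝ} (hf : ContDiff ℝ (⊤ : ℕ∞) f) (hg : ContDiff ℝ (⊤ : ℕ∞) g)
    (hf0 : MeanZero n w f) (hg0 : MeanZero n w g) :
    (dirForm n w f g - lam * l2Form n w f g) ^ 2 ≤
      (dirichlet n w f - lam * l2sq n w f) * (dirichlet n w g - lam * l2sq n w g) := by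
  refine sq_le_of_quadratic_nonneg fun a b => ?_
  have h := hlam (fun x => a * f x + b * g x) (by fun_prop)
    (meanZero_comb hw hf.continuous hg.continuous hf0 hg0 a b)
  rw [l2sq_comb hw hf.continuous hg.continuous, dirichlet_comb hw hf hg] at h
  linarith

/-- The energy of a suitable balanced folded map bounds the second eigenvalue. -/
lemma exists_lambda2_le_energy (hn : 2 ≤ n) (hw : IsConformalFactor n w) :
    ∃ k ∈ Icc (0 : ℝ) 1, ∃ p : Eu n, ‖p‖ = 1 ∧ ∃ y : Eu n,
      lambda2 n w ≤
        (∫ x, w x ^ (n - 2) * (n / foldTime k p y x ^ 2) ∂sphMeasure n) / confVol n w := by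
  have := isFiniteMeasure_confMeasure hw
  obtain ⟨lam, hlam0, hlam, φ', hφ', hφ0', hφ1', hφlim'⟩ := exists_minimizing_sequence hw
  obtain ⟨k, hk, p, hp, y, hz, s, hs, hlim⟩ :=
    exists_foldMap_tendsto_integral hn hw (fun j => (hφ' j).continuous) hφ1'
  refine ⟨k, hk, p, hp, y, le_of_forall_gt_imp_ge_of_dense fun M hM => ?_⟩
  rw [div_lt_iff₀ (confVol_pos hw)] at hM
  obtain ⟨ε, B, hε, hψ⟩ := exists_gap hn hw hk hp y hz hM
  set μ := confMeasure n w with hμ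
  set φ : ℕ → Eu n → ℝ := fun j => φ' (s j) with hφdef
  have hφ (j) : ContDiff ℝ (⊤ : ℕ∞) (φ j) := hφ' (s j)
  have hφ0 (j) : MeanZero n w (φ j) := hφ0' (s j)
  have hφ1 (j) : l2sq n w (φ j) = 1 := hφ1' (s j)
  have hφlim : Tendsto (fun j => dirichlet n w (φ j)) atTop (𝓝 lam) :=
    hφlim'.comp hs.tendsto_atTop
  have hgap : lam < M := by
    obtain ⟨ψ, -, h1, h2, h3, -⟩ := hψ 1 one_pos
    have h4 := hlam ψ h1 h2
    by_contra! h
    nlinarith [l2sq_nonneg (n := n) (w := w) (f := ψ)]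
  set m := M - lam with hm
  have hm0 : 0 < m := sub_pos.2 hgap
  obtain ⟨ψ, i, h1, h2, h3, h4, h5⟩ := hψ (ε / (8 * m)) (by positivity)
  set u : Eu n → Eu n := fun x => confBoost y (foldMap k p x) with hu
  have hμS : ∀ᵐ x ∂μ, ‖x‖ = 1 := ae_confMeasure_norm
  have hu1 : ∀ᵐ x ∂μ, ‖u x‖ = 1 := by
    filter_upwards [ae_norm_foldMap hμS hk hp] with x hx using norm_confBoost y hx
  have hum : AEStronglyMeasurable u μ :=
    aestronglyMeasurable_confBoost (aestronglyMeasurable_foldMap hμS hk hp) y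
  have hui : AEStronglyMeasurable (fun x => u x i) μ :=
    (EuclideanSpace.proj (𝕜 := ℝ) i).continuous.comp_aestronglyMeasurable hum
  have hui1 : ∀ᵐ x ∂μ, ‖u x i‖ ≤ 1 := by
    filter_upwards [hu1] with x hx using (PiLp.norm_apply_le (u x) i).trans hx.le
  have hφi (j) : Integrable (φ j) μ :=
    integrable_confMeasure_of_continuous hw (hφ j).continuous
  have hφui (j) : Integrable (fun x => φ j x * u x i) μ :=
    (hφi j).mul_bdd hui hui1
  set c : ℕ → ℝ := fun j => ∫ x, φ j x * u x i ∂μ with hc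
  have hc0 : Tendsto c atTop (𝓝 0) := by
    have h : ∀ j, (∫ x, φ j x • u x ∂μ) i = c j := fun j => by
      have h_int : Integrable (fun x => φ j x • u x) μ := by
        refine (hφi j).norm.mono' ((hφi j).1.smul hum) ?_
        filter_upwards [hu1] with x hx
        rw [norm_smul, hx, mul_one]
      exact ((EuclideanSpace.proj (𝕜 := ℝ) i).integral_comp_comm h_int).symm
    have h' := ((EuclideanSpace.proj (𝕜 := ℝ) i).continuous.tendsto _).comp hlim
    rw [map_zero] at h'
    exact h'.congr h
  have hl2 (j) : l2Form n w (φ j) ψ ^ 2 ≤ 2 * (ε / (8 * m)) + 2 * c j ^ 2 := by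
    have hψi : Integrable (fun x => (ψ x - u x i) ^ 2) μ := by
      have e1 := integrable_confMeasure_of_continuous hw (h1.continuous.pow 2)
      have e2 := (integrable_confMeasure_of_continuous hw h1.continuous).mul_bdd hui hui1
      have e3 : Integrable (fun x => u x i ^ 2) μ := by
        refine (integrable_const (1 : ℝ)).mono' (hui.pow 2) ?_
        filter_upwards [hui1] with x hx
        rw [norm_pow]
        exact pow_le_one₀ (norm_nonneg _) hx
      refine ((e1.sub (e2.const_mul 2)).add e3).congr (ae_of_all _ fun x => ?_)
      simp only [Pi.add_apply, Pi.sub_apply, Pi.pow_apply]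
      ring
    have hφψ : Integrable (fun x => φ j x * ψ x) μ :=
      integrable_confMeasure_of_continuous hw ((hφ j).continuous.mul h1.continuous)
    have hd : Integrable (fun x => φ j x * (ψ x - u x i)) μ := by
      refine (hφψ.sub (hφui j)).congr (ae_of_all _ fun x => ?_)
      simp only [Pi.sub_apply]
      ring
    have hsplit : l2Form n w (φ j) ψ = ∫ x, φ j x * (ψ x - u x i) ∂μ + c j := by
      rw [hc, ← integral_add hd (hφui j), l2Form]
      refine integral_congr_ae (ae_of_all _ fun x => ?_)
      ring
    have hcs := sq_integral_mul_le (f := φ j)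
      (integrable_confMeasure_of_continuous hw ((hφ j).continuous.pow 2)) hd hψi
    have hφ1j : ∫ x, φ j x ^ 2 ∂μ = 1 := hφ1 j
    rw [hφ1j, one_mul] at hcs
    rw [hsplit]
    nlinarith [sq_nonneg (∫ x, φ j x * (ψ x - u x i) ∂μ - c j)]
  have hev : ∀ᶠ j in atTop,
      2 * m ^ 2 * (2 * (ε / (8 * m)) + 2 * c j ^ 2) + 2 * ((dirichlet n w (φ j) - lam) * B) <
        (M - dirichlet n w (φ j)) * ε := by
    refine Tendsto.eventually_lt (((((hc0.pow 2).const_mul 2).const_add _).const_mul _).add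
      (((hφlim.sub_const lam).mul_const B).const_mul 2)) ((hφlim.const_sub M).mul_const ε) ?_
    have : 2 * m ^ 2 * (2 * (ε / (8 * m)) + 2 * 0 ^ 2) + 2 * ((lam - lam) * B) = m * ε / 2 := by
      field_simp
      ring
    rw [this]
    nlinarith
  obtain ⟨j, hj, hjM⟩ := (hev.and (hφlim.eventually_lt_const hgap)).exists
  have hA : 0 < M * l2sq n w (φ j) - dirichlet n w (φ j) := by rw [hφ1]; linarith
  refine lambda2_le hw (hφ j) h1 (hφ0 j) h2 hA ?_
  have hq := sq_dirForm_sub_le hw hlam (hφ j) h1 (hφ0 j) h2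
  have hqj := hlam (φ j) (hφ j) (hφ0 j)
  rw [hφ1, mul_one] at hq hqj hA ⊢
  have hq2 : (dirForm n w (φ j) ψ - lam * l2Form n w (φ j) ψ) ^ 2 ≤
      (dirichlet n w (φ j) - lam) * B := by
    refine hq.trans (mul_le_mul_of_nonneg_left ?_ (by linarith))
    have := mul_nonneg hlam0 (l2sq_nonneg (n := n) (w := w) (f := ψ))
    linarith
  have hmul := mul_le_mul_of_nonneg_left (hl2 j) (sq_nonneg m)
  calc (M * l2Form n w (φ j) ψ - dirForm n w (φ j) ψ) ^ 2
      = (m * l2Form n w (φ j) ψ - (dirForm n w (φ j) ψ - lam * l2Form n w (φ j) ψ)) ^ 2 := by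
        rw [hm]; ring
    _ ≤ 2 * (m ^ 2 * l2Form n w (φ j) ψ ^ 2) +
        2 * (dirForm n w (φ j) ψ - lam * l2Form n w (φ j) ψ) ^ 2 := by
        nlinarith [sq_nonneg (m * l2Form n w (φ j) ψ +
          (dirForm n w (φ j) ψ - lam * l2Form n w (φ j) ψ))]
    _ < (M - dirichlet n w (φ j)) * ε := by linarith
    _ ≤ _ := mul_le_mul_of_nonneg_left h3 hA.le

theorem lambda2_mul_confVol_lt (hn : 2 ≤ n) (hw : IsConformalFactor n w) :
    lambda2 n w * confVol n w ^ ((2 : ℝ) / n) < n * (2 * sigmaVol n) ^ ((2 : ℝ) / n) := by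
  obtain ⟨k, hk, p, hp, y, hle⟩ := exists_lambda2_le_energy hn hw
  have hV := confVol_pos hw
  have h := integral_conformal_energy_lt hn hw (continuous_foldTime k p y)
    (fun x hx => foldTime_pos hk hp hx y) (integral_inv_foldTime_pow_lt hk hp y)
  rw [le_div_iff₀ hV] at hle
  have h1 := hle.trans_lt h
  rw [Real.rpow_sub hV, Real.rpow_one, mul_div_assoc', lt_div_iff₀ (by positivity)] at h1
  refine lt_of_mul_lt_mul_right ?_ hV.le
  linarith

end Main

section Constant

lemma nine_div_four_le_one_add_inv_pow {n : ℕ} (hn : 2 ≤ n) :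
    (9 : ℝ) / 4 ≤ ((n : ℝ)⁻¹ + 1) ^ n := by
  have hn' : (2 : ℝ) ≤ n := by exact_mod_cast hn
  rw [add_pow]
  have hsub : Finset.range 3 ⊆ Finset.range (n + 1) :=
    Finset.range_subset_range.2 (by omega)
  refine le_trans ?_ (Finset.sum_le_sum_of_subset_of_nonneg hsub fun i _ _ => by positivity)
  simp only [Finset.sum_range_succ, Finset.sum_range_zero, Nat.cast_choose_two, Nat.choose_zero_right,
    Nat.choose_one_right, one_pow, mul_one, pow_zero, pow_one, Nat.cast_one, zero_add]
  rw [inv_mul_cancel₀ (by positivity)]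
  have h : ((n : ℝ)⁻¹) ^ 2 * (n * (n - 1) / 2) = 1 / 2 - (n : ℝ)⁻¹ / 2 := by
    field_simp
  have h2 : (n : ℝ)⁻¹ ≤ 1 / 2 := by rw [inv_le_comm₀ (by positivity) (by positivity)]; linarith
  rw [h]
  linarith

lemma two_thirds_le_gamma_ratio {n : ℕ} (hn : 2 ≤ n) :
    (2 : ℝ) / 3 ≤ (Real.Gamma n * Real.Gamma ((n + 1) / 2)) /
      (Real.Gamma (n + 1 / 2) * Real.Gamma (n / 2)) := by
  induction n using Nat.strong_induction_on with
  | _ n ih =>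
    obtain rfl | rfl | h4 : n = 2 ∨ n = 3 ∨ 4 ≤ n := by omega
    · have h1 : Real.Gamma (((2 : ℕ) : ℝ) + 1 / 2) = 3 / 2 * Real.Gamma (3 / 2) := by
        rw [← Real.Gamma_add_one (by norm_num)]; norm_num
      have h2 : (((2 : ℕ) : ℝ) + 1) / 2 = 3 / 2 := by norm_num
      have h3 := Real.Gamma_pos_of_pos (s := 3 / 2) (by norm_num)
      rw [h1, h2]
      norm_num [Real.Gamma_two]
      rw [div_mul_eq_div_div_swap, div_self h3.ne']
      norm_num
    · have e1 : Real.Gamma (((3 : ℕ) : ℝ) + 1 / 2) = 5 / 2 * (3 / 2 * (1 / 2 * √π)) := by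
        have h1 := Real.Gamma_add_one (s := 1 / 2) (by norm_num)
        have h2 := Real.Gamma_add_one (s := 3 / 2) (by norm_num)
        have h3 := Real.Gamma_add_one (s := 5 / 2) (by norm_num)
        norm_num at h1 h2 h3 ⊢
        rw [h3, h2, h1, Real.Gamma_one_half_eq]
      have e2 : Real.Gamma (((3 : ℕ) : ℝ) / 2) = 1 / 2 * √π := by
        rw [← Real.Gamma_one_half_eq, ← Real.Gamma_add_one (by norm_num)]
        norm_num
      have e3 : Real.Gamma ((3 : ℕ) : ℝ) = 2 := by
        have := Real.Gamma_nat_eq_factorial 2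
        norm_num [Nat.factorial] at this ⊢
      have e4 : Real.Gamma ((((3 : ℕ) : ℝ) + 1) / 2) = 1 := by
        norm_num [Real.Gamma_two]
      rw [e1, e2, e3, e4, le_div_iff₀ (by positivity)]
      have hp : √π * √π = π := Real.mul_self_sqrt Real.pi_pos.le
      nlinarith [Real.pi_lt_d2]
    · obtain ⟨m, rfl⟩ : ∃ m, n = m + 2 := ⟨n - 2, by omega⟩
      have hm : (2 : ℝ) ≤ m := by exact_mod_cast (by omega : 2 ≤ m)
      refine (ih m (by omega) (by omega)).trans ?_
      have g1 : Real.Gamma ((m + 2 : ℕ) : ℝ) = (m + 1) * (m * Real.Gamma m) := by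
        rw [← Real.Gamma_add_one (by positivity), ← Real.Gamma_add_one (by positivity)]
        push_cast
        congr 1; ring
      have g2 : Real.Gamma ((((m + 2 : ℕ) : ℝ) + 1) / 2) =
          (m + 1) / 2 * Real.Gamma ((m + 1) / 2) := by
        rw [← Real.Gamma_add_one (by positivity)]
        push_cast
        congr 1; ring
      have g3 : Real.Gamma (((m + 2 : ℕ) : ℝ) + 1 / 2) =
          (m + 1 / 2 + 1) * ((m + 1 / 2) * Real.Gamma (m + 1 / 2)) := by
        rw [← Real.Gamma_add_one (by positivity), ← Real.Gamma_add_one (by positivity)]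
        push_cast
        congr 1; ring
      have g4 : Real.Gamma (((m + 2 : ℕ) : ℝ) / 2) = m / 2 * Real.Gamma (m / 2) := by
        rw [← Real.Gamma_add_one (by positivity)]
        push_cast
        congr 1; ring
      have p1 := Real.Gamma_pos_of_pos (s := m) (by positivity)
      have p2 := Real.Gamma_pos_of_pos (s := ((m : ℝ) + 1) / 2) (by positivity)
      have p3 := Real.Gamma_pos_of_pos (s := (m : ℝ) + 1 / 2) (by positivity)
      have p4 := Real.Gamma_pos_of_pos (s := (m : ℝ) / 2) (by positivity)
      rw [g1, g2, g3, g4, div_le_div_iff₀ (by positivity) (by positivity)]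
      have hq : ((m : ℝ) + 1 / 2 + 1) * (m + 1 / 2) * (m / 2) ≤ (m + 1) * m * ((m + 1) / 2) := by
        nlinarith
      have hP : 0 ≤ Real.Gamma m * Real.Gamma (((m : ℝ) + 1) / 2) *
        (Real.Gamma (m + 1 / 2) * Real.Gamma (m / 2)) := by positivity
      linarith [mul_le_mul_of_nonneg_left hq hP]

lemma one_le_Kconst {n : ℕ} (hn : 2 ≤ n) : 1 ≤ Kconst n := by
  have hn0 : (0 : ℝ) < n := by positivity
  have h1 := two_thirds_le_gamma_ratio hn
  have h2 := nine_div_four_le_one_add_inv_pow hn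
  rw [Kconst]
  set B := (Real.Gamma n * Real.Gamma ((n + 1) / 2)) /
      (Real.Gamma (n + 1 / 2) * Real.Gamma (n / 2))
  have hr : ((n : ℝ) + 1) / n = (n : ℝ)⁻¹ + 1 := by field_simp; ring
  have hB : 0 < B := by linarith
  have hpow : (B ^ ((2 : ℝ) / n)) ^ n = B ^ 2 := by
    rw [← Real.rpow_natCast, ← Real.rpow_mul hB.le, div_mul_cancel₀ _ hn0.ne']
    norm_num
  rw [hr]
  by_contra! h
  have h3 := pow_lt_one₀ (by positivity) h (by omega : n ≠ 0)
  rw [mul_pow, hpow] at h3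
  nlinarith

end Constant

/-- **Main theorem.** For `n ≥ 2` and any metric `g = w² g₀` on `S^n` conformal
to the round metric, `λ₂(S^n,g) · Vol_g(S^n)^{2/n} < K_n · n · (2σ_n)^{2/n}`. -/
theorem second_eigenvalue_conformal_bound (n : ℕ) (hn : 2 ≤ n)
    (w : Eu n → ℝ) (hw : IsConformalFactor n w) :
    lambda2 n w * confVol n w ^ ((2 : ℝ) / n) <
      Kconst n * n * (2 * sigmaVol n) ^ ((2 : ℝ) / n) := by
  refine (lambda2_mul_confVol_lt hn hw).trans_le ?_
  have hs := sigmaVol_pos n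
  rw [mul_assoc]
  exact le_mul_of_one_le_left (by positivity) (one_le_Kconst hn)

end
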